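/- Let A be a commutative unital complex Banach algebra and n ≥ 1. Applying the Gelfand transform Γ coordinatewise gives a continuous map Aⁿ → C(Max(A), ℂ)ⁿ that maps Lcₙ(A) into Lcₙ(C(Max(A), ℂ)) and sends eₙ to eₙ. The restriction LΓₙ : Lcₙ(A)₀ → Lcₙ(C(Max(A), ℂ))₀ between the path components of eₙ is a homotopy equivalence: there is a continuous map h : Lcₙ(C(Max(A), ℂ))₀ → Lcₙ(A)₀ with h ∘ LΓₙ and LΓₙ ∘ h homotopic to the respective identity maps. -/

import Mathlib

section
universe u v

set_option linter.unusedSectionVars false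
set_option linter.unusedVariables false

theorem exists_completion {A : Type u} [CommRing A] [Algebra ℂ A] (p : RingSeminorm A)
    (hp : ∀ (c : ℂ) (a : A), p (c • a) ≤ ‖c‖ * p a) :
    ∃ (Q : Type u) (_ : NormedCommRing Q) (_ : NormedAlgebra ℂ Q) (_ : CompleteSpace Q)
      (j : A →ₐ[ℂ] Q), DenseRange j ∧ ∀ a, ‖j a‖ = p a := by
  let i1 : SeminormedCommRing A :=
    { p.toSeminormedRing with mul_comm := mul_comm }
  let i2 : NormedAlgebra ℂ A := { norm_smul_le := fun c a => hp c a }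
  refine ⟨UniformSpace.Completion A, inferInstance, inferInstance, inferInstance,
    { (UniformSpace.Completion.coeRingHom : A →+* UniformSpace.Completion A) with
      commutes' := fun c => rfl }, ?_, ?_⟩
  · exact UniformSpace.Completion.denseRange_coe
  · intro a
    exact UniformSpace.Completion.norm_coe a

inductive Cost {A : Type u} [NormedCommRing A] (f : Aˣ) (s : ℝ) : A → ℝ → Prop
  | mono (a : A) (k : ℤ) (α : ℝ) (h : ‖a‖ * Real.exp (k * s) ≤ α) :
      Cost f s (a * ((f ^ k : Aˣ) : A)) α
  | add (x y : A) (α β : ℝ) (hx : Cost f s x α) (hy : Cost f s y β) : Cost f s (x + y) (α + β)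

namespace Cost
variable {A : Type u} [NormedCommRing A] {f : Aˣ} {s : ℝ}

theorem nonneg {x : A} {α : ℝ} (h : Cost f s x α) : 0 ≤ α := by
  induction h with
  | mono a k α h => exact le_trans (by positivity) h
  | add x y α β _ _ h1 h2 => exact add_nonneg h1 h2

theorem of_norm (x : A) : Cost f s x ‖x‖ := by
  have := Cost.mono (f := f) (s := s) x 0 ‖x‖ (by simp)
  simpa using this

theorem neg {x : A} {α : ℝ} (h : Cost f s x α) : Cost f s (-x) α := by
  induction h with
  | mono a k α h =>
    have := Cost.mono (f := f) (s := s) (-a) k α (by simpa using h)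
    simpa using this
  | add x y α β _ _ h1 h2 => rw [neg_add]; exact Cost.add _ _ _ _ h1 h2

theorem mul {x y : A} {α β : ℝ} (hx : Cost f s x α) (hy : Cost f s y β) :
    Cost f s (x * y) (α * β) := by
  induction hx with
  | mono a k α h =>
    induction hy with
    | mono b l β h' =>
      have := Cost.mono (f := f) (s := s) (a * b) (k + l) (α * β) (by
        calc ‖a * b‖ * Real.exp ((k + l : ℤ) * s)
            ≤ (‖a‖ * ‖b‖) * Real.exp ((k + l : ℤ) * s) := by gcongr; exact norm_mul_le _ _
          _ = (‖a‖ * Real.exp (k * s)) * (‖b‖ * Real.exp (l * s)) := by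
            push_cast; rw [add_mul, Real.exp_add]; ring
          _ ≤ α * β := by
            gcongr
            exact le_trans (by positivity) h)
      rw [zpow_add] at this
      convert this using 1
      push_cast; ring
    | add x y α' β' _ _ h1 h2 => rw [mul_add, mul_add]; exact Cost.add _ _ _ _ h1 h2
  | add x y α' β' _ _ h1 h2 => rw [add_mul, add_mul]; exact Cost.add _ _ _ _ h1 h2

end Cost

noncomputable def costN {A : Type u} [NormedCommRing A] (f : Aˣ) (s : ℝ) (x : A) : ℝ :=
  sInf {α | Cost f s x α}

section
variable {A : Type u} [NormedCommRing A] {f : Aˣ} {s : ℝ}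

theorem costN_le {x : A} {α : ℝ} (h : Cost f s x α) : costN f s x ≤ α :=
  csInf_le ⟨0, fun _ h => h.nonneg⟩ h

theorem exists_cost {x : A} {η : ℝ} (h : costN f s x < η) : ∃ α < η, Cost f s x α := by
  obtain ⟨α, h1, h2⟩ := exists_lt_of_csInf_lt ⟨_, Cost.of_norm x⟩ h
  exact ⟨α, h2, h1⟩

theorem le_costN {x : A} {c : ℝ} (h : ∀ α, Cost f s x α → c ≤ α) : c ≤ costN f s x :=
  le_csInf ⟨_, Cost.of_norm x⟩ h

theorem costN_nonneg (x : A) : 0 ≤ costN f s x := le_costN fun _ h => h.nonneg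

variable (f s) in
noncomputable def costSeminorm : RingSeminorm A where
  toFun := costN f s
  map_zero' := le_antisymm (by simpa using costN_le (f := f) (s := s) (Cost.of_norm (0 : A)))
    (costN_nonneg _)
  add_le' x y := by
    refine le_of_forall_pos_lt_add fun ε hε => ?_
    obtain ⟨α, h1, h2⟩ := exists_cost (x := x) (f := f) (s := s) (lt_add_of_pos_right _ (half_pos hε))
    obtain ⟨β, h3, h4⟩ := exists_cost (x := y) (f := f) (s := s) (lt_add_of_pos_right _ (half_pos hε))
    have := costN_le (Cost.add _ _ _ _ h2 h4)
    linarith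
  neg' x := le_antisymm (le_costN fun α h => costN_le h.neg)
    (le_costN fun α h => by simpa using costN_le h.neg)
  mul_le' x y := by
    have key : ∀ α, Cost f s x α → costN f s (x * y) ≤ α * costN f s y := by
      intro α h
      rcases h.nonneg.eq_or_lt with h0 | h0
      · subst h0
        have := costN_le (h.mul (Cost.of_norm y))
        simpa using this
      · rw [← div_le_iff₀' h0]
        refine le_costN fun β h' => ?_
        rw [div_le_iff₀' h0]
        exact costN_le (h.mul h')
    rcases (costN_nonneg (f := f) (s := s) y).eq_or_lt with h0 | h0
    · have := key _ (Cost.of_norm x)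
      rw [← h0] at this ⊢
      simpa using this
    · rw [← div_le_iff₀ h0]
      refine le_costN fun α h => ?_
      rw [div_le_iff₀ h0]
      exact key α h

theorem costSeminorm_apply (x : A) : costSeminorm f s x = costN f s x := rfl

end

section Q
variable {X : Type v} [TopologicalSpace X] [CompactSpace X]
  {A : Type u} [NormedCommRing A] [NormedAlgebra ℂ A]

theorem norm_zpow_apply (G : A →ₐ[ℂ] C(X, ℂ)) (f : Aˣ) (r : X → ℝ)
    (hr : ∀ x, ‖G f x‖ = Real.exp (r x)) (k : ℤ) (x : X) :
    ‖G ((f ^ k : Aˣ) : A) x‖ = Real.exp (k * r x) := by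
  let ev : A →* ℂ := ((ContinuousMap.evalAlgHom ℂ ℂ x).comp G : A →ₐ[ℂ] ℂ)
  have h : G ((f ^ k : Aˣ) : A) x = (Units.map ev (f ^ k) : ℂˣ) := rfl
  rw [h, map_zpow, Units.val_zpow_eq_zpow_val, norm_zpow]
  have : ‖((Units.map ev f : ℂˣ) : ℂ)‖ = Real.exp (r x) := hr x
  rw [this, mul_comm, Real.exp_mul, Real.rpow_intCast]

theorem cost_split (G : A →ₐ[ℂ] C(X, ℂ)) (hG : ∀ a, ‖G a‖ ≤ ‖a‖) (f : Aˣ) (r : X → ℝ)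
    (hr : ∀ x, ‖G f x‖ = Real.exp (r x)) (s : ℝ) {a : A} {α : ℝ} (h : Cost f s a α) :
    ∃ a₁ a₂ : A, a = a₁ + a₂ ∧ costN f s a₁ ≤ α ∧ (∀ x, r x ≤ s → ‖G a₁ x‖ ≤ α) ∧
      (∀ x, s ≤ r x → ‖G a₂ x‖ ≤ α) := by
  induction h with
  | mono a k α h =>
    have hα : 0 ≤ α := le_trans (by positivity) h
    have hb : ∀ x, ‖G (a * ((f ^ k : Aˣ) : A)) x‖ ≤ ‖a‖ * Real.exp (k * r x) := by
      intro x
      rw [map_mul, ContinuousMap.mul_apply, norm_mul, norm_zpow_apply G f r hr]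
      gcongr
      exact ((G a).norm_coe_le_norm x).trans (hG a)
    rcases le_total 0 k with hk | hk
    · refine ⟨_, 0, (add_zero _).symm, costN_le (Cost.mono a k α h), fun x hx => ?_,
        fun x _ => by simpa using hα⟩
      refine (hb x).trans (le_trans ?_ h)
      have : (0 : ℝ) ≤ k := by exact_mod_cast hk
      gcongr
    · refine ⟨0, _, (zero_add _).symm, ?_, fun x _ => by simpa using hα, fun x hx => ?_⟩
      · exact (costN_le (Cost.of_norm 0)).trans (by simpa using hα)
      refine (hb x).trans (le_trans ?_ h)
      have : (k : ℝ) ≤ 0 := by exact_mod_cast hk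
      have := mul_le_mul_of_nonpos_left hx this
      gcongr
  | add x y α β h1 h2 ih1 ih2 =>
    obtain ⟨a₁, a₂, e, h1, h2, h3⟩ := ih1
    obtain ⟨b₁, b₂, e', h1', h2', h3'⟩ := ih2
    refine ⟨a₁ + b₁, a₂ + b₂, by rw [e, e']; ring, ?_, ?_, ?_⟩
    · exact ((costSeminorm f s).add_le' a₁ b₁).trans (add_le_add h1 h1')
    · intro x hx
      rw [map_add, ContinuousMap.add_apply]
      exact (norm_add_le _ _).trans (add_le_add (h2 x hx) (h2' x hx))
    · intro x hx
      rw [map_add, ContinuousMap.add_apply]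
      exact (norm_add_le _ _).trans (add_le_add (h3 x hx) (h3' x hx))

theorem cost_eval (G : A →ₐ[ℂ] C(X, ℂ)) (hG : ∀ a, ‖G a‖ ≤ ‖a‖) (f : Aˣ) (r : X → ℝ)
    (hr : ∀ x, ‖G f x‖ = Real.exp (r x)) (s : ℝ) (x : X) (hx : r x = s) {a : A} {α : ℝ}
    (h : Cost f s a α) : ‖G a x‖ ≤ α := by
  induction h with
  | mono a k α h =>
    rw [map_mul, ContinuousMap.mul_apply, norm_mul, norm_zpow_apply G f r hr, hx]
    refine le_trans ?_ h
    gcongr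
    exact ((G a).norm_coe_le_norm x).trans (hG a)
  | add x y α β h1 h2 ih1 ih2 =>
    rw [map_add, ContinuousMap.add_apply]
    exact (norm_add_le _ _).trans (add_le_add ih1 ih2)

theorem exists_Q (G : A →ₐ[ℂ] C(X, ℂ)) (hG : ∀ a, ‖G a‖ ≤ ‖a‖) (h1 : ‖(1 : A)‖ ≤ 1)
    (nat : ∀ χ : A →ₐ[ℂ] ℂ, (∀ a, ‖χ a‖ ≤ ‖a‖) → ∃ x, ∀ a, χ a = G a x)
    (f : Aˣ) (r : X → ℝ) (hr : ∀ x, ‖G f x‖ = Real.exp (r x)) (s : ℝ) :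
    ∃ (Q : Type u) (_ : NormedCommRing Q) (_ : NormedAlgebra ℂ Q) (_ : CompleteSpace Q)
      (j : A →ₐ[ℂ] Q), DenseRange j ∧ (∀ a, ‖j a‖ ≤ ‖a‖) ∧
      (∀ a η, ‖j a‖ < η → ∃ a₁ a₂ : A, a = a₁ + a₂ ∧ ‖j a₁‖ ≤ η ∧
        (∀ x, r x ≤ s → ‖G a₁ x‖ ≤ η) ∧ (∀ x, s ≤ r x → ‖G a₂ x‖ ≤ η)) ∧
      (∀ a x, r x = s → ‖G a x‖ ≤ ‖j a‖) ∧
      (∀ χ : Q →ₐ[ℂ] ℂ, ∃ x, r x = s ∧ ∀ a, χ (j a) = G a x) := by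
  have hle : ∀ a : A, costN f s a ≤ ‖a‖ := fun a => costN_le (Cost.of_norm a)
  have hsm : ∀ (c : ℂ) (a : A), costSeminorm f s (c • a) ≤ ‖c‖ * costSeminorm f s a := by
    intro c a
    have h2 := (costSeminorm f s).mul_le' (c • (1 : A)) a
    rw [smul_one_mul] at h2
    refine h2.trans (mul_le_mul_of_nonneg_right ?_ (costN_nonneg a))
    refine (hle _).trans ?_
    rw [norm_smul]
    exact mul_le_of_le_one_right (norm_nonneg _) h1
  obtain ⟨Q, iQ1, iQ2, iQ3, j, hd, hj⟩ := exists_completion (costSeminorm f s) hsm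
  have hj' : ∀ a, ‖j a‖ = costN f s a := hj
  refine ⟨Q, iQ1, iQ2, iQ3, j, hd, fun a => (hj' a).trans_le (hle a), ?_, ?_, ?_⟩
  · intro a η h
    rw [hj'] at h
    obtain ⟨α, hα, hc⟩ := exists_cost h
    obtain ⟨a₁, a₂, e, h1, h2, h3⟩ := cost_split G hG f r hr s hc
    exact ⟨a₁, a₂, e, by rw [hj']; linarith, fun x hx => (h2 x hx).trans hα.le,
      fun x hx => (h3 x hx).trans hα.le⟩
  · intro a x hx
    rw [hj']
    exact le_costN fun α h => cost_eval G hG f r hr s x hx h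
  · intro χ
    have hone : ‖(1 : Q)‖ ≤ 1 := by
      rw [← map_one j, hj']; exact (hle 1).trans h1
    have hχ : ∀ a, ‖χ (j a)‖ ≤ costN f s a := by
      intro a
      have := AlgHom.norm_apply_le_self_mul_norm_one χ (j a)
      refine this.trans ?_
      rw [← hj']
      exact mul_le_of_le_one_right (norm_nonneg _) hone
    obtain ⟨x, hx⟩ := nat (χ.comp j) (fun a => (hχ a).trans (hle a))
    refine ⟨x, ?_, hx⟩
    have key : ∀ k : ℤ, Real.exp (k * r x) ≤ Real.exp (k * s) := by
      intro k
      rw [← norm_zpow_apply G f r hr, ← hx]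
      refine (hχ _).trans ?_
      have := Cost.mono (f := f) (s := s) 1 k (Real.exp (k * s))
        (mul_le_of_le_one_left (Real.exp_pos _).le h1)
      rw [one_mul] at this
      exact costN_le this
    have k1 := key 1
    have k2 := key (-1)
    rw [Real.exp_le_exp] at k1 k2
    push_cast at k1 k2
    linarith

theorem unit_ideal {Q : Type u} [NormedCommRing Q] [NormedAlgebra ℂ Q] [CompleteSpace Q]
    {ι : Type*} [Fintype ι] (q : ι → Q)
    (h : ∀ χ : Q →ₐ[ℂ] ℂ, ∃ i, χ (q i) ≠ 0) : ∃ y : ι → Q, ∑ i, y i * q i = 1 := by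
  by_contra hcon
  have hI : Ideal.span (Set.range q) ≠ ⊤ := by
    intro hI
    rw [Ideal.eq_top_iff_one, Ideal.mem_span_range_iff_exists_fun] at hI
    exact hcon hI
  obtain ⟨M, hM, hIM⟩ := Ideal.exists_le_maximal _ hI
  obtain ⟨i, hi⟩ := h (WeakDual.CharacterSpace.equivAlgHom (Ideal.toCharacterSpace M))
  exact hi (Ideal.toCharacterSpace_apply_eq_zero_of_mem M (hIM (Ideal.subset_span ⟨i, rfl⟩)))

end Q

end

section
open Topology

set_option linter.unusedSectionVars false

theorem clopen_all {T : Type*} [TopologicalSpace T] [PreconnectedSpace T] (P : T → Prop)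
    (h : ∀ t₀, ∀ᶠ t in 𝓝 t₀, (P t ↔ P t₀)) {a : T} (ha : P a) (b : T) : P b := by
  have h1 : IsClopen {t | P t} := by
    constructor
    · rw [← isOpen_compl_iff, isOpen_iff_mem_nhds]
      intro t ht
      filter_upwards [h t] with t' ht'
      exact fun h' => ht (ht'.1 h')
    · rw [isOpen_iff_mem_nhds]
      intro t ht
      filter_upwards [h t] with t' ht'
      exact ht'.2 ht
  have := h1.eq_univ ⟨a, ha⟩
  exact (this ▸ Set.mem_univ b : b ∈ {t | P t})

theorem closure_units_mem_nhds {R S : Type*} [NormedRing R] [NormedAlgebra ℂ R] [CompleteSpace R]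
    [NormedRing S] [NormedAlgebra ℂ S] [CompleteSpace S] (j : R →+* S) (hj : Continuous j)
    (hd : DenseRange j) :
    (((Units.map (j : R →* S)).range.topologicalClosure : Subgroup Sˣ) : Set Sˣ) ∈ 𝓝 1 := by
  let _ : NormedAlgebra ℚ R := NormedAlgebra.restrictScalars ℚ ℂ R
  let _ : NormedAlgebra ℚ S := NormedAlgebra.restrictScalars ℚ ℂ S
  have h1 : Filter.map (NormedSpace.exp : S → S) (𝓝 0) = 𝓝 (NormedSpace.exp 0) :=
    (hasStrictFDerivAt_exp_zero (𝕂 := ℂ) (𝔸 := S)).map_nhds_eq_of_equiv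
      (f' := ContinuousLinearEquiv.refl ℂ S)
  rw [NormedSpace.exp_zero] at h1
  have h2 : Set.range (NormedSpace.exp : S → S) ∈ 𝓝 (1 : S) := by
    rw [← h1]; exact Filter.range_mem_map
  have h3 : (fun u : Sˣ => (u : S)) ⁻¹' Set.range (NormedSpace.exp : S → S) ∈ 𝓝 (1 : Sˣ) :=
    Units.continuous_val.continuousAt h2
  refine Filter.mem_of_superset h3 ?_
  rintro u ⟨m, hm⟩
  change u ∈ closure (((Units.map (j : R →* S)).range : Subgroup Sˣ) : Set Sˣ)
  rw [Units.isOpenEmbedding_val.isInducing.closure_eq_preimage_closure_image]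
  change (u : S) ∈ closure _
  have hm' : NormedSpace.exp m = (u : S) := hm
  rw [← hm']
  have hc : Continuous (NormedSpace.exp : S → S) := NormedSpace.exp_continuous
  have : NormedSpace.exp m ∈ closure (NormedSpace.exp '' Set.range j) :=
    image_closure_subset_closure_image hc ⟨m, hd m, rfl⟩
  refine closure_mono ?_ this
  rintro _ ⟨_, ⟨a, rfl⟩, rfl⟩
  rw [← NormedSpace.map_exp j hj a]
  obtain ⟨v, hv⟩ := NormedSpace.isUnit_exp a
  exact ⟨Units.map (j : R →* S) v, ⟨v, rfl⟩, by simp [hv]⟩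

open scoped Matrix Matrix.Norms.Operator unitInterval

section
variable {ι : Type*} [Fintype ι] [DecidableEq ι]

theorem matrix_complete (S : Type*) [NormedCommRing S] [CompleteSpace S] :
    @CompleteSpace (Matrix ι ι S) (@PseudoMetricSpace.toUniformSpace _
      (@SeminormedRing.toPseudoMetricSpace _ (NormedRing.toSeminormedRing))) :=
  inferInstanceAs (CompleteSpace (ι → ι → S))

attribute [local instance] matrix_complete

theorem orbit_path {S : Type*} [NormedCommRing S] [NormedAlgebra ℂ S] [CompleteSpace S]
    (H : Subgroup (Matrix ι ι S)ˣ) (hH : (H : Set (Matrix ι ι S)ˣ) ∈ 𝓝 1)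
    (w : I → ι → S) (hw : Continuous w) (hu : ∀ t, ∃ y : ι → S, y ⬝ᵥ w t = 1) :
    ∃ U ∈ H, (U : Matrix ι ι S) *ᵥ w 0 = w 1 := by
  refine clopen_all (fun t => ∃ U ∈ H, (U : Matrix ι ι S) *ᵥ w 0 = w t) ?_
    (a := 0) ⟨1, H.one_mem, by simp⟩ 1
  intro t₀
  obtain ⟨y, hy⟩ := hu t₀
  have h1 : (Units.val '' (H : Set (Matrix ι ι S)ˣ)) ∈ 𝓝 (1 : Matrix ι ι S) := by
    have := (Units.isOpenEmbedding_val (R := Matrix ι ι S)).map_nhds_eq 1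
    rw [Units.val_one] at this
    have h0 := Filter.image_mem_map (m := Units.val) hH
    exact Filter.mem_of_superset (this.ge h0) subset_rfl
  have h2 : Continuous (fun t => (1 + Matrix.vecMulVec (w t - w t₀) y : Matrix ι ι S)) := by
    fun_prop
  have h3 := h2.continuousAt (x := t₀)
  have h4 : (1 + Matrix.vecMulVec (w t₀ - w t₀) y : Matrix ι ι S) = 1 := by
    simp
  rw [ContinuousAt, h4] at h3
  filter_upwards [h3 h1] with t ht
  obtain ⟨V, hV, hV'⟩ := ht
  have h5 : (V : Matrix ι ι S) *ᵥ w t₀ = w t := by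
    rw [hV', Matrix.add_mulVec, Matrix.one_mulVec, Matrix.vecMulVec_mulVec, hy]
    simp
  constructor
  · rintro ⟨U, hU, e⟩
    refine ⟨V⁻¹ * U, H.mul_mem (H.inv_mem hV) hU, ?_⟩
    rw [Units.val_mul, ← Matrix.mulVec_mulVec, e, ← h5, Matrix.mulVec_mulVec]
    simp
  · rintro ⟨U, hU, e⟩
    refine ⟨V * U, H.mul_mem hV hU, ?_⟩
    rw [Units.val_mul, ← Matrix.mulVec_mulVec, e, ← h5]

theorem dense_matrix {R S : Type*} [NormedCommRing R] [NormedCommRing S]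
    (j : R →+* S) (hd : DenseRange j) : DenseRange (j.mapMatrix (m := ι)) := by
  have : DenseRange (fun (M : ι → ι → R) => fun a b => j (M a b)) :=
    DenseRange.piMap fun _ => DenseRange.piMap fun _ => hd
  exact this

theorem dense_path {A Q : Type*} [NormedCommRing A] [NormedAlgebra ℂ A]
    [NormedCommRing Q] [NormedAlgebra ℂ Q] (j : A →ₐ[ℂ] Q) (hj : Continuous j)
    (hd : DenseRange j) : DenseRange (ContinuousMap.comp (⟨j, hj⟩ : C(A, Q)) : C(I, A) → C(I, Q)) := by
  let _ : NormedSpace ℝ A := NormedSpace.restrictScalars ℝ ℂ A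
  let _ : NormedSpace ℝ Q := NormedSpace.restrictScalars ℝ ℂ Q
  rw [Metric.denseRange_iff]
  intro F ε hε
  obtain ⟨g, hg⟩ := exists_continuous_forall_mem_convex_of_local_const (X := I) (E := A)
    (t := fun t => {a | j a ∈ Metric.ball (F t) (ε / 2)}) (by
      intro t
      have := (convex_ball (F t) (ε / 2)).is_linear_preimage (f := j)
        (IsLinearMap.mk (map_add j) (fun c a => by
          have := map_smul j (c : ℂ) a
          simpa using this))
      exact this) (by
      intro t
      obtain ⟨a, ha⟩ := Metric.denseRange_iff.1 hd (F t) (ε / 2) (half_pos hε)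
      refine ⟨a, ?_⟩
      have : Continuous fun t => dist (j a) (F t) := by fun_prop
      rw [dist_comm] at ha
      exact (this.continuousAt (x := t)).eventually_lt continuousAt_const ha)
  refine ⟨g, ?_⟩
  rw [dist_comm]
  refine lt_of_le_of_lt ((ContinuousMap.dist_le (half_pos hε).le).2 fun t => (hg t).le) (half_lt_self hε)

theorem unimod_path {Q : Type*} [NormedCommRing Q] [NormedAlgebra ℂ Q] [CompleteSpace Q]
    (v : I → ι → Q) (hv : Continuous v) (hu : ∀ t, ∃ y : ι → Q, y ⬝ᵥ v t = 1) :
    ∃ y : I → ι → Q, Continuous y ∧ ∀ t, y t ⬝ᵥ v t = 1 := by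
  let _ : NormedSpace ℝ Q := NormedSpace.restrictScalars ℝ ℂ Q
  obtain ⟨g, hg⟩ := exists_continuous_forall_mem_convex_of_local_const (X := I) (E := ι → Q)
    (t := fun t => {y | y ⬝ᵥ v t ∈ Metric.ball (1 : Q) 1}) (by
      intro t
      exact (convex_ball (1 : Q) 1).is_linear_preimage (f := fun y : ι → Q => y ⬝ᵥ v t)
        (IsLinearMap.mk (fun a b => add_dotProduct a b _) (fun c a => by
          simp [dotProduct, Finset.smul_sum]))) (by
      intro t
      obtain ⟨y, hy⟩ := hu t
      refine ⟨y, ?_⟩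
      have : Continuous fun t => dist (y ⬝ᵥ v t) 1 := by
        simp only [dotProduct]; fun_prop
      exact (this.continuousAt (x := t)).eventually_lt continuousAt_const (by rw [hy]; simp))
  have hunit : ∀ t, IsUnit (g t ⬝ᵥ v t) := by
    intro t
    have h1 : ‖1 - g t ⬝ᵥ v t‖ < 1 := by
      have := hg t
      rw [Set.mem_ofPred, mem_ball_iff_norm, norm_sub_rev] at this
      exact this
    have := isUnit_one_sub_of_norm_lt_one h1
    simpa using this
  refine ⟨fun t => Ring.inverse (g t ⬝ᵥ v t) • g t, ?_, fun t => ?_⟩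
  · have hc : Continuous fun t => g t ⬝ᵥ v t := by
      simp only [dotProduct]; fun_prop
    have hg' : Continuous fun t => g t := g.continuous
    refine continuous_pi fun i => ?_
    simp only [Pi.smul_apply, smul_eq_mul]
    refine Continuous.mul ?_ (by fun_prop)
    rw [continuous_iff_continuousAt]
    intro t
    obtain ⟨u, hu⟩ := hunit t
    have h2 := NormedRing.inverse_continuousAt u
    rw [hu] at h2
    exact ContinuousAt.comp (f := fun t => g t ⬝ᵥ v t) h2 hc.continuousAt
  · rw [smul_dotProduct, smul_eq_mul, Ring.inverse_mul_cancel _ (hunit t)]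

end

end

section
open Topology
set_option linter.unusedSectionVars false
open scoped Matrix Matrix.Norms.Operator unitInterval

section
variable {ι : Type*} [Fintype ι] [DecidableEq ι]

attribute [local instance] matrix_complete

/-- evaluation of continuous functions as a ring hom -/
noncomputable def evR {T : Type*} [TopologicalSpace T] (Q : Type*) [NormedCommRing Q] (t : T) :
    C(T, Q) →+* Q where
  toFun f := f t
  map_one' := rfl
  map_mul' _ _ := rfl
  map_zero' := rfl
  map_add' _ _ := rfl

noncomputable def constR (T : Type*) [TopologicalSpace T] (Q : Type*) [NormedCommRing Q] :
    Q →+* C(T, Q) where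
  toFun q := ContinuousMap.const T q
  map_one' := rfl
  map_mul' _ _ := rfl
  map_zero' := rfl
  map_add' _ _ := rfl

noncomputable def compR (T : Type*) [TopologicalSpace T] {A Q : Type*} [NormedCommRing A]
    [NormedCommRing Q] (j : A →+* Q) (hj : Continuous j) : C(T, A) →+* C(T, Q) where
  toFun q := (⟨j, hj⟩ : C(A, Q)).comp q
  map_one' := by ext; simp
  map_mul' _ _ := by ext; simp
  map_zero' := by ext; simp
  map_add' _ _ := by ext; simp

theorem continuous_matrix_map {R S : Type*} [NormedCommRing R] [NormedCommRing S]
    (j : R →+* S) (hj : Continuous j) : Continuous (j.mapMatrix (m := ι)) :=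
  continuous_id.matrix_map hj

theorem track {A Q : Type*} [NormedCommRing A] [NormedAlgebra ℂ A] [CompleteSpace A]
    [NormedCommRing Q] [NormedAlgebra ℂ Q] [CompleteSpace Q] (j : A →ₐ[ℂ] Q) (hj : Continuous j)
    (hd : DenseRange j) (v : I → ι → Q) (hv : Continuous v)
    (hu : ∀ t, ∃ y : ι → Q, y ⬝ᵥ v t = 1) {ε : ℝ} (hε : 0 < ε) :
    ∃ û : I → Matrix ι ι A, Continuous û ∧ û 0 = 1 ∧ (∀ t, IsUnit (û t)) ∧
      ∀ t, ‖(û t).map j *ᵥ v 0 - v t‖ < ε := by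
  let J : C(I, A) →+* C(I, Q) := compR I (j : A →+* Q) hj
  have hJ : Continuous J := ContinuousMap.continuous_postcomp _
  have hJd : DenseRange J := dense_path j hj hd
  have hH := closure_units_mem_nhds (J.mapMatrix (m := ι)) (continuous_matrix_map J hJ)
    (dense_matrix J hJd)
  have hm : Continuous fun p : I × I => v (p.1 * p.2) := by fun_prop
  let w : I → ι → C(I, Q) := fun τ i => ⟨fun t => v (τ * t) i, by fun_prop⟩
  have hw : Continuous w := by
    refine continuous_pi fun i => ?_
    exact ContinuousMap.continuous_of_continuous_uncurry _
      (by change Continuous fun p : I × I => v (p.1 * p.2) i; fun_prop)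
  obtain ⟨U, hU, hUw⟩ := orbit_path _ hH w hw (by
    intro τ
    obtain ⟨y, hy, hy'⟩ := unimod_path (fun t => v (τ * t)) (by fun_prop) (fun t => hu _)
    refine ⟨fun i => ⟨fun t => y t i, by fun_prop⟩, ?_⟩
    ext t
    have := hy' t
    simp only [dotProduct] at this ⊢
    simpa [w] using this)
  let E : C(I, Q) →+* C(I, Q) := (constR I Q).comp (evR Q 0)
  have hE : Continuous E := by
    have : Continuous fun f : C(I, Q) => ContinuousMap.const I (f 0) := by fun_prop
    exact this
  let E' : (Matrix ι ι C(I, Q))ˣ →* (Matrix ι ι C(I, Q))ˣ :=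
    Units.map (E.mapMatrix (m := ι) : Matrix ι ι C(I, Q) →* Matrix ι ι C(I, Q))
  have hE' : Continuous E' := Continuous.units_map _ (continuous_matrix_map E hE)
  let F : (Matrix ι ι C(I, Q))ˣ → (ι → C(I, Q)) := fun V =>
    ((V * (E' V)⁻¹ : (Matrix ι ι C(I, Q))ˣ) : Matrix ι ι C(I, Q)) *ᵥ w 0
  have hF : Continuous F := by
    have : Continuous fun V => ((V * (E' V)⁻¹ : (Matrix ι ι C(I, Q))ˣ) : Matrix ι ι C(I, Q)) :=
      Units.continuous_val.comp (continuous_id.mul hE'.inv)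
    exact Continuous.matrix_mulVec this continuous_const
  have hFU : F U = w 1 := by
    have h1 : (E' U : Matrix ι ι C(I, Q)) *ᵥ w 0 = w 0 := by
      have h2 : (E' U : Matrix ι ι C(I, Q)) *ᵥ w 0 = E ∘ ((U : Matrix ι ι C(I, Q)) *ᵥ w 0) := by
        have h3 : (w 0 : ι → C(I, Q)) = E ∘ w 0 := by
          ext i t; change v (0 * t) i = v (0 * 0) i; simp
        conv_lhs => rw [h3]
        funext i
        simp only [Matrix.mulVec, dotProduct, Function.comp, map_sum, map_mul]
        rfl
      rw [h2, hUw]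
      ext i t; change v (1 * 0) i = v (0 * t) i; simp
    have h4 : ((E' U)⁻¹ : (Matrix ι ι C(I, Q))ˣ).val *ᵥ w 0 = w 0 := by
      conv_lhs => rw [← h1]
      rw [Matrix.mulVec_mulVec, Units.inv_mul, Matrix.one_mulVec]
    simp only [F]
    rw [Units.val_mul, ← Matrix.mulVec_mulVec, h4, hUw]
  have hopen : IsOpen (F ⁻¹' Metric.ball (w 1) ε) := Metric.isOpen_ball.preimage hF
  obtain ⟨V, hV, ⟨a, rfl⟩⟩ := mem_closure_iff.1 hU _ hopen
    (by rw [Set.mem_preimage, hFU]; exact Metric.mem_ball_self hε)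
  let EA : C(I, A) →+* C(I, A) := (constR I A).comp (evR A 0)
  let EA' : (Matrix ι ι C(I, A))ˣ →* (Matrix ι ι C(I, A))ˣ :=
    Units.map (EA.mapMatrix (m := ι) : Matrix ι ι C(I, A) →* Matrix ι ι C(I, A))
  let b : (Matrix ι ι C(I, A))ˣ := a * (EA' a)⁻¹
  have hb : (b : Matrix ι ι C(I, A)).map J *ᵥ w 0 =
      F (Units.map (J.mapMatrix (m := ι) : Matrix ι ι C(I, A) →* Matrix ι ι C(I, Q)) a) := by
    have h5 : Units.map (J.mapMatrix (m := ι) : Matrix ι ι C(I, A) →* Matrix ι ι C(I, Q)) (EA' a) =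
        E' (Units.map (J.mapMatrix (m := ι) : Matrix ι ι C(I, A) →* Matrix ι ι C(I, Q)) a) := by
      apply Units.ext
      rfl
    have h6 : Units.map (J.mapMatrix (m := ι) : Matrix ι ι C(I, A) →* Matrix ι ι C(I, Q)) b =
      (Units.map (J.mapMatrix (m := ι) : Matrix ι ι C(I, A) →* Matrix ι ι C(I, Q)) a) *
      (E' (Units.map (J.mapMatrix (m := ι) : Matrix ι ι C(I, A) →* Matrix ι ι C(I, Q)) a))⁻¹ := by
      rw [← h5]; simp [b]
    simp only [F]
    rw [← h6]
    rfl
  refine ⟨fun t => (b : Matrix ι ι C(I, A)).map (evR A t), ?_, ?_, ?_, ?_⟩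
  · refine continuous_matrix fun i k => ?_
    exact (b.val i k).continuous
  · have h7 : Units.map ((evR A (0 : I)).mapMatrix (m := ι) : Matrix ι ι C(I, A) →* Matrix ι ι A) b = 1 := by
      simp only [b, map_mul, map_inv]
      rw [mul_inv_eq_one]
      apply Units.ext
      rfl
    have := congrArg Units.val h7
    exact this
  · intro t
    exact ⟨Units.map ((evR A t).mapMatrix (m := ι) : Matrix ι ι C(I, A) →* Matrix ι ι A) b, rfl⟩
  · intro t
    rw [Set.mem_preimage, ← hb, mem_ball_iff_norm] at hV
    rw [pi_norm_lt_iff hε] at hV ⊢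
    intro i
    have h8 := lt_of_le_of_lt (ContinuousMap.norm_coe_le_norm _ t) (hV i)
    have e1 : (evR Q t) (((b : Matrix ι ι C(I, A)).map J *ᵥ w 0) i) =
        (((b : Matrix ι ι C(I, A)).map (evR A t)).map j *ᵥ v 0) i := by
      simp only [Matrix.mulVec, dotProduct, map_sum, map_mul]
      refine Finset.sum_congr rfl fun k _ => ?_
      congr 1
      change v (0 * t) k = v 0 k
      simp
    have e2 : w 1 i t = v t i := by
      change v (1 * t) i = v t i
      simp
    rw [Pi.sub_apply, ← e1, ← e2]
    exact h8

end

end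

section
open Topology
set_option linter.unusedSectionVars false
open scoped Matrix Matrix.Norms.Operator unitInterval

section
variable {ι : Type*} [Fintype ι] [DecidableEq ι]

theorem entry_le_norm {Q : Type*} [NormedCommRing Q] (M : Matrix ι ι Q) (i k : ι) :
    ‖M i k‖ ≤ ‖M‖ := by
  rw [Matrix.linfty_opNorm_def]
  have h1 : ∑ j, ‖M i j‖₊ ≤ Finset.univ.sup fun i => ∑ j, ‖M i j‖₊ :=
    Finset.le_sup (f := fun i => ∑ j, ‖M i j‖₊) (Finset.mem_univ i)
  have h2 : ‖M i k‖₊ ≤ ∑ j, ‖M i j‖₊ :=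
    Finset.single_le_sum (f := fun j => ‖M i j‖₊) (fun _ _ => zero_le) (Finset.mem_univ k)
  exact_mod_cast h2.trans h1

theorem mat_norm_le {Q : Type*} [NormedCommRing Q] (M : Matrix ι ι Q) {η : ℝ} (hη : 0 ≤ η)
    (h : ∀ i k, ‖M i k‖ ≤ η) : ‖M‖ ≤ Fintype.card ι * η := by
  rw [Matrix.linfty_opNorm_def]
  lift η to NNReal using hη
  have : (Finset.univ.sup fun i => ∑ j, ‖M i j‖₊) ≤ Fintype.card ι * η := by
    refine Finset.sup_le fun i _ => ?_
    calc ∑ j, ‖M i j‖₊ ≤ ∑ _j : ι, η := Finset.sum_le_sum fun k _ => by exact_mod_cast h i k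
      _ = _ := by simp
  exact_mod_cast this

theorem map_mulVec' {A B : Type*} [CommRing A] [CommRing B] (φ : A →+* B) (M : Matrix ι ι A)
    (v : ι → A) : φ ∘ (M *ᵥ v) = M.map φ *ᵥ (φ ∘ v) := by
  funext i; exact RingHom.map_mulVec φ M v i

section cartan
variable {X : Type*} {A Q : Type*} [NormedCommRing A] [NormedCommRing Q]
  (j : A →+* Q) (φ : X → A →+* ℂ) (r : X → ℝ) (s : ℝ)
  (split : ∀ a η, ‖j a‖ < η → ∃ a₁ a₂ : A, a = a₁ + a₂ ∧ ‖j a₁‖ ≤ η ∧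
        (∀ x, r x ≤ s → ‖φ x a₁‖ ≤ η) ∧ (∀ x, s ≤ r x → ‖φ x a₂‖ ≤ η))

include split in
theorem mat_split (κ : Matrix ι ι A) (η : ℝ) (h : ‖κ.map j‖ < η) :
    ∃ κ₁ κ₂ : Matrix ι ι A, κ = κ₁ + κ₂ ∧ ‖κ₁.map j‖ ≤ Fintype.card ι * η ∧
      (∀ x, r x ≤ s → ‖κ₁.map (φ x)‖ ≤ Fintype.card ι * η) ∧
      (∀ x, s ≤ r x → ‖κ₂.map (φ x)‖ ≤ Fintype.card ι * η) := by
  have hη : 0 ≤ η := (norm_nonneg _).trans h.le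
  choose a b h1 h2 h3 h4 using fun i k =>
    split (κ i k) η (lt_of_le_of_lt (entry_le_norm (κ.map j) i k) h)
  refine ⟨Matrix.of a, Matrix.of b, ?_, ?_, fun x hx => ?_, fun x hx => ?_⟩
  · ext i k; simp [h1]
  · exact mat_norm_le _ hη fun i k => h2 i k
  · exact mat_norm_le _ hη fun i k => h3 i k x hx
  · exact mat_norm_le _ hη fun i k => h4 i k x hx

theorem mm_mul {A B : Type*} [CommRing A] [CommRing B] (φ : A →+* B) (M N : Matrix ι ι A) :
    (M * N).map φ = M.map φ * N.map φ := Matrix.map_mul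

theorem mm_add {A B : Type*} [CommRing A] [CommRing B] (φ : A →+* B) (M N : Matrix ι ι A) :
    (M + N).map φ = M.map φ + N.map φ := map_add φ.mapMatrix M N

theorem mm_sub {A B : Type*} [CommRing A] [CommRing B] (φ : A →+* B) (M N : Matrix ι ι A) :
    (M - N).map φ = M.map φ - N.map φ := map_sub φ.mapMatrix M N

theorem mm_neg {A B : Type*} [CommRing A] [CommRing B] (φ : A →+* B) (M : Matrix ι ι A) :
    (-M).map φ = -M.map φ := map_neg φ.mapMatrix M

include split in
theorem cartan (θ : ℝ) (hθ : Fintype.card ι * θ ≤ 1 / 8) (κ : Matrix ι ι A)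
    (hκ : ‖κ.map j‖ < θ) {ε : ℝ} (hε : 0 < ε) :
    ∃ p q δ : Matrix ι ι A, (1 + p) * (1 + κ) = 1 + q + δ ∧ ‖p.map j‖ ≤ 1 / 4 ∧
      (∀ x, r x ≤ s → ‖p.map (φ x)‖ ≤ 1 / 4) ∧ (∀ x, s ≤ r x → ‖q.map (φ x)‖ ≤ 1 / 4) ∧
      ‖δ.map j‖ < ε := by
  set N : ℝ := (Fintype.card ι : ℝ) with hN
  have hN0 : 0 ≤ N := by positivity
  have hθ0 : 0 < θ := lt_of_le_of_lt (norm_nonneg _) hκ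
  have key : ∀ k : ℕ, ∃ p q δ : Matrix ι ι A, (1 + p) * (1 + κ) = 1 + q + δ ∧
      ‖p.map j‖ ≤ 2 * N * θ * (1 - (1 / 2) ^ k) ∧
      (∀ x, r x ≤ s → ‖p.map (φ x)‖ ≤ 2 * N * θ * (1 - (1 / 2) ^ k)) ∧
      (∀ x, s ≤ r x → ‖q.map (φ x)‖ ≤ 2 * N * θ * (1 - (1 / 2) ^ k)) ∧
      ‖δ.map j‖ < θ * (1 / 2) ^ k := by
    intro k
    induction k with
    | zero =>
      exact ⟨0, 0, κ, by simp, by simp, by simp, by simp, by simpa using hκ⟩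
    | succ k ih =>
      obtain ⟨p, q, δ, e, h1, h2, h3, h4⟩ := ih
      obtain ⟨δ₁, δ₂, ed, d1, d2, d3⟩ := mat_split j φ r s split δ _ h4
      have ee : 2 * N * θ * (1 - (1 / 2) ^ k) + N * (θ * (1 / 2) ^ k) =
          2 * N * θ * (1 - (1 / 2) ^ (k + 1)) := by rw [pow_succ]; ring
      refine ⟨p - δ₁, q + δ₂, -(δ₁ * κ), ?_, ?_, fun x hx => ?_, fun x hx => ?_, ?_⟩
      · have : (1 + (p - δ₁)) * (1 + κ) = (1 + p) * (1 + κ) - δ₁ - δ₁ * κ := by noncomm_ring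
        rw [this, e, ed]; abel
      · rw [← ee, mm_sub]
        exact (norm_sub_le _ _).trans (add_le_add h1 d1)
      · rw [← ee, mm_sub]
        exact (norm_sub_le _ _).trans (add_le_add (h2 x hx) (d2 x hx))
      · rw [← ee, mm_add]
        exact (norm_add_le _ _).trans (add_le_add (h3 x hx) (d3 x hx))
      · rw [mm_neg, norm_neg, mm_mul]
        have hp : (0 : ℝ) < (1 / 2) ^ k := by positivity
        calc ‖δ₁.map j * κ.map j‖ ≤ ‖δ₁.map j‖ * ‖κ.map j‖ := norm_mul_le _ _
          _ ≤ (N * (θ * (1 / 2) ^ k)) * θ := by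
            gcongr
          _ = (N * θ) * (θ * (1 / 2) ^ k) := by ring
          _ ≤ (1 / 8) * (θ * (1 / 2) ^ k) := by gcongr
          _ < θ * (1 / 2) ^ (k + 1) := by
            rw [pow_succ]; nlinarith [mul_pos hθ0 hp]
  obtain ⟨k, hk⟩ := exists_pow_lt_of_lt_one (div_pos hε hθ0) (by norm_num : (1 / 2 : ℝ) < 1)
  obtain ⟨p, q, δ, e, h1, h2, h3, h4⟩ := key k
  have hp : (0 : ℝ) < (1 / 2) ^ k := by positivity
  have hb : 2 * N * θ * (1 - (1 / 2) ^ k) ≤ 1 / 4 := by nlinarith [mul_nonneg hN0 hθ0.le]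
  refine ⟨p, q, δ, e, h1.trans hb, fun x hx => (h2 x hx).trans hb, fun x hx => (h3 x hx).trans hb,
    h4.trans ?_⟩
  rw [lt_div_iff₀ hθ0] at hk
  linarith

end cartan

theorem exists_lower {X : Type*} [TopologicalSpace X] [CompactSpace X] {S : Set X}
    (hS : IsClosed S) (F : X → ι → ℂ) (hF : Continuous F) (h : ∀ x ∈ S, F x ≠ 0) :
    ∃ c > 0, ∀ x ∈ S, c ≤ ‖F x‖ := by
  rcases S.eq_empty_or_nonempty with rfl | hne
  · exact ⟨1, one_pos, by simp⟩
  · obtain ⟨x, hx, hm⟩ := hS.isCompact.exists_isMinOn hne (f := fun x => ‖F x‖) (by fun_prop)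
    exact ⟨‖F x‖, norm_pos_iff.2 (h x hx), fun y hy => hm hy⟩

theorem mulVec_ne_zero {K : Type*} [CommRing K] {M : Matrix ι ι K} (hM : IsUnit M) {v : ι → K}
    (hv : v ≠ 0) : M *ᵥ v ≠ 0 := by
  obtain ⟨u, rfl⟩ := hM
  intro h
  apply hv
  have : (u⁻¹ : (Matrix ι ι K)ˣ).val *ᵥ (u.val *ᵥ v) = v := by
    rw [Matrix.mulVec_mulVec, Units.inv_mul, Matrix.one_mulVec]
  rw [← this, h, Matrix.mulVec_zero]

theorem isUnit_map_matrix {A B : Type*} [CommRing A] [CommRing B] (φ : A →+* B) {M : Matrix ι ι A}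
    (hM : IsUnit M) : IsUnit (M.map φ) := hM.map φ.mapMatrix

end

end

section
open Topology
set_option linter.unusedSectionVars false
open scoped Matrix Matrix.Norms.Operator unitInterval

section
variable {ι : Type*} [Fintype ι] [DecidableEq ι]

/-- point evaluation through `G` -/
noncomputable def evG {X A : Type*} [TopologicalSpace X] [NormedCommRing A] [NormedAlgebra ℂ A]
    (G : A →ₐ[ℂ] C(X, ℂ)) (x : X) : A →+* ℂ := (evR ℂ x).comp (G : A →+* C(X, ℂ))

theorem evG_apply {X A : Type*} [TopologicalSpace X] [NormedCommRing A] [NormedAlgebra ℂ A]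
    (G : A →ₐ[ℂ] C(X, ℂ)) (x : X) (a : A) : evG G x a = G a x := rfl

theorem glue {X : Type v} [TopologicalSpace X] [CompactSpace X]
    {A : Type u} [NormedCommRing A] [NormedAlgebra ℂ A] [CompleteSpace A]
    (G : A →ₐ[ℂ] C(X, ℂ)) (hG : ∀ a, ‖G a‖ ≤ ‖a‖) (h1 : ‖(1 : A)‖ ≤ 1)
    (nat : ∀ χ : A →ₐ[ℂ] ℂ, (∀ a, ‖χ a‖ ≤ ‖a‖) → ∃ x, ∀ a, χ a = G a x)
    (f : Aˣ) (r : X → ℝ) (hrc : Continuous r) (hr : ∀ x, ‖G f x‖ = Real.exp (r x)) (s s' : ℝ)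
    (g a : ι → A) (hg : ∀ x, r x ≤ s → evG G x ∘ g ≠ 0)
    (ha : ∀ x, s ≤ r x → r x ≤ s' → evG G x ∘ a ≠ 0)
    (p : I → ι → A) (hp : Continuous p) (hp0 : p 0 = g) (hp1 : p 1 = a)
    (hpn : ∀ t x, r x = s → evG G x ∘ p t ≠ 0) {ε : ℝ} (hε : 0 < ε) :
    ∃ û : I → Matrix ι ι A, Continuous û ∧ û 0 = 1 ∧ (∀ t, IsUnit (û t)) ∧ ∃ H : ι → A,
      (∀ t x, r x = s → ‖evG G x ∘ (û t *ᵥ g) - evG G x ∘ p t‖ < ε) ∧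
      (∀ x, r x ≤ s → ‖evG G x ∘ H - evG G x ∘ (û 1 *ᵥ g)‖ ≤ 1 / 3 * ‖evG G x ∘ (û 1 *ᵥ g)‖) ∧
      (∀ x, s ≤ r x → r x ≤ s' → ‖evG G x ∘ H - evG G x ∘ a‖ ≤ 1 / 3 * ‖evG G x ∘ a‖) := by
  obtain ⟨Q, _, _, _, j, hd, hjn, split, hev, hchar⟩ := exists_Q G hG h1 nat f r hr s
  have hj : Continuous j := by
    refine AddMonoidHomClass.continuous_of_bound j 1 fun a => ?_
    simpa using hjn a
  let jR : A →+* Q := j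
  have hjR : ∀ a, jR a = j a := fun _ => rfl
  have hum : ∀ t, ∃ y : ι → Q, y ⬝ᵥ (jR ∘ p t) = 1 := by
    intro t
    refine unit_ideal (jR ∘ p t) fun χ => ?_
    obtain ⟨x, hx, hx'⟩ := hchar χ
    obtain ⟨i, hi⟩ := Function.ne_iff.1 (hpn t x hx)
    exact ⟨i, by rw [Function.comp, hjR, hx']; exact hi⟩
  obtain ⟨y, hy⟩ := hum 1
  rw [hp1] at hy
  set N : ℝ := (Fintype.card ι : ℝ) with hN
  have hN0 : 0 ≤ N := by positivity
  set θ : ℝ := 1 / (8 * (N + 1)) with hθ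
  have hθ0 : 0 < θ := by positivity
  have hNθ : N * θ ≤ 1 / 8 := by
    rw [hθ, mul_one_div, div_le_div_iff₀ (by positivity) (by norm_num)]; linarith
  set ε1 : ℝ := min 1 (min ε (θ / (2 * (N + 1) * (‖y‖ + 1)))) with hε1
  have hε1p : 0 < ε1 := by positivity
  have hε11 : ε1 ≤ 1 := min_le_left _ _
  have hε1ε : ε1 ≤ ε := (min_le_right _ _).trans (min_le_left _ _)
  have hε1θ : ε1 ≤ θ / (2 * (N + 1) * (‖y‖ + 1)) := (min_le_right _ _).trans (min_le_right _ _)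
  obtain ⟨û, hû, hû0, hûu, hûv⟩ := track j hj hd (fun t => jR ∘ p t)
    (by refine continuous_pi fun i => hj.comp ((continuous_apply i).comp hp)) hum hε1p
  have hevv : ∀ (z : ι → A) x, r x = s → ‖evG G x ∘ z‖ ≤ ‖jR ∘ z‖ := by
    intro z x hx
    rw [pi_norm_le_iff_of_nonneg (norm_nonneg _)]
    intro i
    exact (hev (z i) x hx).trans (norm_le_pi_norm (jR ∘ z) i)
  have hsub : ∀ {B : Type u} [NormedCommRing B] (φ : A →+* B) (z w : ι → A),
      φ ∘ (z - w) = φ ∘ z - φ ∘ w := by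
    intro B _ φ z w; funext i; simp
  have hadd : ∀ {B : Type u} [NormedCommRing B] (φ : A →+* B) (z w : ι → A),
      φ ∘ (z + w) = φ ∘ z + φ ∘ w := by
    intro B _ φ z w; funext i; simp
  have hsubC : ∀ (φ : A →+* ℂ) (z w : ι → A), φ ∘ (z - w) = φ ∘ z - φ ∘ w := by
    intro φ z w; funext i; simp
  have htr : ∀ t, ‖jR ∘ (û t *ᵥ g - p t)‖ < ε1 := by
    intro t
    rw [hsub, map_mulVec', ← hp0]
    exact hûv t
  set G1 := û 1 *ᵥ g with hG1
  have hcG : ∀ z : ι → A, Continuous fun x => evG G x ∘ z := by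
    intro z
    exact continuous_pi fun i => (G (z i)).continuous
  obtain ⟨c₁, hc₁, hc₁'⟩ := exists_lower (S := {x | r x ≤ s}) (isClosed_le hrc continuous_const)
    (fun x => evG G x ∘ G1) (hcG _) (by
      intro x hx
      rw [hG1, map_mulVec']
      exact mulVec_ne_zero (isUnit_map_matrix _ (hûu 1)) (hg x hx))
  obtain ⟨c₂, hc₂, hc₂'⟩ := exists_lower (S := {x | s ≤ r x ∧ r x ≤ s'})
    ((isClosed_le continuous_const hrc).inter (isClosed_le hrc continuous_const))
    (fun x => evG G x ∘ a) (hcG _) (fun x hx => ha x hx.1 hx.2)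
  set η : ℝ := min c₁ c₂ / 16 with hη
  have hη0 : 0 < η := by positivity
  set K : ℝ := ‖(1 : Matrix ι ι Q)‖ + 1 / 4 with hK
  have hK0 : 0 < K := by positivity
  -- choose ŷ
  obtain ⟨yh, hyh1, hyh2⟩ : ∃ yh : ι → A, ‖jR ∘ yh‖ < ‖y‖ + 1 ∧
      ‖(jR ∘ yh) ⬝ᵥ (jR ∘ a) - 1‖ < η / (4 * K) := by
    have hdp : DenseRange (fun z : ι → A => jR ∘ z) := DenseRange.piMap fun _ => hd
    have ho : IsOpen {z : ι → Q | ‖z‖ < ‖y‖ + 1 ∧ ‖z ⬝ᵥ (jR ∘ a) - 1‖ < η / (4 * K)} := by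
      refine (isOpen_lt continuous_norm continuous_const).inter
        (isOpen_lt (Continuous.norm ?_) continuous_const)
      simp only [dotProduct]; fun_prop
    obtain ⟨_, hz, ⟨z, rfl⟩⟩ := hdp.inter_open_nonempty _ ho
      ⟨y, by simp, by rw [hy]; simpa using by positivity⟩ |>.imp fun z hz => hz
    exact ⟨z, hz⟩
  set ρ : ι → A := G1 - a with hρ
  have hρn : ‖jR ∘ ρ‖ < ε1 := by have := htr 1; rwa [hp1] at this
  set e : A := yh ⬝ᵥ a - 1 with he
  have hen : ‖jR e‖ < η / (4 * K) := by
    have : jR e = (jR ∘ yh) ⬝ᵥ (jR ∘ a) - 1 := by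
      simp [he, dotProduct]
    rw [this]; exact hyh2
  set κ : Matrix ι ι A := Matrix.vecMulVec ρ yh with hκ
  have hκn : ‖κ.map jR‖ < θ := by
    have hb : ‖κ.map jR‖ ≤ N * (ε1 * (‖y‖ + 1)) := by
      refine mat_norm_le _ (by positivity) fun i k => ?_
      rw [Matrix.map_apply, hκ, Matrix.vecMulVec_apply, map_mul]
      refine (norm_mul_le _ _).trans ?_
      gcongr
      · exact (norm_le_pi_norm (jR ∘ ρ) i).trans hρn.le
      · exact (norm_le_pi_norm (jR ∘ yh) k).trans hyh1.le
    refine lt_of_le_of_lt hb ?_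
    have h2 : ε1 * (2 * (N + 1) * (‖y‖ + 1)) ≤ θ := by
      rwa [le_div_iff₀ (by positivity)] at hε1θ
    have h3 : 0 < ε1 * (‖y‖ + 1) := by positivity
    nlinarith
  obtain ⟨P, q, δ, hPq, hPj, hPx, hqx, hδ⟩ := cartan jR (evG G) r s split θ hNθ κ hκn
    (ε := η / (2 * (‖jR ∘ a‖ + 1))) (by positivity)
  have hκa : (1 + κ) *ᵥ a = G1 + e • ρ := by
    rw [Matrix.add_mulVec, Matrix.one_mulVec, hκ, Matrix.vecMulVec_mulVec]
    funext i
    simp only [Pi.add_apply, Pi.smul_apply, hρ, he, Pi.sub_apply, smul_eq_mul, MulOpposite.smul_eq_mul_unop, MulOpposite.unop_op]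
    ring
  set E : ι → A := δ *ᵥ a - e • ((1 + P) *ᵥ ρ) with hE
  have hmain : (1 + P) *ᵥ G1 = (1 + q) *ᵥ a + E := by
    have h2 : (1 + P) *ᵥ ((1 + κ) *ᵥ a) = (1 + q + δ) *ᵥ a := by
      rw [Matrix.mulVec_mulVec, hPq]
    rw [hκa, Matrix.mulVec_add, Matrix.mulVec_smul, Matrix.add_mulVec (1 + q)] at h2
    rw [hE, eq_sub_of_add_eq h2]; abel
  have hEn : ‖jR ∘ E‖ < η := by
    have e1 : jR ∘ E = δ.map jR *ᵥ (jR ∘ a) - jR e • ((1 + P.map jR) *ᵥ (jR ∘ ρ)) := by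
      rw [hE, hsub, map_mulVec']
      congr 1
      have : jR ∘ (e • ((1 + P) *ᵥ ρ)) = jR e • (jR ∘ ((1 + P) *ᵥ ρ)) := by
        funext i; simp
      rw [this, map_mulVec', mm_add, Matrix.map_one _ (map_zero jR) (map_one jR)]
    rw [e1]
    have b1 : ‖δ.map jR *ᵥ (jR ∘ a)‖ ≤ η / 2 := by
      refine (Matrix.linfty_opNorm_mulVec _ _).trans ?_
      calc ‖δ.map jR‖ * ‖jR ∘ a‖ ≤ η / (2 * (‖jR ∘ a‖ + 1)) * (‖jR ∘ a‖ + 1) := by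
            gcongr; linarith
        _ = η / 2 := by field_simp
    have b2 : ‖jR e • ((1 + P.map jR) *ᵥ (jR ∘ ρ))‖ ≤ η / 4 := by
      refine (norm_smul_le _ _).trans ?_
      calc ‖jR e‖ * ‖(1 + P.map jR) *ᵥ (jR ∘ ρ)‖
          ≤ η / (4 * K) * (K * 1) := by
            gcongr
            refine (Matrix.linfty_opNorm_mulVec _ _).trans ?_
            gcongr
            · exact (norm_add_le _ _).trans (by rw [hK]; gcongr)
            · exact hρn.le.trans hε11
        _ = η / 4 := by field_simp
    have := norm_sub_le (δ.map jR *ᵥ (jR ∘ a)) (jR e • ((1 + P.map jR) *ᵥ (jR ∘ ρ)))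
    linarith
  choose E₁ E₂ hEs _ hE1 hE2 using fun i => split (E i) η
    (lt_of_le_of_lt (norm_le_pi_norm (jR ∘ E) i) hEn)
  have hEs' : E = E₁ + E₂ := funext hEs
  refine ⟨û, hû, hû0, hûu, (1 + P) *ᵥ G1 - E₁, ?_, ?_, ?_⟩
  · intro t x hx
    rw [← hsubC]
    exact lt_of_le_of_lt (hevv _ x hx) ((htr t).trans_le hε1ε)
  · intro x hx
    have e2 : (1 + P) *ᵥ G1 - E₁ - G1 = P *ᵥ G1 - E₁ := by
      rw [Matrix.add_mulVec, Matrix.one_mulVec]; abel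
    rw [← hsubC, e2, hsubC, map_mulVec']
    refine (norm_sub_le _ _).trans ?_
    have b1 : ‖P.map (evG G x) *ᵥ (evG G x ∘ G1)‖ ≤ 1 / 4 * ‖evG G x ∘ G1‖ := by
      refine (Matrix.linfty_opNorm_mulVec _ _).trans ?_
      gcongr
      exact hPx x hx
    have b2 : ‖evG G x ∘ E₁‖ ≤ η := by
      rw [pi_norm_le_iff_of_nonneg hη0.le]
      exact fun i => hE1 i x hx
    have b3 : c₁ ≤ ‖evG G x ∘ G1‖ := hc₁' x hx
    have b4 : η ≤ c₁ / 16 := by rw [hη]; gcongr; exact min_le_left _ _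
    linarith
  · intro x hx hx'
    have e2 : (1 + P) *ᵥ G1 - E₁ - a = q *ᵥ a + E₂ := by
      rw [hmain, hEs', Matrix.add_mulVec, Matrix.one_mulVec]; abel
    have hadd' : evG G x ∘ (q *ᵥ a + E₂) = evG G x ∘ (q *ᵥ a) + evG G x ∘ E₂ := by
      funext i; simp
    rw [← hsubC, e2, hadd', map_mulVec']
    refine (norm_add_le _ _).trans ?_
    have b1 : ‖q.map (evG G x) *ᵥ (evG G x ∘ a)‖ ≤ 1 / 4 * ‖evG G x ∘ a‖ := by
      refine (Matrix.linfty_opNorm_mulVec _ _).trans ?_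
      gcongr
      exact hqx x hx
    have b2 : ‖evG G x ∘ E₂‖ ≤ η := by
      rw [pi_norm_le_iff_of_nonneg hη0.le]
      exact fun i => hE2 i x hx
    have b3 : c₂ ≤ ‖evG G x ∘ a‖ := hc₂' x ⟨hx, hx'⟩
    have b4 : η ≤ c₂ / 16 := by rw [hη]; gcongr; exact min_le_right _ _
    linarith

end

end

section
open Topology
set_option linter.unusedSectionVars false
open scoped unitInterval

section
variable {ι : Type*} [Fintype ι] [DecidableEq ι]
variable {X : Type*} [TopologicalSpace X] [CompactSpace X] [T2Space X]

/-- evaluation of a vector of functions -/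
noncomputable def evv (b : ι → C(X, ℂ)) (x : X) : ι → ℂ := fun i => b i x

/-- vectors over a subalgebra without zeros on `S` -/
noncomputable def Uset (ι : Type*) (B : Subalgebra ℂ C(X, ℂ)) (S : Set X) : Set (ι → C(X, ℂ)) :=
  {b | (∀ i, b i ∈ B) ∧ ∀ x ∈ S, evv b x ≠ 0}

theorem evv_continuous (b : ι → C(X, ℂ)) : Continuous (evv b) :=
  continuous_pi fun i => (b i).continuous

theorem evv_continuous₂ {T : Type*} [TopologicalSpace T] {P : T → ι → C(X, ℂ)}
    (hP : Continuous P) : Continuous fun p : T × X => evv (P p.1) p.2 := by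
  refine continuous_pi fun i => ?_
  have : Continuous fun p : T × X => (P p.1 i, p.2) := by fun_prop
  exact continuous_eval.comp this

theorem joinedIn_of_cont {V : Type*} [TopologicalSpace V] {F : Set V} {x y : V} (γ : I → V)
    (hγ : Continuous γ) (h0 : γ 0 = x) (h1 : γ 1 = y) (hF : ∀ t, γ t ∈ F) : JoinedIn F x y :=
  ⟨⟨⟨γ, hγ⟩, h0, h1⟩, hF⟩

theorem ne_zero_of_near {u w : ι → ℂ} (h : ‖u - w‖ < ‖w‖) : u ≠ 0 := by
  rintro rfl
  simp at h

theorem joinedIn_segment {B : Subalgebra ℂ C(X, ℂ)} {S : Set X} {u v : ι → C(X, ℂ)}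
    (hu : ∀ i, u i ∈ B) (hv : ∀ i, v i ∈ B)
    (h : ∀ x ∈ S, ∃ w : ι → ℂ, ‖evv u x - w‖ < ‖w‖ ∧ ‖evv v x - w‖ < ‖w‖) :
    JoinedIn (Uset ι B S) u v := by
  refine JoinedIn.of_segment_subset ?_
  rintro z ⟨a, b, ha, hb, hab, rfl⟩
  refine ⟨fun i => ?_, fun x hx => ?_⟩
  · have h1 : (a • u + b • v) i = (a : ℂ) • u i + (b : ℂ) • v i := by
      ext x; simp
    rw [h1]
    exact B.add_mem (B.smul_mem (hu i) _) (B.smul_mem (hv i) _)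
  · obtain ⟨w, h1, h2⟩ := h x hx
    have h3 : evv (a • u + b • v) x = a • evv u x + b • evv v x := by
      funext i; simp [evv]
    rw [h3]
    have := convex_ball w ‖w‖ (mem_ball_iff_norm.2 h1) (mem_ball_iff_norm.2 h2) ha hb hab
    exact ne_zero_of_near (mem_ball_iff_norm.1 this)

/-- `x ↦ P (u x) x` -/
noncomputable def diag (P : C(I, C(X, ℂ))) (u : C(X, I)) : C(X, ℂ) :=
  ⟨fun x => P (u x) x, continuous_eval.comp (by fun_prop :
    Continuous fun x => (P (u x), x))⟩

theorem diag_mem {B : Subalgebra ℂ C(X, ℂ)} (hB : IsClosed (B : Set C(X, ℂ)))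
    (P : C(I, C(X, ℂ))) (hP : ∀ t, P t ∈ B) (u : C(X, I))
    (hu : ∀ ψ : C(I, ℝ), (⟨fun x => ((ψ (u x) : ℝ) : ℂ), by fun_prop⟩ : C(X, ℂ)) ∈ B) :
    diag P u ∈ B := by
  have h1 := bernsteinApproximation_uniform P
  have h2 : Filter.Tendsto (fun n => diag (bernsteinApproximation n P) u) Filter.atTop
      (𝓝 (diag P u)) := by
    rw [tendsto_iff_dist_tendsto_zero] at h1 ⊢
    refine squeeze_zero (fun _ => dist_nonneg) (fun n => ?_) h1
    rw [ContinuousMap.dist_le dist_nonneg]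
    intro x
    change dist (bernsteinApproximation n P (u x) x) (P (u x) x) ≤ _
    exact (ContinuousMap.dist_apply_le_dist x).trans (ContinuousMap.dist_apply_le_dist (u x))
  refine hB.mem_of_tendsto h2 (Filter.Eventually.of_forall fun n => ?_)
  have h3 : diag (bernsteinApproximation n P) u = ∑ k : Fin (n + 1),
      (⟨fun x => ((bernstein n k (u x) : ℝ) : ℂ), by fun_prop⟩ : C(X, ℂ)) *
        P (bernstein.z k) := by
    ext x
    simp [diag, bernsteinApproximation.apply, ContinuousMap.sum_apply]
  rw [h3]
  exact B.sum_mem fun k _ => B.mul_mem (hu (bernstein n k)) (hP _)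

theorem strip {r : X → ℝ} (hr : Continuous r) {s : ℝ} {O : Set X} (hO : IsOpen O)
    (h : ∀ x, r x = s → x ∈ O) : ∃ ε > 0, ∀ x, |r x - s| ≤ ε → x ∈ O := by
  rcases (Oᶜ).eq_empty_or_nonempty with h0 | h0
  · exact ⟨1, one_pos, fun x _ => by_contra fun hx => by
      have : x ∈ Oᶜ := hx
      rw [h0] at this; exact this⟩
  · obtain ⟨x, hx, hm⟩ := hO.isClosed_compl.isCompact.exists_isMinOn h0 (f := fun x => |r x - s|)
      (by fun_prop)
    have hpos : 0 < |r x - s| := by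
      rw [abs_pos, sub_ne_zero]; exact fun e => hx (h x e)
    refine ⟨|r x - s| / 2, half_pos hpos, fun y hy => by_contra fun hy' => ?_⟩
    have : |r x - s| ≤ |r y - s| := hm hy'
    linarith

end

end

section
open Topology
set_option linter.unusedSectionVars false
open scoped unitInterval

section
variable {ι : Type*} [Fintype ι] [DecidableEq ι]
variable {X : Type*} [TopologicalSpace X] [CompactSpace X] [T2Space X]

/-- every character is a point evaluation -/
def Natural (A : Subalgebra ℂ C(X, ℂ)) : Prop :=
  ∀ χ : A →ₐ[ℂ] ℂ, (∀ a, ‖χ a‖ ≤ ‖a‖) → ∃ x, ∀ a, χ a = (a : C(X, ℂ)) x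

theorem near_symm {u v : ι → ℂ} (hv : v ≠ 0) (h : ‖u - v‖ ≤ 1 / 3 * ‖v‖) : ‖v - u‖ < ‖u‖ := by
  have h1 := norm_pos_iff.2 hv
  have h2 : ‖v‖ ≤ ‖u - v‖ + ‖u‖ := by
    have := norm_sub_le u (u - v)
    rw [sub_sub_cancel] at this; linarith
  rw [norm_sub_rev]
  linarith

theorem glue' {A : Subalgebra ℂ C(X, ℂ)} (hA : IsClosed (A : Set C(X, ℂ))) (nat : Natural A)
    (g₀ : C(X, ℂ)) (hg₀ : g₀ ∈ A) (r : X → ℝ) (hr : ∀ x, r x = (g₀ x).re) (s s' : ℝ)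
    (p : I → ι → A) (hp : Continuous p)
    (hg : ∀ x, r x ≤ s → evv (fun i => (p 0 i : C(X, ℂ))) x ≠ 0)
    (ha : ∀ x, s ≤ r x → r x ≤ s' → evv (fun i => (p 1 i : C(X, ℂ))) x ≠ 0)
    (hpn : ∀ t x, r x = s → evv (fun i => (p t i : C(X, ℂ))) x ≠ 0) {ε : ℝ} (hε : 0 < ε) :
    ∃ W : I → ι → C(X, ℂ), Continuous W ∧ (∀ i, W 0 i = p 0 i) ∧ (∀ t i, W t i ∈ A) ∧
      (∀ t x, r x ≤ s → evv (W t) x ≠ 0) ∧ ∃ H : ι → C(X, ℂ), (∀ i, H i ∈ A) ∧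
      (∀ t x, r x = s → ‖evv (W t) x - evv (fun i => (p t i : C(X, ℂ))) x‖ < ε) ∧
      (∀ x, r x ≤ s → ‖evv (W 1) x - evv H x‖ < ‖evv H x‖) ∧
      (∀ x, s ≤ r x → r x ≤ s' →
        ‖evv (fun i => (p 1 i : C(X, ℂ))) x - evv H x‖ < ‖evv H x‖) := by
  have : CompleteSpace A := hA.completeSpace_coe
  let _ : NormedAlgebra ℚ A := NormedAlgebra.restrictScalars ℚ ℂ A
  have hrc : Continuous r := by
    rw [show r = fun x => (g₀ x).re from funext hr]
    exact Complex.continuous_re.comp g₀.continuous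
  obtain ⟨f, hf⟩ := NormedSpace.isUnit_exp (⟨g₀, hg₀⟩ : A)
  have h1 : ‖(1 : A)‖ ≤ 1 := by
    have : ‖(1 : C(X, ℂ))‖ ≤ 1 := by
      rw [ContinuousMap.norm_le _ zero_le_one]; intro x; simp
    exact this
  have hev : ∀ x, Continuous (evG A.val x) := by
    intro x
    have : Continuous fun a : A => (a : C(X, ℂ)) x :=
      (continuous_eval_const x).comp continuous_subtype_val
    exact this
  have hfr : ∀ x, ‖A.val f x‖ = Real.exp (r x) := by
    intro x
    have h2 := NormedSpace.map_exp (evG A.val x) (hev x) (⟨g₀, hg₀⟩ : A)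
    rw [← hf, evG_apply, evG_apply] at h2
    rw [h2, ← Complex.exp_eq_exp_ℂ, Complex.norm_exp, hr]
    rfl
  obtain ⟨û, hû, hû0, hûu, H, h2, h3, h4⟩ := glue (X := X) (A := A) A.val (fun a => le_rfl) h1 nat f r hrc
    hfr s s' (p 0) (p 1) hg ha p hp rfl rfl hpn hε
  have hW : ∀ t x, r x ≤ s → evv (fun i => ((Matrix.mulVec (û t) (p 0) i : A) : C(X, ℂ))) x ≠ 0 := by
    intro t x hx
    have := mulVec_ne_zero (isUnit_map_matrix (evG A.val x) (hûu t)) (hg x hx)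
    have e := map_mulVec' (evG A.val x) (û t) (p 0)
    change evG A.val x ∘ (Matrix.mulVec (û t) (p 0)) ≠ 0
    rw [e]
    exact this
  refine ⟨fun t i => ((Matrix.mulVec (û t) (p 0) i : A) : C(X, ℂ)), ?_, ?_, ?_, hW, fun i => H i,
    fun i => (H i).2, h2, ?_, ?_⟩
  · refine continuous_pi fun i => continuous_subtype_val.comp ?_
    exact (continuous_apply i).comp (Continuous.matrix_mulVec hû continuous_const)
  · intro i; simp [hû0]
  · intro t i; exact Subtype.property _
  · intro x hx
    exact near_symm (hW 1 x hx) (h3 x hx)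
  · intro x hx hx'
    exact near_symm (ha x hx hx') (h4 x hx hx')

end

end

section
open Topology
set_option linter.unusedSectionVars false
open scoped unitInterval

section
variable {ι : Type*} [Fintype ι] [DecidableEq ι]
variable {X : Type*} [TopologicalSpace X] [CompactSpace X] [T2Space X]

noncomputable def cA {A : Subalgebra ℂ C(X, ℂ)} (a : ι → A) : ι → C(X, ℂ) := fun i => a i

theorem exists_cutoff {a b : ℝ} (h : a < b) :
    ∃ φ : C(ℝ, I), (∀ x ≤ a, φ x = 0) ∧ (∀ x, b ≤ x → φ x = 1) := by
  refine ⟨⟨fun x => Set.projIcc (0 : ℝ) 1 zero_le_one ((x - a) / (b - a)),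
    continuous_projIcc.comp (by fun_prop)⟩, fun x hx => ?_, fun x hx => ?_⟩
  · exact Set.projIcc_of_le_left zero_le_one (div_nonpos_of_nonpos_of_nonneg (by linarith) (by linarith))
  · refine Set.projIcc_of_right_le zero_le_one ?_
    rw [le_div_iff₀ (by linarith)]; linarith

theorem isOpen_forall_compact {T Y : Type*} [TopologicalSpace T] [CompactSpace T]
    [TopologicalSpace Y] {P : Y → T → Prop} (h : IsOpen {p : Y × T | P p.1 p.2}) :
    IsOpen {y | ∀ t, P y t} := by
  rw [isOpen_iff_mem_nhds]
  intro y hy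
  have := isCompact_univ.eventually_forall_of_forall_eventually (x₀ := y) (K := (Set.univ : Set T))
    (P := P) (fun t _ => h.mem_nhds (hy t))
  filter_upwards [this] with z hz t using hz t (Set.mem_univ t)

theorem select {A : Subalgebra ℂ C(X, ℂ)} {S : Set X} (hS : IsClosed S)
    (R : I → ι → C(X, ℂ)) (hR : Continuous R) (hRn : ∀ t, ∀ x ∈ S, evv (R t) x ≠ 0)
    (hloc : ∀ t, ∀ ε > 0, ∃ a : ι → A, ∀ x ∈ S, ‖evv (cA a) x - evv (R t) x‖ < ε)
    (g a : ι → A) (hg : R 0 = cA g)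
    (ha : ∀ x ∈ S, ‖evv (cA a) x - evv (R 1) x‖ < 1 / 2 * ‖evv (R 1) x‖) :
    ∃ p : I → ι → A, Continuous p ∧ p 0 = g ∧ p 1 = a ∧
      ∀ t, ∀ x ∈ S, ‖evv (cA (p t)) x - evv (R t) x‖ < 1 / 2 * ‖evv (R t) x‖ := by
  have hR2 := evv_continuous₂ hR
  have hopen : ∀ c : ι → A, IsOpen {t | ∀ x ∈ S, ‖evv (cA c) x - evv (R t) x‖ <
      1 / 2 * ‖evv (R t) x‖} := by
    intro c
    have : CompactSpace S := isCompact_iff_compactSpace.1 hS.isCompact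
    have hh : IsOpen {p : I × S | ‖evv (cA c) p.2 - evv (R p.1) p.2‖ <
      1 / 2 * ‖evv (R p.1) p.2‖} := by
      have h1 : Continuous fun p : I × S => evv (R p.1) p.2 :=
        hR2.comp (by fun_prop : Continuous fun p : I × S => (p.1, (p.2 : X)))
      have h2 : Continuous fun p : I × S => evv (cA c) p.2 :=
        (evv_continuous (cA c)).comp (by fun_prop)
      exact isOpen_lt (h2.sub h1).norm (continuous_const.mul h1.norm)
    have := isOpen_forall_compact (P := fun (t : I) (x : S) => ‖evv (cA c) x - evv (R t) x‖ <
      1 / 2 * ‖evv (R t) x‖) hh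
    have e : {t | ∀ x ∈ S, ‖evv (cA c) x - evv (R t) x‖ < 1 / 2 * ‖evv (R t) x‖} =
        {t | ∀ x : S, ‖evv (cA c) x - evv (R t) x‖ < 1 / 2 * ‖evv (R t) x‖} := by
      ext t; exact ⟨fun h x => h x x.2, fun h x hx => h ⟨x, hx⟩⟩
    rw [e]; exact this
  obtain ⟨p, hp⟩ := exists_continuous_forall_mem_convex_of_local_const (X := I) (E := ι → A)
    (t := fun t => {c | (∀ x ∈ S, ‖evv (cA c) x - evv (R t) x‖ < 1 / 2 * ‖evv (R t) x‖) ∧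
      (t = 0 → c = g) ∧ (t = 1 → c = a)}) (by
      rintro t c ⟨hc1, hc2, hc3⟩ d ⟨hd1, hd2, hd3⟩ u v hu hv huv
      refine ⟨fun x hx => ?_, fun ht => ?_, fun ht => ?_⟩
      · have e : evv (cA (u • c + v • d)) x = u • evv (cA c) x + v • evv (cA d) x := by
          funext i; simp [evv, cA]
        rw [e]
        exact mem_ball_iff_norm.1 (convex_ball _ _ (mem_ball_iff_norm.2 (hc1 x hx))
          (mem_ball_iff_norm.2 (hd1 x hx)) hu hv huv)
      · rw [hc2 ht, hd2 ht, ← add_smul, huv, one_smul]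
      · rw [hc3 ht, hd3 ht, ← add_smul, huv, one_smul]) (by
      intro t
      rcases eq_or_ne t 0 with rfl | h0
      · refine ⟨g, ?_⟩
        have h1 : ∀ᶠ t : I in 𝓝 0, t ≠ 1 := isOpen_ne.mem_nhds zero_ne_one
        filter_upwards [(hopen g).mem_nhds (by
          intro x hx
          rw [← hg, sub_self, norm_zero]
          have := norm_pos_iff.2 (hRn 0 x hx)
          positivity), h1] with t ht ht1
        exact ⟨ht, fun _ => rfl, fun h => absurd h ht1⟩
      · have h2 : ∀ᶠ t : I in 𝓝 t, t ≠ 0 := isOpen_ne.mem_nhds h0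
        rcases eq_or_ne t 1 with rfl | h1
        · refine ⟨a, ?_⟩
          filter_upwards [(hopen a).mem_nhds ha, h2] with t ht ht1
          exact ⟨ht, fun h => absurd h ht1, fun _ => rfl⟩
        · have h3 : ∀ᶠ t : I in 𝓝 t, t ≠ 1 := isOpen_ne.mem_nhds h1
          obtain ⟨c, hc, hc'⟩ := exists_lower hS (evv (R t)) (evv_continuous _) (hRn t)
          obtain ⟨d, hd⟩ := hloc t (1 / 2 * c) (by positivity)
          refine ⟨d, ?_⟩
          filter_upwards [(hopen d).mem_nhds (by
            intro x hx
            refine (hd x hx).trans_le ?_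
            have := hc' x hx
            linarith), h2, h3] with t ht ht1 ht2
          exact ⟨ht, fun h => absurd h ht1, fun h => absurd h ht2⟩)
  exact ⟨p, p.continuous, (hp 0).2.1 rfl, (hp 1).2.2 rfl, fun t => (hp t).1⟩

/-- coordinate paths -/
noncomputable def coordP (P : I → ι → C(X, ℂ)) (hP : Continuous P) (i : ι) : C(I, C(X, ℂ)) :=
  ⟨fun t => P t i, by fun_prop⟩

/-- coordinatewise diagonal -/
noncomputable def diagV (P : I → ι → C(X, ℂ)) (hP : Continuous P) (u : C(X, I)) : ι → C(X, ℂ) :=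
  fun i => diag (coordP P hP i) u

theorem evv_diagV (P : I → ι → C(X, ℂ)) (hP : Continuous P) (u : C(X, I)) (x : X) :
    evv (diagV P hP u) x = evv (P (u x)) x := rfl

/-- cutoff family -/
noncomputable def uFam (lam : C(ℝ, I)) (r : C(X, ℝ)) (τ : I) : C(X, I) :=
  ⟨fun x => max (lam (r x)) τ, by fun_prop⟩

theorem diagV_continuous (P : I → ι → C(X, ℂ)) (hP : Continuous P) (lam : C(ℝ, I)) (r : C(X, ℝ)) :
    Continuous fun τ => diagV P hP (uFam lam r τ) := by
  refine continuous_pi fun i => ?_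
  refine ContinuousMap.continuous_of_continuous_uncurry _ ?_
  have h : Continuous fun p : I × X => (max (lam (r p.2)) p.1, p.2) := by fun_prop
  have := (evv_continuous₂ hP).comp h
  exact (continuous_apply i).comp this

theorem diagV_mem {B : Subalgebra ℂ C(X, ℂ)} (hB : IsClosed (B : Set C(X, ℂ))) (r : C(X, ℝ))
    (hcomp : ∀ ψ : C(ℝ, ℝ), (⟨fun x => ((ψ (r x) : ℝ) : ℂ), by fun_prop⟩ : C(X, ℂ)) ∈ B)
    (P : I → ι → C(X, ℂ)) (hP : Continuous P) (hPB : ∀ t i, P t i ∈ B) (lam : C(ℝ, I)) (τ : I)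
    (i : ι) : diagV P hP (uFam lam r τ) i ∈ B := by
  refine diag_mem hB _ (fun t => hPB t i) _ fun ψ => ?_
  exact hcomp ⟨fun ρ => ψ (max (lam ρ) τ), by fun_prop⟩

end

end

section
open Topology
set_option linter.unusedSectionVars false
open scoped unitInterval

section
variable {ι : Type*} [Fintype ι] [DecidableEq ι]
variable {X : Type*} [TopologicalSpace X] [CompactSpace X] [T2Space X]

/-- pointwise convex combination -/
noncomputable def mix (k : C(X, I)) (P a : ι → C(X, ℂ)) : ι → C(X, ℂ) :=
  fun i => (1 - ⟨fun x => ((k x : ℝ) : ℂ), by fun_prop⟩) * P i +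
    (⟨fun x => ((k x : ℝ) : ℂ), by fun_prop⟩ : C(X, ℂ)) * a i

theorem evv_mix (k : C(X, I)) (P a : ι → C(X, ℂ)) (x : X) :
    evv (mix k P a) x = (1 - (k x : ℝ)) • evv P x + (k x : ℝ) • evv a x := by
  funext i; simp [evv, mix]

theorem mix_near {k : C(X, I)} {P a : ι → C(X, ℂ)} {x : X} {w : ι → ℂ}
    (h1 : ‖evv P x - w‖ < ‖w‖) (h2 : ‖evv a x - w‖ < ‖w‖) :
    ‖evv (mix k P a) x - w‖ < ‖w‖ := by
  rw [evv_mix]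
  exact mem_ball_iff_norm.1 (convex_ball w ‖w‖ (mem_ball_iff_norm.2 h1) (mem_ball_iff_norm.2 h2)
    (by linarith [(k x).2.2]) (k x).2.1 (by ring))

theorem mix_zero {k : C(X, I)} {P a : ι → C(X, ℂ)} {x : X} (h : k x = 0) :
    evv (mix k P a) x = evv P x := by rw [evv_mix, h]; simp

theorem mix_one {k : C(X, I)} {P a : ι → C(X, ℂ)} {x : X} (h : k x = 1) :
    evv (mix k P a) x = evv a x := by rw [evv_mix, h]; simp

theorem mix_mem {B : Subalgebra ℂ C(X, ℂ)} {k : C(X, I)} {P a : ι → C(X, ℂ)}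
    (hk : (⟨fun x => ((k x : ℝ) : ℂ), by fun_prop⟩ : C(X, ℂ)) ∈ B) (hP : ∀ i, P i ∈ B)
    (ha : ∀ i, a i ∈ B) (i : ι) : mix k P a i ∈ B :=
  B.add_mem (B.mul_mem (B.sub_mem B.one_mem hk) (hP i)) (B.mul_mem hk (ha i))

theorem mix_continuous (k : C(X, I)) (a : ι → C(X, ℂ)) {T : Type*} [TopologicalSpace T]
    {P : T → ι → C(X, ℂ)} (hP : Continuous P) : Continuous fun t => mix k (P t) a := by
  unfold mix
  fun_prop

set_option maxHeartbeats 1000000 in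
theorem step {A A' : Subalgebra ℂ C(X, ℂ)} (hA : IsClosed (A : Set C(X, ℂ)))
    (hA' : IsClosed (A' : Set C(X, ℂ))) (hAA : A ≤ A') (nat : Natural A)
    (g₀ : C(X, ℂ)) (hg₀ : g₀ ∈ A) (r : C(X, ℝ)) (hr : ∀ x, r x = (g₀ x).re)
    (hcomp : ∀ ψ : C(ℝ, ℝ), (⟨fun x => ((ψ (r x) : ℝ) : ℂ), by fun_prop⟩ : C(X, ℂ)) ∈ A')
    (hloc : ∀ b : ι → C(X, ℂ), (∀ i, b i ∈ A') → ∀ s : ℝ, ∀ ε > 0, ∃ a : ι → A, ∃ η > 0, ∀ x,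
      |r x - s| < η → ‖evv (cA a) x - evv b x‖ < ε)
    {s s' : ℝ} {b : ι → C(X, ℂ)} (hb : b ∈ Uset ι A' Set.univ) (a g : ι → A)
    (ha : ∀ x, s ≤ r x → r x ≤ s' → ‖evv (cA a) x - evv b x‖ < 1 / 2 * ‖evv b x‖)
    (hj : JoinedIn (Uset ι A' {x | r x ≤ s}) (cA g) b) (hss : s ≤ s') :
    ∃ H : ι → A, JoinedIn (Uset ι A' {x | r x ≤ s'}) (cA H) b := by
  obtain ⟨R, hRU⟩ := hj
  have hRc : Continuous R := R.continuous
  have hR0 : R 0 = cA g := R.source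
  have hR1 : R 1 = b := R.target
  have hR2 := evv_continuous₂ hRc
  have hRn : ∀ t x, r x ≤ s → evv (R t) x ≠ 0 := fun t x hx => (hRU t).2 x hx
  have hbn : ∀ x, evv b x ≠ 0 := fun x => hb.2 x trivial
  have haA : ∀ (c : ι → A) i, cA c i ∈ A' := fun c i => hAA (c i).2
  have ha' : ∀ x, s ≤ r x → r x ≤ s' → ‖evv (cA a) x - evv b x‖ < ‖evv b x‖ := by
    intro x h1 h2
    have := ha x h1 h2
    have := norm_nonneg (evv b x)
    linarith
  have hXs : IsClosed {x | r x = s} := isClosed_eq r.continuous continuous_const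
  obtain ⟨p, hpc, hp0, hp1, hpR⟩ := select (A := A) hXs R hRc
    (fun t x hx => hRn t x (le_of_eq hx)) (fun t ε hε => by
      obtain ⟨c, η, hη, h⟩ := hloc (R t) (hRU t).1 s ε hε
      refine ⟨c, fun x hx => h x ?_⟩
      have : r x = s := hx
      rw [this, sub_self, abs_zero]; exact hη) g a hR0 (by
      intro x hx
      have : r x = s := hx
      rw [hR1]
      exact ha x this.ge (this.trans_le hss))
  obtain ⟨c, hc, hcR⟩ := exists_lower (X := I × X) (S := {q : I × X | r q.2 = s})
    (isClosed_eq (by fun_prop) continuous_const) (fun q => evv (R q.1) q.2) hR2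
    (fun q hq => hRn _ _ (le_of_eq hq))
  have hpn : ∀ t x, r x = s → evv (fun i => (p t i : C(X, ℂ))) x ≠ 0 := by
    intro t x hx
    have h1 := hpR t x hx
    have h2 := norm_nonneg (evv (R t) x)
    exact ne_zero_of_near (w := evv (R t) x) (h1.trans_le (by linarith))
  obtain ⟨W, hWc, hW0, hWA, hWn, H, hHA, hWp, hWH, haH⟩ := glue' hA nat g₀ hg₀ r hr s s' p hpc
    (by
      intro x hx
      have := hRn 0 x hx
      rw [hR0, ← hp0] at this
      exact this)
    (by
      intro x h1 h2
      rw [hp1]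
      exact ne_zero_of_near (ha' x h1 h2)) hpn (ε := c / 2) (by positivity)
  have haH : ∀ x, s ≤ r x → r x ≤ s' → ‖evv (cA a) x - evv H x‖ < ‖evv H x‖ := by
    intro x h1 h2
    have := haH x h1 h2
    rw [hp1] at this
    exact this
  have hW0 : W 0 = cA g := by
    funext i; rw [hW0, hp0]; rfl
  have hW2 := evv_continuous₂ hWc
  have hO : IsOpen ({x | ∀ t, ‖evv (W t) x - evv (R t) x‖ < ‖evv (R t) x‖} ∩
      {x | ‖evv (cA a) x - evv b x‖ < ‖evv b x‖} ∩ {x | ‖evv (cA a) x - evv H x‖ < ‖evv H x‖}) := by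
    have c1 := evv_continuous (cA a)
    have c2 := evv_continuous b
    have c3 := evv_continuous H
    have c4 : Continuous fun q : X × I => evv (W q.2) q.1 := hW2.comp continuous_swap
    have c5 : Continuous fun q : X × I => evv (R q.2) q.1 := hR2.comp continuous_swap
    refine ((isOpen_forall_compact (P := fun x t => ‖evv (W t) x - evv (R t) x‖ < ‖evv (R t) x‖)
      ?_).inter ?_).inter ?_
    · exact isOpen_lt (c4.sub c5).norm c5.norm
    · exact isOpen_lt (c1.sub c2).norm c2.norm
    · exact isOpen_lt (c1.sub c3).norm c3.norm
  obtain ⟨e, he, heO⟩ := strip r.continuous hO (s := s) (by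
    intro x hx
    refine ⟨⟨fun t => ?_, ha' x hx.ge (hx.trans_le hss)⟩, haH x hx.ge (hx.trans_le hss)⟩
    have h1 := hWp t x hx
    have h2 := hpR t x hx
    have h3 : c ≤ ‖evv (R t) x‖ := hcR (t, x) hx
    have h4 : ‖evv (W t) x - evv (R t) x‖ ≤ ‖evv (W t) x - evv (fun i => (p t i : C(X, ℂ))) x‖ +
      ‖evv (cA (p t)) x - evv (R t) x‖ := norm_sub_le_norm_sub_add_norm_sub _ _ _
    linarith)
  obtain ⟨lam, hl0, hl1⟩ := exists_cutoff (a := s - e) (b := s - e / 2) (by linarith)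
  obtain ⟨kap, hk0, hk1⟩ := exists_cutoff (a := s - e / 2) (b := s) (by linarith)
  let k : C(X, I) := kap.comp r
  have hk0 : ∀ x, r x ≤ s - e / 2 → k x = 0 := fun x hx => hk0 (r x) hx
  have hk1 : ∀ x, s ≤ r x → k x = 1 := fun x hx => hk1 (r x) hx
  have hk : (⟨fun x => ((k x : ℝ) : ℂ), by fun_prop⟩ : C(X, ℂ)) ∈ A' :=
    hcomp ⟨fun ρ => (kap ρ : ℝ), by fun_prop⟩
  have hstrip : ∀ x, s - e ≤ r x → r x ≤ s → (∀ t, ‖evv (W t) x - evv (R t) x‖ < ‖evv (R t) x‖) ∧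
      ‖evv (cA a) x - evv b x‖ < ‖evv b x‖ ∧ ‖evv (cA a) x - evv H x‖ < ‖evv H x‖ := by
    intro x h1 h2
    have := heO x (by rw [abs_le]; constructor <;> linarith)
    exact ⟨this.1.1, this.1.2, this.2⟩
  have evu : ∀ (P : I → ι → C(X, ℂ)) (hP : Continuous P) τ x,
      evv (diagV P hP (uFam lam r τ)) x = evv (P (max (lam (r x)) τ)) x := fun _ _ _ _ => rfl
  have ev1 : ∀ (P : I → ι → C(X, ℂ)) (hP : Continuous P) τ x, s - e / 2 ≤ r x →
      evv (diagV P hP (uFam lam r τ)) x = evv (P 1) x := by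
    intro P hP τ x hx
    rw [evu, hl1 _ hx, max_eq_left (by exact τ.2.2)]
  have ev2 : ∀ (P : I → ι → C(X, ℂ)) (hP : Continuous P) x,
      evv (diagV P hP (uFam lam r 1)) x = evv (P 1) x := by
    intro P hP x
    rw [evu, max_eq_right (by exact (lam (r x)).2.2)]
  have hWA' : ∀ t i, W t i ∈ A' := fun t i => hAA (hWA t i)
  have hRA' : ∀ t i, R t i ∈ A' := fun t i => (hRU t).1 i
  -- the middle segment near b
  have key : ∀ τ x, r x ≤ s' → s - e / 2 ≤ r x →
      ‖evv (mix k (diagV W hWc (uFam lam r τ)) (cA a)) x - evv b x‖ < ‖evv b x‖ := by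
    intro τ x h1 h2
    rcases le_total (r x) s with h3 | h3
    · obtain ⟨q1, q2, q3⟩ := hstrip x (by linarith) h3
      refine mix_near ?_ q2
      rw [ev1 _ _ _ _ h2, ← hR1]
      exact q1 1
    · rw [mix_one (hk1 _ h3)]
      exact ha' x h3 h1
  have J1 : JoinedIn (Uset ι A' {x | r x ≤ s'}) (diagV R hRc (uFam lam r 0)) b := by
    refine joinedIn_of_cont (fun τ => diagV R hRc (uFam lam r τ)) (diagV_continuous _ _ _ _) rfl ?_ ?_
    · funext i; ext x
      have := ev2 R hRc x
      rw [hR1] at this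
      exact congrFun this i
    · intro τ
      refine ⟨diagV_mem hA' r hcomp _ _ hRA' _ _, fun x _ => ?_⟩
      rcases le_total (r x) s with h3 | h3
      · exact hRn _ x h3
      · rw [ev1 _ _ _ _ (by linarith), hR1]; exact hbn x
  have J2 : JoinedIn (Uset ι A' {x | r x ≤ s'}) (diagV R hRc (uFam lam r 0))
      (mix k (diagV W hWc (uFam lam r 0)) (cA a)) := by
    refine joinedIn_segment (diagV_mem hA' r hcomp _ _ hRA' _ _)
      (mix_mem hk (diagV_mem hA' r hcomp _ _ hWA' _ _) (haA a)) fun x hx => ?_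
    rcases le_total (r x) (s - e / 2) with h1 | h1
    · rw [mix_zero (hk0 _ h1)]
      rcases le_total (r x) (s - e) with h2 | h2
      · refine ⟨evv (cA g) x, ?_⟩
        have hn : evv (cA g) x ≠ 0 := by
          rw [← hR0]; exact hRn 0 x (by linarith)
        rw [evu, evu, hl0 _ h2, max_self, hR0, hW0, sub_self, norm_zero, norm_pos_iff]
        exact ⟨hn, hn⟩
      · refine ⟨evv (R (max (lam (r x)) 0)) x, ?_, ?_⟩
        · rw [evu, sub_self, norm_zero, norm_pos_iff]
          exact hRn _ x (by linarith)
        · rw [evu]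
          exact (hstrip x h2 (by linarith)).1 _
    · refine ⟨evv b x, ?_, key 0 x hx h1⟩
      rw [ev1 _ _ _ _ h1, hR1, sub_self, norm_zero, norm_pos_iff]
      exact hbn x
  have J3 : JoinedIn (Uset ι A' {x | r x ≤ s'}) (mix k (diagV W hWc (uFam lam r 0)) (cA a))
      (mix k (diagV W hWc (uFam lam r 1)) (cA a)) := by
    refine joinedIn_of_cont (fun τ => mix k (diagV W hWc (uFam lam r τ)) (cA a))
      (mix_continuous _ _ (diagV_continuous _ _ _ _)) rfl rfl fun τ => ?_
    refine ⟨mix_mem hk (diagV_mem hA' r hcomp _ _ hWA' _ _) (haA a), fun x hx => ?_⟩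
    rcases le_total (r x) (s - e / 2) with h1 | h1
    · rw [mix_zero (hk0 _ h1)]
      exact hWn _ x (by linarith)
    · exact ne_zero_of_near (key τ x hx h1)
  have J4 : JoinedIn (Uset ι A' {x | r x ≤ s'}) (mix k (diagV W hWc (uFam lam r 1)) (cA a)) H := by
    refine joinedIn_segment (mix_mem hk (diagV_mem hA' r hcomp _ _ hWA' _ _) (haA a))
      (fun i => hAA (hHA i)) fun x hx => ?_
    have q : ‖evv (mix k (diagV W hWc (uFam lam r 1)) (cA a)) x - evv H x‖ < ‖evv H x‖ := by
      rcases le_total (r x) s with h2 | h2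
      · rcases le_total (r x) (s - e / 2) with h1 | h1
        · rw [mix_zero (hk0 _ h1), ev2]
          exact hWH x h2
        · refine mix_near ?_ (hstrip x (by linarith) h2).2.2
          rw [ev2]; exact hWH x h2
      · rw [mix_one (hk1 _ h2)]
        exact haH x h2 hx
    refine ⟨evv H x, q, ?_⟩
    rw [sub_self, norm_zero]
    exact (norm_nonneg _).trans_lt q
  exact ⟨fun i => ⟨H i, hHA i⟩, J4.symm.trans (J3.symm.trans (J2.symm.trans J1))⟩


theorem Uset_mono {B : Subalgebra ℂ C(X, ℂ)} {S S' : Set X} (h : S ⊆ S') :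
    Uset ι B S' ⊆ Uset ι B S := fun _ hb => ⟨hb.1, fun x hx => hb.2 x (h hx)⟩

theorem sweep {A A' : Subalgebra ℂ C(X, ℂ)} (hA : IsClosed (A : Set C(X, ℂ)))
    (hA' : IsClosed (A' : Set C(X, ℂ))) (hAA : A ≤ A') (nat : Natural A)
    (g₀ : C(X, ℂ)) (hg₀ : g₀ ∈ A) (r : C(X, ℝ)) (hr : ∀ x, r x = (g₀ x).re)
    (hcomp : ∀ ψ : C(ℝ, ℝ), (⟨fun x => ((ψ (r x) : ℝ) : ℂ), by fun_prop⟩ : C(X, ℂ)) ∈ A')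
    (hloc : ∀ b : ι → C(X, ℂ), (∀ i, b i ∈ A') → ∀ s : ℝ, ∀ ε > 0, ∃ a : ι → A, ∃ η > 0, ∀ x,
      |r x - s| < η → ‖evv (cA a) x - evv b x‖ < ε)
    {b : ι → C(X, ℂ)} (hb : b ∈ Uset ι A' Set.univ) :
    ∃ g ∈ Uset ι A Set.univ, JoinedIn (Uset ι A' Set.univ) g b := by
  obtain ⟨c, hc, hcb⟩ := exists_lower isClosed_univ (evv b) (evv_continuous b) hb.2
  have hst : ∀ s s' : ℝ, s ≤ s' → ∀ a : ι → A, (∀ x, s ≤ r x → r x ≤ s' →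
      ‖evv (cA a) x - evv b x‖ < 1 / 2 * c) →
      ((∃ g : ι → A, JoinedIn (Uset ι A' {x | r x ≤ s'}) (cA g) b) ↔
      (∃ g : ι → A, JoinedIn (Uset ι A' {x | r x ≤ s}) (cA g) b)) := by
    intro s s' hss a ha
    constructor
    · rintro ⟨g, hg⟩
      exact ⟨g, hg.mono (Uset_mono fun x (hx : r x ≤ s) => hx.trans hss)⟩
    · rintro ⟨g, hg⟩
      refine step hA hA' hAA nat g₀ hg₀ r hr hcomp hloc hb a g (fun x h1 h2 => ?_) hg hss
      have := hcb x trivial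
      have := ha x h1 h2
      linarith
  have := clopen_all (T := ℝ) (fun s => ∃ g : ι → A, JoinedIn (Uset ι A' {x | r x ≤ s}) (cA g) b)
    (fun s₀ => by
      obtain ⟨a, η, hη, h⟩ := hloc b hb.1 s₀ (1 / 2 * c) (by positivity)
      filter_upwards [Metric.ball_mem_nhds s₀ hη] with s hs
      rw [Real.ball_eq_Ioo] at hs
      rcases le_total s₀ s with h1 | h1
      · exact hst s₀ s h1 a fun x h2 h3 => h x (by rw [abs_lt]; constructor <;> linarith [hs.1, hs.2])
      · exact (hst s s₀ h1 a fun x h2 h3 => h x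
          (by rw [abs_lt]; constructor <;> linarith [hs.1, hs.2])).symm)
    (a := -‖r‖ - 1) ⟨0, joinedIn_segment (fun i => A'.zero_mem) hb.1 fun x (hx : r x ≤ _) => by
      have := (abs_le.1 (r.norm_coe_le_norm x)).1
      linarith⟩ (‖r‖ + 1)
  obtain ⟨g, hg⟩ := this
  have e : {x | r x ≤ ‖r‖ + 1} = Set.univ := by
    ext x
    have := (abs_le.1 (r.norm_coe_le_norm x)).2
    simp only [Set.mem_univ, iff_true]
    change r x ≤ ‖r‖ + 1
    linarith
  rw [e] at hg
  exact ⟨cA g, ⟨fun i => (g i).2, hg.source_mem.2⟩, hg⟩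

end

end

section
open Topology
set_option linter.unusedSectionVars false
open scoped unitInterval

section
variable {ι : Type*} [Fintype ι] [DecidableEq ι]
variable {X : Type*} [TopologicalSpace X] [CompactSpace X] [T2Space X]

/-- real part -/
noncomputable def reC (g : C(X, ℂ)) : C(X, ℂ) := ⟨fun x => ((g x).re : ℂ), by fun_prop⟩

/-- real part, real valued -/
noncomputable def reR (g : C(X, ℂ)) : C(X, ℝ) := ⟨fun x => (g x).re, by fun_prop⟩

/-- the closed algebra generated by `A` and real parts of elements of `S` -/
noncomputable def extA (A : Subalgebra ℂ C(X, ℂ)) (S : Set C(X, ℂ)) : Subalgebra ℂ C(X, ℂ) :=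
  (Algebra.adjoin ℂ ((A : Set C(X, ℂ)) ∪ reC '' S)).topologicalClosure

theorem extA_closed (A : Subalgebra ℂ C(X, ℂ)) (S : Set C(X, ℂ)) :
    IsClosed (extA A S : Set C(X, ℂ)) := Subalgebra.isClosed_topologicalClosure _

theorem le_extA (A : Subalgebra ℂ C(X, ℂ)) (S : Set C(X, ℂ)) : A ≤ extA A S :=
  fun _ ha => Subalgebra.le_topologicalClosure _ (Algebra.subset_adjoin (Or.inl ha))

theorem re_mem_extA (A : Subalgebra ℂ C(X, ℂ)) {S : Set C(X, ℂ)} {g : C(X, ℂ)} (hg : g ∈ S) :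
    reC g ∈ extA A S :=
  Subalgebra.le_topologicalClosure _ (Algebra.subset_adjoin (Or.inr ⟨g, hg, rfl⟩))

theorem extA_le {A B : Subalgebra ℂ C(X, ℂ)} {S : Set C(X, ℂ)} (hB : IsClosed (B : Set C(X, ℂ)))
    (h1 : A ≤ B) (h2 : ∀ g ∈ S, reC g ∈ B) : extA A S ≤ B := by
  refine Subalgebra.topologicalClosure_minimal (Algebra.adjoin_le ?_) hB
  rintro x (hx | ⟨g, hg, rfl⟩)
  · exact h1 hx
  · exact h2 g hg

theorem nsq_aux (z : ℂ) (t : ℝ) : ‖z + t * Complex.I‖ ^ 2 = z.re ^ 2 + (z.im + t) ^ 2 := by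
  rw [← Complex.normSq_eq_norm_sq, Complex.normSq_apply]
  simp
  ring

theorem char_real {B : Subalgebra ℂ C(X, ℂ)} (χ : B →ₐ[ℂ] ℂ) (hχ : ∀ a, ‖χ a‖ ≤ ‖a‖) (ρ : B)
    (hρ : ∀ x, ((ρ : C(X, ℂ)) x).im = 0) : (χ ρ).im = 0 := by
  have key : ∀ t : ℝ, (χ ρ).re ^ 2 + ((χ ρ).im + t) ^ 2 ≤ ‖ρ‖ ^ 2 + t ^ 2 := by
    intro t
    have h1 := hχ (ρ + algebraMap ℂ B (t * Complex.I))
    have h2 : ‖ρ + algebraMap ℂ B (t * Complex.I)‖ ≤ Real.sqrt (‖ρ‖ ^ 2 + t ^ 2) := by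
      change ‖((ρ + algebraMap ℂ B (t * Complex.I) : B) : C(X, ℂ))‖ ≤ _
      rw [ContinuousMap.norm_le _ (Real.sqrt_nonneg _)]
      intro x
      have h3 : ‖(ρ : C(X, ℂ)) x‖ ≤ ‖ρ‖ := (ρ : C(X, ℂ)).norm_coe_le_norm x
      refine Real.le_sqrt_of_sq_le ?_
      have e : ((ρ + algebraMap ℂ B (t * Complex.I) : B) : C(X, ℂ)) x =
        (ρ : C(X, ℂ)) x + t * Complex.I := rfl
      have h4 : ‖(ρ : C(X, ℂ)) x‖ ^ 2 ≤ ‖ρ‖ ^ 2 := by gcongr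
      have h5 := nsq_aux ((ρ : C(X, ℂ)) x) 0
      rw [Complex.ofReal_zero, zero_mul, add_zero, hρ x] at h5
      rw [e, nsq_aux, hρ x]
      linarith
    have e : χ (ρ + algebraMap ℂ B (t * Complex.I)) = χ ρ + t * Complex.I := by
      refine (χ.map_add' _ _).trans ?_
      have := χ.commutes (t * Complex.I)
      change χ ρ + χ (algebraMap ℂ B (t * Complex.I)) = _
      rw [this]; rfl
    rw [e] at h1
    have h6 : ‖χ ρ + t * Complex.I‖ ^ 2 ≤ ‖ρ‖ ^ 2 + t ^ 2 := by
      have := Real.sq_sqrt (show 0 ≤ ‖ρ‖ ^ 2 + t ^ 2 by positivity)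
      rw [← this]
      have := h1.trans h2
      gcongr
    rwa [nsq_aux] at h6
  generalize χ ρ = z at key ⊢
  generalize ‖ρ‖ = q at key
  by_contra h
  have := key ((q ^ 2 + 1) / (2 * z.im))
  have e : 2 * z.im * ((q ^ 2 + 1) / (2 * z.im)) = q ^ 2 + 1 := by
    field_simp
  nlinarith [sq_nonneg z.re, sq_nonneg z.im]

theorem natural_extA {A : Subalgebra ℂ C(X, ℂ)} (nat : Natural A) {S : Set C(X, ℂ)}
    (hS : S ⊆ A) : Natural (extA A S) := by
  intro χ hχ
  obtain ⟨x, hx⟩ := nat (χ.comp (Subalgebra.inclusion (le_extA A S))) (fun a => hχ _)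
  refine ⟨x, ?_⟩
  have hgA : ∀ a (ha : a ∈ A), χ ⟨a, le_extA A S ha⟩ = a x := fun a ha => hx ⟨a, ha⟩
  have hgS : ∀ g (hg : g ∈ S), χ ⟨reC g, re_mem_extA A hg⟩ = reC g x := by
    intro g hg
    have h1 := char_real χ hχ ⟨reC g, re_mem_extA A hg⟩ (fun x => by simp [reC])
    have hm : (-Complex.I) • (g - reC g) ∈ extA A S :=
      (extA A S).smul_mem ((extA A S).sub_mem (le_extA A S (hS hg)) (re_mem_extA A hg)) _
    have h2 := char_real χ hχ ⟨_, hm⟩ (fun x => by simp [reC])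
    have e : (⟨_, hm⟩ : extA A S) = algebraMap ℂ (extA A S) (-Complex.I) *
        (⟨g, le_extA A S (hS hg)⟩ - ⟨reC g, re_mem_extA A hg⟩) := rfl
    rw [e, map_mul, map_sub, hgA g (hS hg), AlgHom.commutes] at h2
    have e2 : reC g x = ((g x).re : ℂ) := rfl
    rw [e2]
    generalize χ ⟨reC g, re_mem_extA A hg⟩ = z at h1 h2 ⊢
    simp at h2
    apply Complex.ext
    · rw [Complex.ofReal_re]; linarith
    · rw [Complex.ofReal_im]; exact h1
  have hc : Continuous χ := AddMonoidHomClass.continuous_of_bound χ 1 (fun a => (hχ a).trans_eq (one_mul _).symm)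
  have hev : Continuous fun a : extA A S => (a : C(X, ℂ)) x :=
    (continuous_eval_const x).comp continuous_subtype_val
  have hle : Algebra.adjoin ℂ ((A : Set C(X, ℂ)) ∪ reC '' S) ≤ extA A S :=
    Subalgebra.le_topologicalClosure _
  have had : ∀ a (ha : a ∈ Algebra.adjoin ℂ ((A : Set C(X, ℂ)) ∪ reC '' S)),
      χ ⟨a, hle ha⟩ = a x := by
    intro a ha
    induction ha using Algebra.adjoin_induction with
    | mem a ha =>
      rcases ha with ha | ⟨g, hg, rfl⟩
      · exact hgA a ha
      · exact hgS g hg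
    | algebraMap r => exact χ.commutes r
    | add a b ha hb h1 h2 =>
      rw [ContinuousMap.add_apply, ← h1, ← h2]; exact χ.map_add' ⟨a, hle ha⟩ ⟨b, hle hb⟩
    | mul a b ha hb h1 h2 =>
      rw [ContinuousMap.mul_apply, ← h1, ← h2]; exact map_mul χ ⟨a, hle ha⟩ ⟨b, hle hb⟩
  rintro ⟨a, ha⟩
  obtain ⟨u, hu, hul⟩ := mem_closure_iff_seq_limit.1 (show a ∈ closure
    (Algebra.adjoin ℂ ((A : Set C(X, ℂ)) ∪ reC '' S) : Set C(X, ℂ)) from ha)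
  have hlim : Filter.Tendsto (fun n => (⟨u n, hle (hu n)⟩ : extA A S)) Filter.atTop
    (𝓝 ⟨a, ha⟩) := tendsto_subtype_rng.2 hul
  have h1 := (hc.tendsto _).comp hlim
  have h2 := (hev.tendsto _).comp hlim
  refine tendsto_nhds_unique h1 (h2.congr fun n => ?_)
  exact (had _ (hu n)).symm

theorem extA_comp (A : Subalgebra ℂ C(X, ℂ)) (g : C(X, ℂ)) (ψ : C(ℝ, ℝ)) :
    (⟨fun x => ((ψ (reR g x) : ℝ) : ℂ), by fun_prop⟩ : C(X, ℂ)) ∈ extA A {g} := by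
  change _ ∈ closure ((Algebra.adjoin ℂ ((A : Set C(X, ℂ)) ∪ reC '' {g})) : Set C(X, ℂ))
  rw [Metric.mem_closure_iff]
  intro ε hε
  obtain ⟨p, hp⟩ := exists_polynomial_near_of_continuousOn (-‖reR g‖) ‖reR g‖ ψ
    ψ.continuous.continuousOn (ε / 2) (by positivity)
  refine ⟨Polynomial.aeval (reC g) (p.map (algebraMap ℝ ℂ)), ?_, ?_⟩
  · exact Algebra.adjoin_mono (by simp) (Polynomial.aeval_mem_adjoin_singleton (R := ℂ) (reC g))
  · refine lt_of_le_of_lt ?_ (half_lt_self hε)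
    rw [ContinuousMap.dist_le (by positivity)]
    intro x
    have h1 : (Polynomial.aeval (reC g) (p.map (algebraMap ℝ ℂ))) x = ((p.eval (reR g x) : ℝ) : ℂ) := by
      rw [Polynomial.aeval_continuousMap_apply]
      exact (Polynomial.eval_map_algebraMap p _).trans
        (Polynomial.aeval_algebraMap_apply_eq_algebraMap_eval (reR g x) p)
    rw [h1, dist_comm]
    change dist (((p.eval (reR g x) : ℝ) : ℂ)) ((ψ (reR g x) : ℝ) : ℂ) ≤ _
    rw [dist_eq_norm, ← Complex.ofReal_sub, Complex.norm_real, Real.norm_eq_abs]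
    exact (hp _ (abs_le.1 ((reR g).norm_coe_le_norm x))).le

/-- local approximability along level sets -/
def Loc (A : Subalgebra ℂ C(X, ℂ)) (r : C(X, ℝ)) (b : C(X, ℂ)) : Prop :=
  ∀ s : ℝ, ∀ ε > 0, ∃ a ∈ A, ∃ η > 0, ∀ x, |r x - s| < η → ‖a x - b x‖ < ε

theorem loc_extA (A : Subalgebra ℂ C(X, ℂ)) (g : C(X, ℂ)) {b : C(X, ℂ)} (hb : b ∈ extA A {g}) :
    Loc A (reR g) b := by
  have hadj : ∀ b ∈ Algebra.adjoin ℂ ((A : Set C(X, ℂ)) ∪ reC '' {g}), Loc A (reR g) b := by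
    intro b hb
    induction hb using Algebra.adjoin_induction with
    | mem a ha =>
      rcases ha with ha | ⟨g', hg, rfl⟩
      · exact fun s ε hε => ⟨a, ha, 1, one_pos, fun x _ => by simpa using hε⟩
      · obtain rfl : g' = g := hg
        intro s ε hε
        refine ⟨algebraMap ℂ _ s, A.algebraMap_mem _, ε, hε, fun x hx => ?_⟩
        change ‖(s : ℂ) - ((reR g' x : ℝ) : ℂ)‖ < ε
        rw [← Complex.ofReal_sub, Complex.norm_real, Real.norm_eq_abs, abs_sub_comm]
        exact hx
    | algebraMap r => exact fun s ε hε => ⟨_, A.algebraMap_mem r, 1, one_pos, fun x _ => by simpa using hε⟩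
    | add a b ha hb h1 h2 =>
      intro s ε hε
      obtain ⟨a', ha', η, hη, h3⟩ := h1 s (ε / 2) (by positivity)
      obtain ⟨b', hb', η', hη', h4⟩ := h2 s (ε / 2) (by positivity)
      refine ⟨a' + b', A.add_mem ha' hb', min η η', lt_min hη hη', fun x hx => ?_⟩
      have q1 := h3 x (hx.trans_le (min_le_left _ _))
      have q2 := h4 x (hx.trans_le (min_le_right _ _))
      have e : (a' + b') x - (a + b) x = (a' x - a x) + (b' x - b x) := by
        simp; ring
      rw [e]
      exact (norm_add_le _ _).trans_lt (by linarith)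
    | mul a b ha hb h1 h2 =>
      intro s ε hε
      set δ := min 1 (ε / (2 * (‖a‖ + ‖b‖ + 1))) with hδ
      have hδ0 : 0 < δ := lt_min one_pos (by positivity)
      have hδ1 : δ ≤ 1 := min_le_left _ _
      have hδ2 : δ * (‖a‖ + ‖b‖ + 1) ≤ ε / 2 := by
        have : δ ≤ ε / (2 * (‖a‖ + ‖b‖ + 1)) := min_le_right _ _
        rw [le_div_iff₀ (by positivity)] at this
        linarith
      obtain ⟨a', ha', η, hη, h3⟩ := h1 s δ hδ0
      obtain ⟨b', hb', η', hη', h4⟩ := h2 s δ hδ0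
      refine ⟨a' * b', A.mul_mem ha' hb', min η η', lt_min hη hη', fun x hx => ?_⟩
      have q1 := h3 x (hx.trans_le (min_le_left _ _))
      have q2 := h4 x (hx.trans_le (min_le_right _ _))
      have e : (a' * b') x - (a * b) x = (a' x - a x) * (b' x - b x) + (a' x - a x) * b x +
        a x * (b' x - b x) := by
        simp; ring
      rw [e]
      have n1 := a.norm_coe_le_norm x
      have n2 := b.norm_coe_le_norm x
      have p1 : ‖(a' x - a x) * (b' x - b x)‖ ≤ δ * 1 := by
        rw [norm_mul]; gcongr; linarith
      have p2 : ‖(a' x - a x) * b x‖ ≤ δ * ‖b‖ := by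
        rw [norm_mul]; gcongr
      have p3 : ‖a x * (b' x - b x)‖ ≤ δ * ‖a‖ := by
        rw [norm_mul, mul_comm]; gcongr
      have := norm_add₃_le (a := (a' x - a x) * (b' x - b x)) (b := (a' x - a x) * b x)
        (c := a x * (b' x - b x))
      nlinarith
  intro s ε hε
  obtain ⟨b', hb', h1⟩ := Metric.mem_closure_iff.1 (show b ∈ closure _ from hb) (ε / 2) (by positivity)
  obtain ⟨a, ha, η, hη, h⟩ := hadj b' hb' s (ε / 2) (by positivity)
  refine ⟨a, ha, η, hη, fun x hx => ?_⟩
  have h2 := h x hx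
  have h3 : ‖b' x - b x‖ < ε / 2 := by
    rw [← dist_eq_norm, dist_comm]
    exact (ContinuousMap.dist_apply_le_dist x).trans_lt h1
  have := norm_sub_le_norm_sub_add_norm_sub (a x) (b' x) (b x)
  linarith

theorem locV_extA (A : Subalgebra ℂ C(X, ℂ)) (g : C(X, ℂ)) (b : ι → C(X, ℂ))
    (hb : ∀ i, b i ∈ extA A {g}) (s : ℝ) (ε : ℝ) (hε : 0 < ε) : ∃ a : ι → A, ∃ η > 0, ∀ x,
      |reR g x - s| < η → ‖evv (cA a) x - evv b x‖ < ε := by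
  choose a ha η hη h using fun i => loc_extA A g (hb i) s ε hε
  refine ⟨fun i => ⟨a i, ha i⟩, ?_⟩
  have : ∀ᶠ y : ℝ in 𝓝 s, ∀ i, |y - s| < η i := by
    rw [Filter.eventually_all]
    intro i
    filter_upwards [Metric.ball_mem_nhds s (hη i)] with y hy
    exact hy
  obtain ⟨η', hη', h'⟩ := Metric.eventually_nhds_iff.1 this
  refine ⟨η', hη', fun x hx => ?_⟩
  rw [pi_norm_lt_iff hε]
  intro i
  exact h i x (h' hx i)

theorem sweep1 {A : Subalgebra ℂ C(X, ℂ)} (hA : IsClosed (A : Set C(X, ℂ))) (nat : Natural A)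
    {g₀ : C(X, ℂ)} (hg₀ : g₀ ∈ A) {b : ι → C(X, ℂ)} (hb : b ∈ Uset ι (extA A {g₀}) Set.univ) :
    ∃ g ∈ Uset ι A Set.univ, JoinedIn (Uset ι (extA A {g₀}) Set.univ) g b :=
  sweep hA (extA_closed _ _) (le_extA _ _) nat g₀ hg₀ (reR g₀) (fun _ => rfl) (extA_comp A g₀)
    (locV_extA A g₀) hb

theorem Uset_mono_alg {A B : Subalgebra ℂ C(X, ℂ)} {S : Set X} (h : A ≤ B) :
    Uset ι A S ⊆ Uset ι B S := fun _ hb => ⟨fun i => h (hb.1 i), hb.2⟩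

theorem sweepF {A : Subalgebra ℂ C(X, ℂ)} (hA : IsClosed (A : Set C(X, ℂ))) (nat : Natural A)
    {F : Set C(X, ℂ)} (hF : F.Finite) (hFA : F ⊆ A) {b : ι → C(X, ℂ)}
    (hb : b ∈ Uset ι (extA A F) Set.univ) :
    ∃ g ∈ Uset ι A Set.univ, JoinedIn (Uset ι (extA A F) Set.univ) g b := by
  induction F, hF using Set.Finite.induction_on generalizing b with
  | empty =>
    have : extA A ∅ ≤ A := extA_le hA le_rfl (by simp)
    exact ⟨b, Uset_mono_alg this hb, JoinedIn.refl hb⟩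
  | @insert g F hg hF ih =>
    have h1 : extA A (insert g F) ≤ extA (extA A F) {g} := by
      refine extA_le (extA_closed _ _) ((le_extA _ _).trans (le_extA _ _)) ?_
      rintro g' (rfl | hg')
      · exact re_mem_extA _ rfl
      · exact le_extA _ _ (re_mem_extA _ hg')
    have h0 : extA A F ≤ extA A (insert g F) :=
      extA_le (extA_closed _ _) (le_extA _ _) fun g' hg' => re_mem_extA _ (Or.inr hg')
    have h2 : extA (extA A F) {g} ≤ extA A (insert g F) := by
      refine extA_le (extA_closed _ _) h0 ?_
      rintro g' rfl
      exact re_mem_extA _ (Or.inl rfl)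
    have hFA' : F ⊆ A := (Set.subset_insert _ _).trans hFA
    obtain ⟨g1, hg1, hj1⟩ := sweep1 (extA_closed A F) (natural_extA nat hFA')
      (le_extA A F (hFA (Set.mem_insert _ _))) (Uset_mono_alg h1 hb)
    obtain ⟨g2, hg2, hj2⟩ := ih hFA' hg1
    exact ⟨g2, hg2, (hj2.mono (Uset_mono_alg h0)).trans (hj1.mono (Uset_mono_alg h2))⟩

/-- admissible pairs -/
structure Adm (A B : Subalgebra ℂ C(X, ℂ)) : Prop where
  clA : IsClosed (A : Set C(X, ℂ))
  clB : IsClosed (B : Set C(X, ℂ))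
  le : A ≤ B
  nat : Natural A
  gen : B ≤ extA A {g | g ∈ A ∧ reC g ∈ B}

theorem adjoin_finite (A : Subalgebra ℂ C(X, ℂ)) (S : Set C(X, ℂ)) {b : C(X, ℂ)}
    (hb : b ∈ Algebra.adjoin ℂ ((A : Set C(X, ℂ)) ∪ reC '' S)) :
    ∃ F ⊆ S, F.Finite ∧ b ∈ extA A F := by
  have mono : ∀ F F' : Set C(X, ℂ), F ⊆ F' → extA A F ≤ extA A F' := fun F F' h =>
    extA_le (extA_closed _ _) (le_extA _ _) fun g hg => re_mem_extA _ (h hg)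
  induction hb using Algebra.adjoin_induction with
  | mem a ha =>
    rcases ha with ha | ⟨g, hg, rfl⟩
    · exact ⟨∅, by simp, Set.finite_empty, le_extA _ _ ha⟩
    · exact ⟨{g}, by simpa using hg, Set.finite_singleton g, re_mem_extA _ rfl⟩
  | algebraMap r => exact ⟨∅, by simp, Set.finite_empty, Subalgebra.algebraMap_mem _ _⟩
  | add a b _ _ k1 k2 =>
    obtain ⟨F, h1, h2, h3⟩ := k1
    obtain ⟨F', h1', h2', h3'⟩ := k2
    exact ⟨F ∪ F', Set.union_subset h1 h1', h2.union h2', Subalgebra.add_mem _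
      (mono _ _ Set.subset_union_left h3) (mono _ _ Set.subset_union_right h3')⟩
  | mul a b _ _ k1 k2 =>
    obtain ⟨F, h1, h2, h3⟩ := k1
    obtain ⟨F', h1', h2', h3'⟩ := k2
    exact ⟨F ∪ F', Set.union_subset h1 h1', h2.union h2', Subalgebra.mul_mem _
      (mono _ _ Set.subset_union_left h3) (mono _ _ Set.subset_union_right h3')⟩

theorem pi0 {A B : Subalgebra ℂ C(X, ℂ)} (adm : Adm A B) {b : ι → C(X, ℂ)}
    (hb : b ∈ Uset ι B Set.univ) :
    ∃ g ∈ Uset ι A Set.univ, JoinedIn (Uset ι B Set.univ) g b := by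
  obtain ⟨c, hc, hcb⟩ := exists_lower isClosed_univ (evv b) (evv_continuous b) hb.2
  choose b' hb' hd using fun i => Metric.mem_closure_iff.1 (show b i ∈ closure _ from
    adm.gen (hb.1 i)) c hc
  choose F hFS hFf hFb using fun i => adjoin_finite _ _ (hb' i)
  have hFB : extA A (⋃ i, F i) ≤ B := extA_le adm.clB adm.le fun g hg => by
    obtain ⟨i, hi⟩ := Set.mem_iUnion.1 hg
    exact (hFS i hi).2
  have hbF : ∀ i, b' i ∈ extA A (⋃ i, F i) := fun i =>
    extA_le (extA_closed _ _) (le_extA _ _)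
      (fun g hg => re_mem_extA _ (Set.mem_iUnion_of_mem i hg)) (hFb i)
  have hnear : ∀ x, ‖evv b' x - evv b x‖ < ‖evv b x‖ := by
    intro x
    refine lt_of_lt_of_le ?_ (hcb x trivial)
    rw [pi_norm_lt_iff hc]
    intro i
    change ‖b' i x - b i x‖ < c
    rw [← dist_eq_norm, dist_comm]
    exact (ContinuousMap.dist_apply_le_dist x).trans_lt (hd i)
  have hj : JoinedIn (Uset ι B Set.univ) b' b :=
    joinedIn_segment (fun i => hFB (hbF i)) hb.1 fun x _ => ⟨evv b x, hnear x, by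
      rw [sub_self, norm_zero, norm_pos_iff]; exact hb.2 x trivial⟩
  obtain ⟨g, hg, hjg⟩ := sweepF adm.clA adm.nat (Set.finite_iUnion hFf) (F := ⋃ i, F i)
    (Set.iUnion_subset fun i g hg => (hFS i hg).1) (b := b') ⟨hbF, fun x _ => ne_zero_of_near (hnear x)⟩
  exact ⟨g, hg, (hjg.mono (Uset_mono_alg hFB)).trans hj⟩

end

end

section
open Topology
set_option linter.unusedSectionVars false
open scoped unitInterval

section
variable {ι : Type*} [Fintype ι] [DecidableEq ι]
variable {X : Type*} [TopologicalSpace X] [CompactSpace X] [T2Space X]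
variable {T : Type*} [TopologicalSpace T] [CompactSpace T] [T2Space T]

noncomputable def sliceH (t : T) : C(T × X, ℂ) →ₐ[ℂ] C(X, ℂ) :=
  ContinuousMap.compRightAlgHom ℂ ℂ ⟨fun x => (t, x), by fun_prop⟩

noncomputable def fstH : C(T, ℂ) →ₐ[ℂ] C(T × X, ℂ) :=
  ContinuousMap.compRightAlgHom ℂ ℂ ⟨fun x => x.1, by fun_prop⟩

noncomputable def sndH : C(X, ℂ) →ₐ[ℂ] C(T × X, ℂ) :=
  ContinuousMap.compRightAlgHom ℂ ℂ ⟨fun x => x.2, by fun_prop⟩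

theorem sliceH_apply (t : T) (F : C(T × X, ℂ)) (x : X) : sliceH t F x = F (t, x) := rfl
theorem fstH_apply (f : C(T, ℂ)) (p : T × X) : fstH f p = f p.1 := rfl
theorem sndH_apply (f : C(X, ℂ)) (p : T × X) : (sndH f : C(T × X, ℂ)) p = f p.2 := rfl

theorem sliceH_continuous (t : T) : Continuous (sliceH t : C(T × X, ℂ) → C(X, ℂ)) :=
  ContinuousMap.compRightAlgHom_continuous ℂ ℂ _

theorem slice_continuous (F : C(T × X, ℂ)) : Continuous fun t => sliceH t F := F.curry.continuous

/-- `T`-families in `A` -/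
noncomputable def tA (T : Type*) [TopologicalSpace T] [CompactSpace T] [T2Space T]
    (A : Subalgebra ℂ C(X, ℂ)) : Subalgebra ℂ C(T × X, ℂ) := ⨅ t : T, A.comap (sliceH t)

/-- `T`-families in `B` lying in `A` over `T0` -/
noncomputable def tB (T0 : Set T) (A B : Subalgebra ℂ C(X, ℂ)) : Subalgebra ℂ C(T × X, ℂ) :=
  tA T B ⊓ ⨅ t : T0, A.comap (sliceH (t : T))

theorem mem_tA {A : Subalgebra ℂ C(X, ℂ)} {F : C(T × X, ℂ)} : F ∈ tA T A ↔ ∀ t, sliceH t F ∈ A := by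
  simp [tA, Algebra.mem_iInf]

theorem mem_tB {T0 : Set T} {A B : Subalgebra ℂ C(X, ℂ)} {F : C(T × X, ℂ)} :
    F ∈ tB T0 A B ↔ (∀ t, sliceH t F ∈ B) ∧ ∀ t ∈ T0, sliceH t F ∈ A := by
  rw [tB, Algebra.mem_inf, mem_tA]
  simp [Algebra.mem_iInf]

theorem tA_closed {A : Subalgebra ℂ C(X, ℂ)} (hA : IsClosed (A : Set C(X, ℂ))) :
    IsClosed (tA T A : Set C(T × X, ℂ)) := by
  have : (tA T A : Set C(T × X, ℂ)) = ⋂ t, sliceH t ⁻¹' A := by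
    ext F; simp [mem_tA]
  rw [this]
  exact isClosed_iInter fun t => hA.preimage (sliceH_continuous t)

theorem tB_closed {T0 : Set T} {A B : Subalgebra ℂ C(X, ℂ)} (hA : IsClosed (A : Set C(X, ℂ)))
    (hB : IsClosed (B : Set C(X, ℂ))) : IsClosed (tB T0 A B : Set C(T × X, ℂ)) := by
  have : (tB T0 A B : Set C(T × X, ℂ)) =
      (tA T B : Set C(T × X, ℂ)) ∩ ⋂ t ∈ T0, sliceH t ⁻¹' (A : Set C(X, ℂ)) := by
    ext F; simp [mem_tA, mem_tB]
  rw [this]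
  exact (tA_closed hB).inter (isClosed_biInter fun t _ => hA.preimage (sliceH_continuous t))

theorem smul_const_mem {A : Subalgebra ℂ C(X, ℂ)} {F : C(T × X, ℂ)} (hF : F ∈ tA T A) (f : C(T, ℂ)) :
    fstH f * F ∈ tA T A := by
  rw [mem_tA] at *
  intro t
  have : sliceH t (fstH f * F) = (f t) • sliceH t F := rfl
  rw [this]; exact A.smul_mem (hF t) _

theorem fstH_mem {A : Subalgebra ℂ C(X, ℂ)} (f : C(T, ℂ)) : (fstH f : C(T × X, ℂ)) ∈ tA T A := by
  rw [mem_tA]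
  exact fun t => A.algebraMap_mem (f t)

theorem sndH_mem {A : Subalgebra ℂ C(X, ℂ)} {f : C(X, ℂ)} (hf : f ∈ A) :
    (sndH f : C(T × X, ℂ)) ∈ tA T A := by
  rw [mem_tA]
  exact fun t => hf

theorem char_CT (χ : C(T, ℂ) →ₐ[ℂ] ℂ) : ∃ t, ∀ f, χ f = f t := by
  obtain ⟨t, ht⟩ := (WeakDual.CharacterSpace.continuousMapEval_bijective T ℂ).2
    (WeakDual.CharacterSpace.equivAlgHom.symm χ)
  refine ⟨t, fun f => ?_⟩
  have h1 : WeakDual.CharacterSpace.continuousMapEval T ℂ t f = f t := rfl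
  rw [← h1, ht]
  rfl

set_option maxHeartbeats 1000000 in
theorem tA_natural {A : Subalgebra ℂ C(X, ℂ)} (nat : Natural A) : Natural (tA T A) := by
  intro χ hχ
  obtain ⟨t, ht⟩ := char_CT (χ.comp (AlgHom.codRestrict (fstH (T := T) (X := X)) (tA T A) fstH_mem))
  obtain ⟨x, hx⟩ := nat (χ.comp (AlgHom.codRestrict ((sndH (T := T) (X := X)).comp A.val) (tA T A)
    (fun a => sndH_mem a.2))) (fun a => by
      refine (hχ _).trans ?_
      change ‖(sndH (a : C(X, ℂ)) : C(T × X, ℂ))‖ ≤ ‖(a : C(X, ℂ))‖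
      rw [ContinuousMap.norm_le _ (norm_nonneg _)]
      exact fun p => (a : C(X, ℂ)).norm_coe_le_norm p.2)
  refine ⟨(t, x), ?_⟩
  have h0 : ∀ F : tA T A, sliceH t (F : C(T × X, ℂ)) = 0 → χ F = 0 := by
    intro F hF
    rw [← norm_le_zero_iff]
    refine le_of_forall_pos_le_add fun ε hε => ?_
    rw [zero_add]
    have hev : ∀ᶠ s in 𝓝 t, ‖sliceH s (F : C(T × X, ℂ))‖ < ε := by
      refine ((slice_continuous (F : C(T × X, ℂ))).norm.tendsto t).eventually_lt_const ?_
      rw [hF, norm_zero]; exact hε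
    obtain ⟨V, hV, hVo, htV⟩ := eventually_nhds_iff.1 hev
    obtain ⟨f, hf0, hf1, hfI⟩ := exists_continuous_zero_one_of_isClosed hVo.isClosed_compl
      (isClosed_singleton (x := t)) (by simpa using htV)
    let f' : C(T, ℂ) := ⟨fun s => (f s : ℂ), by fun_prop⟩
    have e1 : χ (⟨fstH f', fstH_mem f'⟩ * F) = χ F := by
      rw [map_mul]
      have : χ ⟨fstH f', fstH_mem f'⟩ = f' t := ht f'
      rw [this]
      have : f t = 1 := hf1 rfl
      simp [f', this]
    rw [← e1]
    refine (hχ _).trans ?_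
    change ‖(fstH f' * (F : C(T × X, ℂ)))‖ ≤ ε
    rw [ContinuousMap.norm_le _ hε.le]
    rintro ⟨s, y⟩
    rw [ContinuousMap.mul_apply, fstH_apply, norm_mul]
    change ‖(f s : ℂ)‖ * _ ≤ ε
    rw [Complex.norm_real, Real.norm_eq_abs, abs_of_nonneg (hfI s).1]
    by_cases hs : s ∈ V
    · have h1 := hV s hs
      have h2 : ‖(F : C(T × X, ℂ)) (s, y)‖ ≤ ‖sliceH s (F : C(T × X, ℂ))‖ :=
        (sliceH s (F : C(T × X, ℂ))).norm_coe_le_norm y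
      have h3 := (hfI s).2
      have h4 := (hfI s).1
      nlinarith [norm_nonneg ((F : C(T × X, ℂ)) (s, y))]
    · have : f s = 0 := hf0 hs
      rw [this, zero_mul]; exact hε.le
  intro F
  have hsl : sliceH t (F : C(T × X, ℂ)) ∈ A := mem_tA.1 F.2 t
  have h1 := h0 (F - ⟨sndH (sliceH t (F : C(T × X, ℂ))), sndH_mem hsl⟩) (by
    ext y; exact sub_self _)
  have h2 := χ.map_add' (F - ⟨sndH (sliceH t (F : C(T × X, ℂ))), sndH_mem hsl⟩)
    ⟨sndH (sliceH t (F : C(T × X, ℂ))), sndH_mem hsl⟩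
  rw [sub_add_cancel] at h2
  change χ F = χ _ + χ _ at h2
  rw [h1, zero_add] at h2
  rw [h2]
  exact hx ⟨_, hsl⟩

theorem local_mem {E : Subalgebra ℂ C(T × X, ℂ)} (hE : IsClosed (E : Set C(T × X, ℂ)))
    (hf : ∀ f : C(T, ℂ), fstH f ∈ E) {F : C(T × X, ℂ)}
    (h : ∀ t₀, ∀ ε > 0, ∃ H ∈ E, ∀ᶠ t in 𝓝 t₀, ∀ x, ‖H (t, x) - F (t, x)‖ ≤ ε) : F ∈ E := by
  rw [← SetLike.mem_coe, ← hE.closure_eq, Metric.mem_closure_iff]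
  intro ε hε
  choose H hH hev using fun t => h t (ε / 2) (by positivity)
  choose V hV hVo htV using fun t => eventually_nhds_iff.1 (hev t)
  obtain ⟨S, hS⟩ := isCompact_univ.elim_finite_subcover V hVo (fun t _ => Set.mem_iUnion_of_mem t (htV t))
  let e := S.equivFin
  obtain ⟨f, hfs, hf1, hfI, -⟩ := exists_continuous_sum_one_of_isOpen_isCompact
    (s := fun i : Fin S.card => V (e.symm i)) (fun i => hVo _) (isCompact_univ (X := T)) (by
      intro t _
      have := hS (Set.mem_univ t)
      simp only [Set.mem_iUnion] at this ⊢
      obtain ⟨s, hs, ht⟩ := this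
      exact ⟨e ⟨s, hs⟩, by simpa using ht⟩)
  let f' : Fin S.card → C(T, ℂ) := fun i => ⟨fun s => (f i s : ℂ), by fun_prop⟩
  refine ⟨∑ i, fstH (f' i) * H (e.symm i), E.sum_mem fun i _ => E.mul_mem (hf _) (hH _), ?_⟩
  refine lt_of_le_of_lt ?_ (half_lt_self hε)
  rw [ContinuousMap.dist_le (by positivity)]
  rintro ⟨t, x⟩
  have hsum : ∑ i, f i t = 1 := by
    have := hf1 (Set.mem_univ t)
    simpa using this
  have e1 : F (t, x) = ∑ i, (f i t : ℂ) * F (t, x) := by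
    rw [← Finset.sum_mul, ← Complex.ofReal_sum, hsum]; simp
  have e2 : (∑ i, fstH (f' i) * H (e.symm i) : C(T × X, ℂ)) (t, x) = ∑ i, (f i t : ℂ) * H (e.symm i) (t, x) := by
    rw [ContinuousMap.sum_apply]; rfl
  rw [dist_comm, dist_eq_norm, e2]
  rw [e1]
  rw [← Finset.sum_sub_distrib]
  refine (norm_sum_le _ _).trans ?_
  have : ε / 2 = ∑ i, f i t * (ε / 2) := by rw [← Finset.sum_mul, hsum, one_mul]
  rw [this]
  refine Finset.sum_le_sum fun i _ => ?_
  rw [← mul_sub, norm_mul, Complex.norm_real, Real.norm_eq_abs, abs_of_nonneg (hfI i t).1]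
  by_cases ht : t ∈ V (e.symm i)
  · exact mul_le_mul_of_nonneg_left (hV _ t ht x) (hfI i t).1
  · have : f i t = 0 := by
      by_contra h0
      exact ht (hfs i (subset_tsupport _ h0))
    rw [this]; simp

theorem exists_local_cutoff {T0 : Set T} (hT0 : IsClosed T0) {t₀ : T} (ht : t₀ ∉ T0) :
    ∃ f : C(T, ℝ), (∀ t ∈ T0, f t = 0) ∧ ∀ᶠ t in 𝓝 t₀, f t = 1 := by
  obtain ⟨V, hV, hVc, hVT⟩ := exists_mem_nhds_isClosed_subset (hT0.isOpen_compl.mem_nhds ht)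
  obtain ⟨f, hf0, hf1, -⟩ := exists_continuous_zero_one_of_isClosed hT0 hVc
    (Set.disjoint_left.2 fun t h1 h2 => hVT h2 h1)
  exact ⟨f, hf0, Filter.mem_of_superset hV hf1⟩

theorem adm_T {A B : Subalgebra ℂ C(X, ℂ)} (adm : Adm A B) {T0 : Set T} (hT0 : IsClosed T0) :
    Adm (tA T A) (tB T0 A B) where
  clA := tA_closed adm.clA
  clB := tB_closed adm.clA adm.clB
  le := fun F hF => mem_tB.2 ⟨fun t => adm.le (mem_tA.1 hF t), fun t _ => mem_tA.1 hF t⟩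
  nat := tA_natural adm.nat
  gen := by
    intro F hF
    obtain ⟨hFB, hFA⟩ := mem_tB.1 hF
    have hfst : ∀ f : C(T, ℂ), fstH f ∈ extA (tA T A) {g | g ∈ tA T A ∧ reC g ∈ tB T0 A B} :=
      fun f => le_extA _ _ (fstH_mem f)
    refine local_mem (extA_closed _ _) hfst fun t₀ ε hε => ?_
    have hnear : ∀ δ > 0, ∀ᶠ t in 𝓝 t₀, ∀ x, ‖F (t₀, x) - F (t, x)‖ ≤ δ := by
      intro δ hδ
      have := ((slice_continuous F).tendsto t₀).eventually (Metric.ball_mem_nhds _ hδ)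
      filter_upwards [this] with t ht x
      rw [← dist_eq_norm, dist_comm]
      exact (ContinuousMap.dist_apply_le_dist (f := sliceH t F) (g := sliceH t₀ F) x).trans ht.le
    by_cases ht : t₀ ∈ T0
    · exact ⟨sndH (sliceH t₀ F), le_extA _ _ (sndH_mem (hFA t₀ ht)), hnear ε hε⟩
    · obtain ⟨f, hf0, hf1⟩ := exists_local_cutoff hT0 ht
      have hadj : ∀ b ∈ Algebra.adjoin ℂ ((A : Set C(X, ℂ)) ∪ reC '' {g | g ∈ A ∧ reC g ∈ B}),
          ∃ H ∈ extA (tA T A) {g | g ∈ tA T A ∧ reC g ∈ tB T0 A B}, ∀ᶠ t in 𝓝 t₀, ∀ x,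
            H (t, x) = b x := by
        intro b hb
        induction hb using Algebra.adjoin_induction with
        | mem a ha =>
          rcases ha with ha | ⟨g, ⟨hgA, hgB⟩, rfl⟩
          · exact ⟨sndH a, le_extA _ _ (sndH_mem ha), Filter.Eventually.of_forall fun t x => rfl⟩
          · let f' : C(T, ℂ) := ⟨fun s => (f s : ℂ), by fun_prop⟩
            refine ⟨reC (fstH f' * sndH g), re_mem_extA _ ⟨?_, ?_⟩, ?_⟩
            · exact smul_const_mem (sndH_mem hgA) f'
            · have hsl : ∀ t, sliceH t (reC (fstH f' * sndH g)) = (f t : ℂ) • reC g := by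
                intro t; ext x
                have e : sliceH t (reC (fstH f' * sndH g)) x = (((f t : ℂ) * g x).re : ℂ) := rfl
                rw [e, Complex.re_ofReal_mul]
                simp [reC]
              refine mem_tB.2 ⟨fun t => ?_, fun t ht => ?_⟩
              · rw [hsl]; exact B.smul_mem hgB _
              · rw [hsl, hf0 t ht]; simp
            · filter_upwards [hf1] with t ht x
              have e : (reC (fstH f' * sndH g)) (t, x) = (((f t : ℂ) * g x).re : ℂ) := rfl
              rw [e, ht]; simp [reC]
        | algebraMap r =>
          exact ⟨algebraMap ℂ _ r, Subalgebra.algebraMap_mem _ r, Filter.Eventually.of_forall fun t x => rfl⟩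
        | add a b _ _ k1 k2 =>
          obtain ⟨H, h1, h2⟩ := k1
          obtain ⟨H', h1', h2'⟩ := k2
          refine ⟨H + H', Subalgebra.add_mem _ h1 h1', ?_⟩
          filter_upwards [h2, h2'] with t q1 q2 x
          rw [ContinuousMap.add_apply, q1, q2]; rfl
        | mul a b _ _ k1 k2 =>
          obtain ⟨H, h1, h2⟩ := k1
          obtain ⟨H', h1', h2'⟩ := k2
          refine ⟨H * H', Subalgebra.mul_mem _ h1 h1', ?_⟩
          filter_upwards [h2, h2'] with t q1 q2 x
          rw [ContinuousMap.mul_apply, q1, q2]; rfl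
      obtain ⟨b, hb, hbd⟩ := Metric.mem_closure_iff.1 (show sliceH t₀ F ∈ closure _ from
        adm.gen (hFB t₀)) (ε / 2) (by positivity)
      obtain ⟨H, hH, hHe⟩ := hadj b hb
      refine ⟨H, hH, ?_⟩
      filter_upwards [hHe, hnear (ε / 2) (by positivity)] with t h1 h2 x
      rw [h1]
      have h3 : ‖b x - F (t₀, x)‖ ≤ ε / 2 := by
        rw [← dist_eq_norm, dist_comm]
        exact ((ContinuousMap.dist_apply_le_dist (f := sliceH t₀ F) (g := b) x).trans_lt hbd).le
      have := norm_sub_le_norm_sub_add_norm_sub (b x) (F (t₀, x)) (F (t, x))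
      linarith [h2 x]

end

end

section
open Topology
set_option linter.unusedSectionVars false
open scoped unitInterval

section ndr

/-- projection to the interval -/
noncomputable def prI (q : ℝ) : I := Set.projIcc 0 1 zero_le_one q

theorem prI_continuous : Continuous prI := continuous_projIcc (h := zero_le_one)

theorem prI_coe (t : I) : prI (t : ℝ) = t := Set.projIcc_val _ t

theorem prI_of_le {q : ℝ} (h : q ≤ 0) : prI q = 0 := Set.projIcc_of_le_left _ h

theorem prI_of_ge {q : ℝ} (h : 1 ≤ q) : prI q = 1 := Set.projIcc_of_right_le _ h

theorem ndr_ext {T E : Type*} [TopologicalSpace T] [TopologicalSpace E] {T0 : Set T}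
    {Z Y : Set E} (D : T → ℝ → T) (hD : Continuous (Function.uncurry D)) (u : T → ℝ)
    (hu : Continuous u) (hunn : ∀ w, 0 ≤ u w) (hu0 : ∀ w ∈ T0, u w = 0) (hD0 : ∀ w, D w 0 = w)
    (hDT : ∀ w ∈ T0, ∀ s, D w s = w) (hDu : ∀ w, u w ≤ 1 / 2 → D w (u w) ∈ T0)
    (r : T → E) (hr : Continuous r) (hrZ : ∀ w, r w ∈ Z)
    (G : T → I → E) (hG : ContinuousOn (Function.uncurry G) (T0 ×ˢ Set.univ))
    (hGZ : ∀ w ∈ T0, ∀ t, G w t ∈ Z) (hG0 : ∀ w ∈ T0, G w 0 ∈ Y) (hG1 : ∀ w ∈ T0, G w 1 = r w)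
    (ext : ∀ F : T → E, Continuous F → (∀ w, F w ∈ Z) → (∀ w ∈ T0, F w ∈ Y) →
      ∃ Γ : I → T → E, Continuous (Function.uncurry Γ) ∧ Γ 0 = F ∧ (∀ τ w, Γ τ w ∈ Z) ∧
        (∀ w, Γ 1 w ∈ Y) ∧ ∀ τ, ∀ w ∈ T0, Γ τ w ∈ Y) :
    ∃ G' : T → I → E, Continuous (Function.uncurry G') ∧ (∀ w t, G' w t ∈ Z) ∧
      (∀ w, G' w 0 ∈ Y) ∧ (∀ w, G' w 1 = r w) ∧ ∀ w ∈ T0, ∀ t, G' w t = G w t := by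
  have hP : ∃ P : T → I → E, Continuous (Function.uncurry P) ∧ (∀ w t, P w t ∈ Z) ∧
      (∀ w ∈ T0, ∀ t, P w t = G w t) ∧ ∀ w, P w 1 = r w := by
    refine ⟨fun w t => if (t : ℝ) + 2 * u w ≤ 1 then G (D w (u w)) (prI (t + 2 * u w)) else
      r (D w (min (u w) ((1 - t) / 2))), ?_, ?_, ?_, ?_⟩
    · refine continuous_if_le (f := fun p : T × I => ((p.2 : ℝ) + 2 * u p.1)) (by fun_prop)
        continuous_const ?_ ?_ ?_
      · refine hG.comp (f := fun p : T × I => (D p.1 (u p.1), prI ((p.2 : ℝ) + 2 * u p.1))) ?_ ?_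
        · refine Continuous.continuousOn ?_
          have h1 : Continuous fun p : T × I => D p.1 (u p.1) :=
            hD.comp (by fun_prop : Continuous fun p : T × I => (p.1, u p.1))
          exact h1.prodMk (prI_continuous.comp (by fun_prop))
        · rintro ⟨w, t⟩ (h : (t : ℝ) + 2 * u w ≤ 1)
          exact ⟨hDu w (by have := t.2.1; linarith), trivial⟩
      · refine Continuous.continuousOn (hr.comp ?_)
        exact hD.comp (by fun_prop : Continuous fun p : T × I => (p.1, min (u p.1) ((1 - (p.2 : ℝ)) / 2)))
      · rintro ⟨w, t⟩ h
        change (t : ℝ) + 2 * u w = 1 at h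
        have e : (1 - (t : ℝ)) / 2 = u w := by linarith
        change G (D w (u w)) (prI (t + 2 * u w)) = r (D w (min (u w) ((1 - t) / 2)))
        rw [h, e, min_self, prI_of_ge le_rfl, hG1 _ (hDu w (by have := t.2.1; linarith))]
    · intro w t
      dsimp only
      split_ifs with h
      · exact hGZ _ (hDu w (by have := t.2.1; linarith)) _
      · exact hrZ _
    · intro w hw t
      dsimp only
      rw [hu0 w hw, mul_zero, add_zero, if_pos t.2.2, hDT w hw, prI_coe]
    · intro w
      dsimp only
      have h1 := hunn w
      split_ifs with h
      · have h2 : ((1 : I) : ℝ) = 1 := rfl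
        rw [h2] at h
        have h3 : u w = 0 := by linarith
        have h4 : w ∈ T0 := by
          have := hDu w (by linarith)
          rwa [h3, hD0] at this
        rw [h3, hD0, mul_zero, add_zero, prI_coe, hG1 w h4]
      · have : (1 - ((1 : I) : ℝ)) / 2 = 0 := by simp
        rw [this, min_eq_right h1, hD0]
  obtain ⟨P, hPc, hPZ, hPG, hP1⟩ := hP
  obtain ⟨Γ, hΓ, hΓ0, hΓZ, hΓ1, hΓY⟩ := ext (fun w => P w 0)
    (hPc.comp (by fun_prop : Continuous fun w : T => (w, (0 : I)))) (fun w => hPZ w 0)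
    (fun w hw => by rw [hPG w hw]; exact hG0 w hw)
  let Ξ : T × ℝ → E := fun p => if 0 ≤ p.2 then P p.1 (prI p.2) else Γ (prI (-p.2)) p.1
  have hΞ : Continuous Ξ := by
    refine Continuous.if_le ?_ ?_ continuous_const continuous_snd ?_
    · exact hPc.comp (continuous_fst.prodMk (prI_continuous.comp continuous_snd))
    · exact hΓ.comp ((prI_continuous.comp continuous_snd.neg).prodMk continuous_fst)
    · rintro ⟨w, q⟩ (h : 0 = q)
      subst h
      dsimp only
      rw [neg_zero, prI_of_le le_rfl, hΓ0]
  have hΞZ : ∀ p, Ξ p ∈ Z := by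
    intro p
    simp only [Ξ]
    split_ifs
    · exact hPZ _ _
    · exact hΓZ _ _
  have hΞpos : ∀ w (t : I), Ξ (w, (t : ℝ)) = P w t := by
    intro w t
    simp only [Ξ]
    rw [if_pos t.2.1, prI_coe]
  have hΞneg : ∀ w (q : ℝ), q ≤ 0 → Ξ (w, q) = Γ (prI (-q)) w := by
    intro w q hq
    simp only [Ξ]
    split_ifs with h
    · have : q = 0 := le_antisymm hq h
      rw [this, neg_zero, prI_of_le le_rfl, hΓ0]
    · rfl
  refine ⟨fun w t => Ξ (D w ((1 - t) * u w), -(min 1 (2 * u w)) * (1 - t) + t), ?_, fun w t => hΞZ _,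
    ?_, ?_, ?_⟩
  · refine hΞ.comp ?_
    have h1 : Continuous fun p : T × I => D p.1 ((1 - p.2) * u p.1) :=
      hD.comp (by fun_prop : Continuous fun p : T × I => (p.1, (1 - (p.2 : ℝ)) * u p.1))
    exact h1.prodMk (by fun_prop)
  · intro w
    have h1 := hunn w
    have e : -(min 1 (2 * u w)) * (1 - ((0 : I) : ℝ)) + ((0 : I) : ℝ) = -(min 1 (2 * u w)) := by simp
    have e' : (1 - ((0 : I) : ℝ)) * u w = u w := by simp
    dsimp only
    rw [e, e', hΞneg _ _ (by simp [h1]), neg_neg]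
    rcases le_total (2 * u w) 1 with h | h
    · exact hΓY _ _ (hDu w (by linarith))
    · rw [min_eq_left h, prI_of_ge le_rfl]
      exact hΓ1 _
  · intro w
    have e : -(min 1 (2 * u w)) * (1 - ((1 : I) : ℝ)) + ((1 : I) : ℝ) = ((1 : I) : ℝ) := by simp
    have e' : (1 - ((1 : I) : ℝ)) * u w = 0 := by simp
    dsimp only
    rw [e, e', hΞpos, hD0, hP1]
  · intro w hw t
    have e : -(min 1 (2 * u w)) * (1 - (t : ℝ)) + (t : ℝ) = t := by rw [hu0 w hw]; simp
    dsimp only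
    rw [e, hDT w hw, hΞpos, hPG w hw]

end ndr

end

section
open Topology
set_option linter.unusedSectionVars false
open scoped unitInterval

section simplex

variable {J : Type*}

/-- the simplex spanned by a finite set -/
def Dl (κ : Finset J) : Set (J → ℝ) :=
  {w | (∀ j, 0 ≤ w j) ∧ (∀ j, j ∉ κ → w j = 0) ∧ ∑ j ∈ κ, w j = 1}

theorem Dl_closed (κ : Finset J) : IsClosed (Dl κ) := by
  have : Dl κ = (⋂ j, {w | 0 ≤ w j}) ∩ ((⋂ j, ⋂ (_ : j ∉ κ), {w | w j = 0}) ∩ {w | ∑ j ∈ κ, w j = 1}) := by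
    ext w; simp [Dl]
  rw [this]
  refine IsClosed.inter (isClosed_iInter fun j => isClosed_le continuous_const (continuous_apply j))
    (IsClosed.inter (isClosed_iInter fun j => isClosed_iInter fun _ =>
      isClosed_eq (continuous_apply j) continuous_const) (isClosed_eq (by fun_prop) continuous_const))

theorem Dl_le_one {κ : Finset J} {w : J → ℝ} (hw : w ∈ Dl κ) (j : J) : w j ≤ 1 := by
  by_cases h : j ∈ κ
  · rw [← hw.2.2]
    exact Finset.single_le_sum (f := w) (fun i _ => hw.1 i) h
  · rw [hw.2.1 j h]; exact zero_le_one

theorem Dl_compact (κ : Finset J) : IsCompact (Dl κ) := by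
  refine IsCompact.of_isClosed_subset (isCompact_univ_pi (s := fun _ : J => Set.Icc (0 : ℝ) 1)
    fun _ => isCompact_Icc) (Dl_closed κ) ?_
  intro w hw j _
  exact ⟨hw.1 j, Dl_le_one hw j⟩

theorem Dl_mono {κ τ : Finset J} (h : κ ⊆ τ) : Dl κ ⊆ Dl τ := by
  intro w hw
  refine ⟨hw.1, fun j hj => hw.2.1 j fun hj' => hj (h hj'), ?_⟩
  rw [← hw.2.2]
  exact (Finset.sum_subset h fun j _ hj => hw.2.1 j hj).symm

theorem Dl_of_supp {κ τ : Finset J} {w : J → ℝ} (hw : w ∈ Dl κ) (h : ∀ j ∈ κ, w j ≠ 0 → j ∈ τ) :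
    w ∈ Dl τ := by
  have hz : ∀ j, j ∉ τ → w j = 0 := by
    intro j hj
    by_contra h0
    by_cases hs : j ∈ κ
    · exact hj (h j hs h0)
    · exact h0 (hw.2.1 j hs)
  refine ⟨hw.1, hz, ?_⟩
  classical
  have h1 : ∑ j ∈ κ, w j = ∑ j ∈ κ ∪ τ, w j :=
    Finset.sum_subset Finset.subset_union_left fun j _ hj => hw.2.1 j hj
  have h2 : ∑ j ∈ τ, w j = ∑ j ∈ κ ∪ τ, w j :=
    Finset.sum_subset Finset.subset_union_right fun j _ hj => hz j hj
  rw [h2, ← h1, hw.2.2]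

theorem Dl_apply {κ : Finset J} (j : J) : Continuous fun w : Dl κ => w.1 j :=
  (continuous_apply j).comp continuous_subtype_val

/-- boundary -/
def bd (κ : Finset J) : Set (Dl κ) := {w | ∃ j ∈ κ, w.1 j = 0}

theorem bd_closed (κ : Finset J) : IsClosed (bd κ) := by
  have : bd κ = ⋃ j ∈ κ, {w : Dl κ | w.1 j = 0} := by ext; simp [bd]
  rw [this]
  exact Set.Finite.isClosed_biUnion κ.finite_toSet fun j _ =>
    isClosed_eq (Dl_apply j) continuous_const

theorem ndr_simplex (κ : Finset J) (hκ : κ.Nonempty) :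
    ∃ (D : Dl κ → ℝ → Dl κ) (u : Dl κ → ℝ), Continuous (Function.uncurry D) ∧ Continuous u ∧
      (∀ w, 0 ≤ u w) ∧ (∀ w ∈ bd κ, u w = 0) ∧ (∀ w, D w 0 = w) ∧
      (∀ w ∈ bd κ, ∀ s, D w s = w) ∧ (∀ w, u w ≤ 1 / 2 → D w (u w) ∈ bd κ) := by
  classical
  let k : ℝ := κ.card
  have hk : 0 < k := by simpa [k] using hκ.card_pos
  let m : Dl κ → ℝ := fun w => κ.inf' hκ fun j => w.1 j
  have hm : Continuous m := by
    simp only [m]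
    exact Continuous.finset_inf'_apply hκ fun j _ => Dl_apply j
  have hm0 : ∀ w, 0 ≤ m w := fun w => (Finset.le_inf'_iff hκ _).2 fun j _ => w.2.1 j
  have hmle : ∀ w, ∀ j ∈ κ, m w ≤ w.1 j := fun w j hj => Finset.inf'_le _ hj
  have hmbd : ∀ w ∈ bd κ, m w = 0 := by
    rintro w ⟨j, hj, h⟩
    exact le_antisymm (h ▸ hmle w j hj) (hm0 w)
  let s' : Dl κ → ℝ → ℝ := fun w s => max 0 (min s (min (k * m w) (1 / 2)))
  have hs' : Continuous (Function.uncurry s') := by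
    simp only [s']
    change Continuous fun p : Dl κ × ℝ => max 0 (min p.2 (min (k * m p.1) (1 / 2)))
    fun_prop
  have hs0 : ∀ w s, 0 ≤ s' w s := fun w s => le_max_left _ _
  have hs2 : ∀ w s, s' w s ≤ 1 / 2 := fun w s =>
    max_le (by norm_num) ((min_le_right _ _).trans (min_le_right _ _))
  have hsm : ∀ w s, s' w s ≤ k * m w := fun w s =>
    max_le (mul_nonneg hk.le (hm0 w)) ((min_le_right _ _).trans (min_le_left _ _))
  let D0 : Dl κ → ℝ → J → ℝ := fun w s j =>
    if j ∈ κ then (w.1 j - s' w s / k) / (1 - s' w s) else 0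
  have hD0 : ∀ w s, D0 w s ∈ Dl κ := by
    intro w s
    have h1 : 0 < 1 - s' w s := by have := hs2 w s; linarith
    refine ⟨fun j => ?_, fun j hj => by simp [D0, hj], ?_⟩
    · simp only [D0]
      split_ifs with hj
      · refine div_nonneg ?_ h1.le
        have h2 : s' w s / k ≤ m w := by rw [div_le_iff₀ hk, mul_comm]; exact hsm w s
        linarith [hmle w j hj]
      · exact le_rfl
    · have : ∀ j ∈ κ, D0 w s j = (w.1 j - s' w s / k) / (1 - s' w s) := fun j hj => by simp [D0, hj]
      rw [Finset.sum_congr rfl this, ← Finset.sum_div, Finset.sum_sub_distrib, w.2.2.2,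
        Finset.sum_const, nsmul_eq_mul]
      change (1 - k * (s' w s / k)) / _ = 1
      rw [mul_div_cancel₀ _ hk.ne', div_self h1.ne']
  have hDid : ∀ w s, s' w s = 0 → (⟨D0 w s, hD0 w s⟩ : Dl κ) = w := by
    intro w s h
    refine Subtype.ext (funext fun j => ?_)
    simp only [D0, h]
    split_ifs with hj
    · simp
    · exact (w.2.2.1 j hj).symm
  refine ⟨fun w s => ⟨D0 w s, hD0 w s⟩, fun w => k * m w, ?_, by fun_prop,
    fun w => mul_nonneg hk.le (hm0 w), fun w hw => by dsimp only; rw [hmbd w hw, mul_zero], ?_, ?_, ?_⟩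
  · refine Continuous.subtype_mk (continuous_pi fun j => ?_) _
    simp only [D0]
    by_cases hj : j ∈ κ
    · simp only [hj, if_true]
      change Continuous fun p : Dl κ × ℝ => (p.1.1 j - s' p.1 p.2 / k) / (1 - s' p.1 p.2)
      have hs'' : Continuous fun p : Dl κ × ℝ => s' p.1 p.2 := hs'
      have hj' : Continuous fun p : Dl κ × ℝ => p.1.1 j := (Dl_apply j).comp continuous_fst
      refine Continuous.div (by fun_prop) (by fun_prop) fun p => ?_
      have := hs2 p.1 p.2
      intro h; linarith
    · simp only [hj, if_false]
      exact continuous_const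
  · intro w
    refine hDid w 0 ?_
    simp only [s']
    exact max_eq_left (min_le_left _ _)
  · intro w hw s
    refine hDid w s ?_
    exact le_antisymm (by have := hsm w s; rwa [hmbd w hw, mul_zero] at this) (hs0 w s)
  · intro w hw
    dsimp only at hw
    obtain ⟨j, hj, h⟩ := Finset.exists_mem_eq_inf' hκ (fun j => w.1 j)
    have h' : w.1 j = m w := h.symm
    refine ⟨j, hj, ?_⟩
    have hs : s' w (k * m w) = k * m w := by
      simp only [s']
      rw [min_eq_left hw, min_self, max_eq_right (mul_nonneg hk.le (hm0 w))]
    simp only [D0, hj, if_true, hs, h']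
    rw [mul_div_cancel_left₀ _ hk.ne', sub_self, zero_div]

end simplex

end

section
open Topology
set_option linter.unusedSectionVars false
open scoped unitInterval

section nerve

universe u
variable {J : Type u} {E : Type u} [NormedAddCommGroup E] [NormedSpace ℝ E]

/-- the extension property -/
def EXT (Z Y : Set E) : Prop := ∀ (T : Type u) [TopologicalSpace T] [CompactSpace T] [T2Space T]
  (T0 : Set T), IsClosed T0 → ∀ F : T → E, Continuous F → (∀ w, F w ∈ Z) → (∀ w ∈ T0, F w ∈ Y) →
      ∃ Γ : I → T → E, Continuous (Function.uncurry Γ) ∧ Γ 0 = F ∧ (∀ τ w, Γ τ w ∈ Z) ∧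
        (∀ w, Γ 1 w ∈ Y) ∧ ∀ τ, ∀ w ∈ T0, Γ τ w ∈ Y

/-- realisation -/
noncomputable def rz (c : J → E) (w : J → ℝ) : E := ∑ᶠ j, w j • c j

theorem rz_eq (c : J → E) {κ : Finset J} {w : J → ℝ} (hw : w ∈ Dl κ) :
    rz c w = ∑ j ∈ κ, w j • c j := by
  refine finsum_eq_sum_of_support_subset _ ?_
  intro j hj
  by_contra h
  exact hj (by simp [hw.2.1 j h])

theorem rz_cont (c : J → E) (κ : Finset J) : Continuous fun w : Dl κ => rz c w.1 := by
  have : (fun w : Dl κ => rz c w.1) = fun w => ∑ j ∈ κ, w.1 j • c j := funext fun w => rz_eq c w.2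
  rw [this]
  exact continuous_finsetSum _ fun j _ => (Dl_apply j).smul continuous_const

/-- partial solution on a simplex -/
def GoodOn (Z Y : Set E) (c : J → E) (κ : Finset J) (G : (J → ℝ) → I → E) : Prop :=
  ContinuousOn (Function.uncurry G) (Dl κ ×ˢ Set.univ) ∧
    ∀ w ∈ Dl κ, (∀ t, G w t ∈ Z) ∧ G w 0 ∈ Y ∧ G w 1 = rz c w

theorem GoodOn.congr {Z Y : Set E} {c : J → E} {κ : Finset J} {G G' : (J → ℝ) → I → E}
    (h : GoodOn Z Y c κ G) (hG : ∀ w ∈ Dl κ, G' w = G w) : GoodOn Z Y c κ G' := by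
  refine ⟨h.1.congr ?_, fun w hw => by rw [hG w hw]; exact h.2 w hw⟩
  rintro ⟨w, t⟩ ⟨hw, -⟩
  exact congrFun (hG w hw) t

theorem simplex_step {Z Y : Set E} (hE : EXT Z Y) (c : J → E) (κ : Finset J) (hκ : κ.Nonempty)
    (hK : ∀ w ∈ Dl κ, rz c w ∈ Z) (G : (J → ℝ) → I → E)
    (hG : ∀ κ', κ' ⊂ κ → GoodOn Z Y c κ' G) :
    ∃ G' : (J → ℝ) → I → E, GoodOn Z Y c κ G' ∧ ∀ κ', κ' ⊂ κ → ∀ w ∈ Dl κ', G' w = G w := by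
  classical
  obtain ⟨D, u, hD, hu, hunn, hu0, hD0, hDT, hDu⟩ := ndr_simplex κ hκ
  have hface : ∀ j ∈ κ, ∀ w : Dl κ, w.1 j = 0 → w.1 ∈ Dl (κ.erase j) := by
    intro j hj w h
    refine Dl_of_supp w.2 fun i hi hi0 => Finset.mem_erase.2 ⟨fun e => hi0 (e ▸ h), hi⟩
  have hb : ∀ w ∈ bd κ, ∃ κ', κ' ⊂ κ ∧ w.1 ∈ Dl κ' := by
    rintro w ⟨j, hj, h⟩
    exact ⟨κ.erase j, Finset.erase_ssubset hj, hface j hj w h⟩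
  haveI : CompactSpace (Dl κ) := isCompact_iff_compactSpace.1 (Dl_compact κ)
  obtain ⟨G', h1, h2, h3, h4, h5⟩ := ndr_ext (T0 := bd κ) (Z := Z) (Y := Y) D hD u hu hunn hu0 hD0 hDT hDu
    (fun w => rz c w.1) (rz_cont c κ) (fun w => hK _ w.2) (fun w t => G w.1 t) (by
      have e : bd κ ×ˢ (Set.univ : Set I) = ⋃ j : κ, {p : Dl κ × I | p.1.1 j.1 = 0} := by
        ext ⟨w, t⟩; simp [bd]
      rw [e]
      refine LocallyFinite.continuousOn_iUnion (locallyFinite_of_finite _) (fun j =>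
        isClosed_eq ((Dl_apply j.1).comp continuous_fst) continuous_const) fun j => ?_
      refine (hG _ (Finset.erase_ssubset j.2)).1.comp
        (f := fun p : Dl κ × I => (p.1.1, p.2)) (by fun_prop) ?_
      intro p hp
      exact ⟨hface j.1 j.2 p.1 hp, trivial⟩)
    (fun w hw t => by obtain ⟨κ', a, b⟩ := hb w hw; exact ((hG κ' a).2 _ b).1 t)
    (fun w hw => by obtain ⟨κ', a, b⟩ := hb w hw; exact ((hG κ' a).2 _ b).2.1)
    (fun w hw => by obtain ⟨κ', a, b⟩ := hb w hw; exact ((hG κ' a).2 _ b).2.2)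
    (hE (Dl κ) (bd κ) (bd_closed κ))
  let G1 : (J → ℝ) → I → E := fun w t => if h : w ∈ Dl κ then G' ⟨w, h⟩ t else 0
  have hG1 : ∀ w (h : w ∈ Dl κ) , G1 w = G' ⟨w, h⟩ := fun w h => by
    funext t; simp [G1, h]
  refine ⟨G1, ⟨?_, ?_⟩, ?_⟩
  · rw [continuousOn_iff_continuous_domRestrict]
    have e : (Dl κ ×ˢ (Set.univ : Set I)).domRestrict (Function.uncurry G1) =
      fun p => Function.uncurry G' (⟨p.1.1, p.2.1⟩, p.1.2) := by
      funext p
      exact congrFun (hG1 p.1.1 p.2.1) p.1.2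
    rw [e]
    exact h1.comp (by fun_prop)
  · intro w hw
    rw [hG1 w hw]
    exact ⟨h2 _, h3 _, h4 _⟩
  · intro κ' hκ' w hw
    have hw' := Dl_mono hκ'.1 hw
    rw [hG1 w hw']
    obtain ⟨j, hj, hj'⟩ := Finset.exists_of_ssubset hκ'
    exact funext fun t => h5 ⟨w, hw'⟩ ⟨j, hj, hw.2.1 j hj'⟩ t

theorem skel_step {Z Y : Set E} (hE : EXT Z Y) (c : J → E) (k : ℕ) (G : (J → ℝ) → I → E)
    (hG : ∀ κ : Finset J, κ.card ≤ k → (∀ w ∈ Dl κ, rz c w ∈ Z) → GoodOn Z Y c κ G) :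
    ∃ G' : (J → ℝ) → I → E, (∀ κ : Finset J, κ.card ≤ k + 1 → (∀ w ∈ Dl κ, rz c w ∈ Z) → GoodOn Z Y c κ G')
      ∧ ∀ κ : Finset J, κ.card ≤ k → ∀ w ∈ Dl κ, G' w = G w := by
  classical
  have hex : ∀ κ : Finset J, ∃ G' : (J → ℝ) → I → E, κ.card = k + 1 → (∀ w ∈ Dl κ, rz c w ∈ Z) →
      GoodOn Z Y c κ G' ∧ ∀ κ', κ' ⊂ κ → ∀ w ∈ Dl κ', G' w = G w := by
    intro κ
    by_cases h : κ.card = k + 1 ∧ (∀ w ∈ Dl κ, rz c w ∈ Z)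
    · obtain ⟨G', hG'⟩ := simplex_step hE c κ (Finset.card_pos.1 (by omega)) h.2 G fun κ' hκ' =>
        hG κ' (by have := Finset.card_lt_card hκ'; omega) fun w hw => h.2 w (Dl_mono hκ'.1 hw)
      exact ⟨G', fun _ _ => hG'⟩
    · exact ⟨G, fun h1 h2 => (h ⟨h1, h2⟩).elim⟩
  choose Gs hGs using hex
  let Q : (J → ℝ) → Finset J → Prop := fun w κ => κ.card = k + 1 ∧ (∀ w ∈ Dl κ, rz c w ∈ Z) ∧ w ∈ Dl κ ∧
    ∀ j ∈ κ, w j ≠ 0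
  let G1 : (J → ℝ) → I → E := fun w => if h : ∃ κ, Q w κ then Gs h.choose w else G w
  have hlow : ∀ κ : Finset J, κ.card ≤ k → ∀ w ∈ Dl κ, ¬ ∃ κ, Q w κ := by
    rintro κ hκ w hw ⟨κ', h1, h2, h3, h4⟩
    have : κ' ⊆ κ := fun j hj => by
      by_contra h
      exact h4 j hj (hw.2.1 j h)
    have := Finset.card_le_card this
    omega
  have hlow' : ∀ κ : Finset J, κ.card ≤ k → ∀ w ∈ Dl κ, G1 w = G w := by
    intro κ hκ w hw
    simp only [G1, dif_neg (hlow κ hκ w hw)]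
  refine ⟨G1, ?_, hlow'⟩
  intro κ hκ hK
  rcases Nat.lt_or_ge κ.card (k + 1) with h | h
  · exact (hG κ (by omega) hK).congr (hlow' κ (by omega))
  · have hc : κ.card = k + 1 := le_antisymm hκ h
    refine (hGs κ hc hK).1.congr fun w hw => ?_
    by_cases hint : ∀ j ∈ κ, w j ≠ 0
    · have hq : ∃ κ, Q w κ := ⟨κ, hc, hK, hw, hint⟩
      have e : hq.choose = κ := by
        obtain ⟨-, -, h3, h4⟩ := hq.choose_spec
        ext j
        constructor
        · intro hj; by_contra h'; exact h4 j hj (hw.2.1 j h')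
        · intro hj; by_contra h'; exact hint j hj (h3.2.1 j h')
      simp only [G1, dif_pos hq]
      rw [e]
    · push Not at hint
      obtain ⟨j, hj, hj0⟩ := hint
      have hw' : w ∈ Dl (κ.erase j) :=
        Dl_of_supp hw fun i hi hi0 => Finset.mem_erase.2 ⟨fun e => hi0 (e ▸ hj0), hi⟩
      rw [hlow' _ (by rw [Finset.card_erase_of_mem hj]; omega) w hw',
        (hGs κ hc hK).2 _ (Finset.erase_ssubset hj) w hw']

theorem nerve_sol {Z Y : Set E} (hE : EXT Z Y) (c : J → E) :
    ∃ G : (J → ℝ) → I → E, ∀ κ : Finset J, (∀ w ∈ Dl κ, rz c w ∈ Z) → GoodOn Z Y c κ G := by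
  classical
  let P : ℕ → ((J → ℝ) → I → E) → Prop := fun k G =>
    ∀ κ : Finset J, κ.card ≤ k → (∀ w ∈ Dl κ, rz c w ∈ Z) → GoodOn Z Y c κ G
  have h0 : P 0 (fun _ _ => 0) := by
    intro κ hκ _
    have : κ = ∅ := Finset.card_eq_zero.1 (by omega)
    subst this
    have e : ∀ w : J → ℝ, w ∉ Dl (∅ : Finset J) := fun w hw => by
      have := hw.2.2
      simp at this
    refine ⟨?_, fun w hw => (e w hw).elim⟩
    rintro ⟨w, t⟩ ⟨hw, -⟩
    exact (e w hw).elim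
  let S : (k : ℕ) → {G // P k G} := fun k => Nat.rec ⟨_, h0⟩
    (fun k g => ⟨(skel_step hE c k g.1 g.2).choose, (skel_step hE c k g.1 g.2).choose_spec.1⟩) k
  have hS : ∀ k, ∀ κ : Finset J, κ.card ≤ k → ∀ w ∈ Dl κ, (S (k + 1)).1 w = (S k).1 w := fun k =>
    (skel_step hE c k (S k).1 (S k).2).choose_spec.2
  have hS' : ∀ κ : Finset J, ∀ m, κ.card ≤ m → ∀ w ∈ Dl κ, (S m).1 w = (S κ.card).1 w := by
    intro κ m hm w hw
    induction m, hm using Nat.le_induction with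
    | base => rfl
    | succ m hm ih => rw [hS m κ hm w hw, ih]
  let G : (J → ℝ) → I → E := fun w => if h : ∃ κ, w ∈ Dl κ then (S h.choose.card).1 w else 0
  refine ⟨G, fun κ hK => ((S κ.card).2 κ le_rfl hK).congr fun w hw => ?_⟩
  have h : ∃ κ, w ∈ Dl κ := ⟨κ, hw⟩
  simp only [G, dif_pos h]
  rw [← hS' _ (max h.choose.card κ.card) (le_max_left _ _) w h.choose_spec,
    ← hS' κ (max h.choose.card κ.card) (le_max_right _ _) w hw]

end nerve

end

section
open Topology
set_option linter.unusedSectionVars false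
open scoped unitInterval

section thmS

universe u
variable {E : Type u} [NormedAddCommGroup E] [NormedSpace ℝ E]

theorem thmS {Z Y V : Set E} (hV : Convex ℝ V) (hZV : Z ⊆ V)
    (hZ : ∀ z ∈ Z, ∃ r > 0, Metric.ball z r ∩ V ⊆ Z) (hE : EXT Z Y) :
    ∃ G : Z → I → E, Continuous (Function.uncurry G) ∧ (∀ z t, G z t ∈ Z) ∧ (∀ z, G z 0 ∈ Y) ∧
      ∀ z, G z 1 = z := by
  classical
  have hr : ∀ z : Z, ∃ r > 0, Metric.ball (z : E) (2 * r) ∩ V ⊆ Z := by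
    intro z
    obtain ⟨r, h0, h⟩ := hZ z.1 z.2
    exact ⟨r / 2, by positivity, by rwa [mul_div_cancel₀ _ two_ne_zero]⟩
  choose r hr0 hr using hr
  obtain ⟨ρ, hρ⟩ := PartitionOfUnity.exists_isSubordinate (X := Z) (ι := Z) isClosed_univ
    (fun j => Metric.ball j (r j)) (fun j => Metric.isOpen_ball)
    (fun z _ => Set.mem_iUnion.2 ⟨z, Metric.mem_ball_self (hr0 z)⟩)
  let wt : Z → Z → ℝ := fun z j => ρ j z
  let c : Z → E := fun j => j.1
  have hwt : Continuous wt := continuous_pi fun j => (ρ j).continuous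
  have hsum : ∀ z κ, ρ.fintsupport z ⊆ κ → wt z ∈ Dl κ := by
    intro z κ hκ
    have hz : ∀ j, j ∉ κ → ρ j z = 0 := by
      intro j hj
      by_contra h
      exact hj (hκ ((ρ.mem_fintsupport_iff z j).2 (subset_tsupport _ h)))
    refine ⟨fun j => ρ.nonneg j z, hz, ?_⟩
    rw [← ρ.sum_eq_one (Set.mem_univ z)]
    refine (finsum_eq_sum_of_support_subset _ ?_).symm
    intro j hj
    by_contra h
    exact hj (hz j h)
  have hC : ∀ z, ∃ C : Set E, Convex ℝ C ∧ C ⊆ Z ∧ z.1 ∈ C ∧ ∀ w ∈ Dl (ρ.fintsupport z), rz c w ∈ C := by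
    intro z
    have hne : (ρ.fintsupport z).Nonempty := by
      rw [Finset.nonempty_iff_ne_empty]
      intro h
      have := (hsum z _ subset_rfl).2.2
      rw [h] at this
      simp at this
    obtain ⟨j, hj, hmax⟩ := Finset.exists_max_image _ r hne
    have hd : ∀ i ∈ ρ.fintsupport z, dist z.1 i.1 < r j := fun i hi =>
      lt_of_lt_of_le (hρ i ((ρ.mem_fintsupport_iff z i).1 hi)) (hmax i hi)
    have hcv : Convex ℝ (Metric.ball j.1 (2 * r j) ∩ V) := (convex_ball _ _).inter hV
    refine ⟨_, hcv, hr j, ⟨?_, hZV z.2⟩, ?_⟩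
    · have := hd j hj
      have := hr0 j
      rw [Metric.mem_ball]; linarith
    · intro w hw
      rw [rz_eq c hw]
      refine hcv.sum_mem (fun i _ => hw.1 i) hw.2.2 fun i hi => ⟨?_, hZV i.2⟩
      have h1 := hd j hj
      have h2 := hd i hi
      have h3 := dist_triangle i.1 z.1 j.1
      rw [dist_comm i.1 z.1] at h3
      rw [Metric.mem_ball]; linarith
  choose C hCc hCZ hzC hCw using hC
  obtain ⟨G0, hG0⟩ := nerve_sol hE c
  have hgood : ∀ z, GoodOn Z Y c (ρ.fintsupport z) G0 := fun z => hG0 _ fun w hw => hCZ z (hCw z w hw)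
  have hG0c : Continuous fun p : Z × I => G0 (wt p.1) p.2 := by
    rw [continuous_iff_continuousAt]
    rintro ⟨z, t⟩
    have h1 := (hgood z).1 (wt z, t) ⟨hsum z _ subset_rfl, trivial⟩
    refine Filter.Tendsto.comp (g := Function.uncurry G0) (f := fun p : Z × I => (wt p.1, p.2)) h1 ?_
    refine tendsto_nhdsWithin_iff.2 ⟨?_, ?_⟩
    · exact ((hwt.comp continuous_fst).prodMk continuous_snd).continuousAt
    · have h2 := ρ.eventually_fintsupport_subset z
      filter_upwards [((continuous_fst : Continuous (Prod.fst : Z × I → Z)).tendsto (z, t)).eventually h2] with p hp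
      exact ⟨hsum p.1 _ hp, trivial⟩
  have h1 : ∀ z, G0 (wt z) 1 = rz c (wt z) := fun z => ((hgood z).2 _ (hsum z _ subset_rfl)).2.2
  have hrzc : Continuous fun z => rz c (wt z) := by
    have : (fun z => rz c (wt z)) = fun z => G0 (wt z) 1 := funext fun z => (h1 z).symm
    rw [this]
    exact hG0c.comp (by fun_prop : Continuous fun z : Z => (z, (1 : I)))
  refine ⟨fun z t => if (t : ℝ) ≤ 1 / 2 then G0 (wt z) (prI (2 * t)) else
    (2 - 2 * (t : ℝ)) • rz c (wt z) + (2 * (t : ℝ) - 1) • z.1, ?_, ?_, ?_, ?_⟩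
  · change Continuous fun p : Z × I => if (p.2 : ℝ) ≤ 1 / 2 then G0 (wt p.1) (prI (2 * p.2)) else
      (2 - 2 * (p.2 : ℝ)) • rz c (wt p.1) + (2 * (p.2 : ℝ) - 1) • p.1.1
    refine Continuous.if_le ?_ ?_ (by fun_prop) continuous_const ?_
    · exact hG0c.comp (continuous_fst.prodMk (prI_continuous.comp (by fun_prop)))
    · have := hrzc.comp (continuous_fst : Continuous fun p : Z × I => p.1)
      exact ((by fun_prop : Continuous fun p : Z × I => 2 - 2 * (p.2 : ℝ)).smul this).add
        ((by fun_prop : Continuous fun p : Z × I => 2 * (p.2 : ℝ) - 1).smul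
          (continuous_subtype_val.comp continuous_fst))
    · intro p hp
      rw [hp]
      norm_num
      rw [prI_of_ge le_rfl, h1]
  · intro z t
    dsimp only
    split_ifs with h
    · exact ((hgood z).2 _ (hsum z _ subset_rfl)).1 _
    · refine hCZ z (hCc z (hCw z _ (hsum z _ subset_rfl)) (hzC z) ?_ ?_ (by ring))
      · have := t.2.2; linarith
      · linarith
  · intro z
    dsimp only
    rw [if_pos (by simp)]
    have : prI (2 * ((0 : I) : ℝ)) = 0 := by rw [prI_of_le]; simp
    rw [this]
    exact ((hgood z).2 _ (hsum z _ subset_rfl)).2.1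
  · intro z
    dsimp only
    rw [if_neg (by norm_num)]
    norm_num

end thmS

end

section
open Topology
set_option linter.unusedSectionVars false
open scoped unitInterval

section admS

universe u
variable {ι : Type} [Fintype ι] [DecidableEq ι]
variable {X : Type u} [TopologicalSpace X] [CompactSpace X] [T2Space X]
variable {T : Type u} [TopologicalSpace T] [CompactSpace T] [T2Space T]

/-- slice of a vector -/
noncomputable def slv {T : Type*} [TopologicalSpace T] [CompactSpace T] [T2Space T]
    (t : T) (G : ι → C(T × X, ℂ)) : ι → C(X, ℂ) := fun i => sliceH t (G i)

theorem slv_cont {T : Type*} [TopologicalSpace T] [CompactSpace T] [T2Space T] :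
    Continuous fun p : T × (ι → C(T × X, ℂ)) => slv p.1 p.2 := by
  refine continuous_pi fun i => ?_
  refine ContinuousMap.continuous_of_continuous_uncurry _ ?_
  change Continuous fun q : (T × (ι → C(T × X, ℂ))) × X => q.1.2 i (q.1.1, q.2)
  exact continuous_eval.comp (by fun_prop : Continuous fun q : (T × (ι → C(T × X, ℂ))) × X =>
    (q.1.2 i, (q.1.1, q.2)))

theorem unc_cont {T : Type*} [TopologicalSpace T] {F : T → ι → C(X, ℂ)} (hF : Continuous F)
    (i : ι) : Continuous fun p : T × X => F p.1 i p.2 :=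
  continuous_eval.comp (by fun_prop : Continuous fun p : T × X => (F p.1 i, p.2))

theorem slv_mem_B {T : Type*} [TopologicalSpace T] [CompactSpace T] [T2Space T]
    {A B : Subalgebra ℂ C(X, ℂ)} {T0 : Set T} {G : ι → C(T × X, ℂ)}
    (hG : G ∈ Uset ι (tB T0 A B) Set.univ) (t : T) : slv t G ∈ Uset ι B Set.univ :=
  ⟨fun i => (mem_tB.1 (hG.1 i)).1 t, fun x _ => hG.2 (t, x) trivial⟩

theorem slv_mem_A {T : Type*} [TopologicalSpace T] [CompactSpace T] [T2Space T]
    {A B : Subalgebra ℂ C(X, ℂ)} {T0 : Set T} {G : ι → C(T × X, ℂ)}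
    (hG : G ∈ Uset ι (tB T0 A B) Set.univ) {t : T} (ht : t ∈ T0) : slv t G ∈ Uset ι A Set.univ :=
  ⟨fun i => (mem_tB.1 (hG.1 i)).2 t ht, fun x _ => hG.2 (t, x) trivial⟩

theorem slv_mem_A' {T : Type*} [TopologicalSpace T] [CompactSpace T] [T2Space T]
    {A : Subalgebra ℂ C(X, ℂ)} {G : ι → C(T × X, ℂ)}
    (hG : G ∈ Uset ι (tA T A) Set.univ) (t : T) : slv t G ∈ Uset ι A Set.univ :=
  ⟨fun i => mem_tA.1 (hG.1 i) t, fun x _ => hG.2 (t, x) trivial⟩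

theorem adm_EXT {A B : Subalgebra ℂ C(X, ℂ)} (adm : Adm A B) :
    EXT (Uset ι B Set.univ) (Uset ι A Set.univ) := by
  intro T _ _ _ T0 hT0 F hF hFZ hFY
  let b : ι → C(T × X, ℂ) := fun i => ⟨fun p => F p.1 i p.2, unc_cont hF i⟩
  have hsb : ∀ t, slv t b = F t := fun t => rfl
  have hb : b ∈ Uset ι (tB T0 A B) Set.univ := by
    refine ⟨fun i => mem_tB.2 ⟨fun t => ?_, fun t ht => ?_⟩, ?_⟩
    · exact (hFZ t).1 i
    · exact (hFY t ht).1 i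
    · rintro ⟨t, x⟩ -
      exact (hFZ t).2 x trivial
  obtain ⟨g, hg, γ, hγ⟩ := pi0 (adm_T adm hT0) hb
  refine ⟨fun τ t => slv t (γ (unitInterval.symm τ)), ?_, ?_, ?_, ?_, ?_⟩
  · exact slv_cont.comp (by fun_prop : Continuous fun p : I × T => (p.2, γ (unitInterval.symm p.1)))
  · funext t
    dsimp only
    rw [unitInterval.symm_zero, γ.target, hsb]
  · exact fun τ w => slv_mem_B (hγ _) w
  · intro w
    dsimp only
    rw [unitInterval.symm_one, γ.source]
    exact slv_mem_A' hg w
  · exact fun τ w hw => slv_mem_A (hγ _) hw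

theorem adm_S {A B : Subalgebra ℂ C(X, ℂ)} (adm : Adm A B) :
    ∃ G : Uset ι B Set.univ → I → (ι → C(X, ℂ)), Continuous (Function.uncurry G) ∧
      (∀ z t, G z t ∈ Uset ι B Set.univ) ∧ (∀ z, G z 0 ∈ Uset ι A Set.univ) ∧ ∀ z, G z 1 = z := by
  refine thmS (V := {b | ∀ i, b i ∈ B}) ?_ (fun b hb => hb.1) ?_ (adm_EXT adm)
  · intro u hu v hv a b _ _ _ i
    have h1 : (a • u + b • v) i = (a : ℂ) • u i + (b : ℂ) • v i := by
      ext x; simp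
    rw [h1]
    exact B.add_mem (B.smul_mem (hu i) _) (B.smul_mem (hv i) _)
  · intro z hz
    obtain ⟨c, hc, hcz⟩ := exists_lower isClosed_univ (evv z) (evv_continuous z) hz.2
    refine ⟨c, hc, fun b hb => ⟨hb.2, fun x _ => ?_⟩⟩
    refine ne_zero_of_near (w := evv z x) (lt_of_lt_of_le ?_ (hcz x trivial))
    refine lt_of_le_of_lt ?_ (mem_ball_iff_norm.1 hb.1)
    refine (pi_norm_le_iff_of_nonneg (norm_nonneg _)).2 fun i => ?_
    exact ((b i - z i).norm_coe_le_norm x).trans (norm_le_pi_norm (b - z) i)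

theorem adm_equiv {A B : Subalgebra ℂ C(X, ℂ)} (adm : Adm A B) :
    ∃ H : Uset ι B Set.univ → I → (ι → C(X, ℂ)), (Continuous (Function.uncurry H) ∧
      (∀ z t, H z t ∈ Uset ι B Set.univ) ∧ (∀ z, H z 0 ∈ Uset ι A Set.univ) ∧ ∀ z, H z 1 = z) ∧
    ∃ K : Uset ι A Set.univ → I → (ι → C(X, ℂ)), Continuous (Function.uncurry K) ∧
      (∀ y t, K y t ∈ Uset ι A Set.univ) ∧ (∀ y, K y 0 = H ⟨y.1, Uset_mono_alg adm.le y.2⟩ 0) ∧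
      ∀ y, K y 1 = y := by
  obtain ⟨H, hH, hHB, hH0, hH1⟩ := adm_S (ι := ι) adm
  refine ⟨H, ⟨hH, hHB, hH0, hH1⟩, ?_⟩
  let T0 : Set I := {0, 1}
  have hT0 : IsClosed T0 := (Set.toFinite _).isClosed
  obtain ⟨H', hH', hHB', hH0', hH1'⟩ := adm_S (ι := ι) (adm_T (T := I) adm hT0)
  let j : Uset ι A Set.univ → Uset ι B Set.univ := fun y => ⟨y.1, Uset_mono_alg adm.le y.2⟩
  have hj : Continuous j := by fun_prop
  have hcc : ∀ i, Continuous fun q : Uset ι A Set.univ × (I × X) => H (j q.1) q.2.1 i q.2.2 := by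
    intro i
    have h1 : Continuous fun q : Uset ι A Set.univ × (I × X) => H (j q.1) q.2.1 :=
      hH.comp (by fun_prop : Continuous fun q : Uset ι A Set.univ × (I × X) => (j q.1, q.2.1))
    exact continuous_eval.comp (by fun_prop : Continuous fun q : Uset ι A Set.univ × (I × X) =>
      (H (j q.1) q.2.1 i, q.2.2))
  let c0 : Uset ι A Set.univ → ι → C(I × X, ℂ) := fun y i =>
    ⟨fun p => H (j y) p.1 i p.2, (hcc i).comp (by fun_prop : Continuous fun p : I × X => (y, p))⟩
  have hc0 : Continuous c0 := continuous_pi fun i =>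
    ContinuousMap.continuous_of_continuous_uncurry _ (hcc i)
  have hsl : ∀ y t, slv t (c0 y) = H (j y) t := fun y t => rfl
  have hcB : ∀ y, c0 y ∈ Uset ι (tB T0 A B) Set.univ := by
    intro y
    refine ⟨fun i => mem_tB.2 ⟨fun t => (hHB (j y) t).1 i, fun t ht => ?_⟩, ?_⟩
    · rcases ht with rfl | rfl
      · exact (hH0 (j y)).1 i
      · change H (j y) 1 i ∈ A
        rw [hH1]
        exact y.2.1 i
    · rintro ⟨t, x⟩ -
      exact (hHB (j y) t).2 x trivial
  let c : Uset ι A Set.univ → Uset ι (tB T0 A B) Set.univ := fun y => ⟨c0 y, hcB y⟩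
  have hc : Continuous c := hc0.subtype_mk _
  refine ⟨fun y t => slv (prI (3 * t - 1)) (H' (c y) (max (prI (1 - 3 * t)) (prI (3 * t - 2)))),
    ?_, ?_, ?_, ?_⟩
  · have h1 : Continuous fun p : Uset ι A Set.univ × I =>
        max (prI (1 - 3 * (p.2 : ℝ))) (prI (3 * (p.2 : ℝ) - 2)) :=
      (prI_continuous.comp (by fun_prop)).max (prI_continuous.comp (by fun_prop))
    have h2 : Continuous fun p : Uset ι A Set.univ × I => prI (3 * (p.2 : ℝ) - 1) :=
      prI_continuous.comp (by fun_prop)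
    exact slv_cont.comp (h2.prodMk (hH'.comp ((hc.comp continuous_fst).prodMk h1)))
  · intro y t
    dsimp only
    rcases le_total (3 * (t : ℝ)) 1 with h | h
    · rw [prI_of_le (by linarith : 3 * (t : ℝ) - 1 ≤ 0)]
      exact slv_mem_A (hHB' _ _) (Or.inl rfl)
    · rcases le_total (3 * (t : ℝ)) 2 with h' | h'
      · rw [prI_of_le (by linarith : 3 * (t : ℝ) - 2 ≤ 0), prI_of_le (by linarith : 1 - 3 * (t : ℝ) ≤ 0),
          max_self]
        exact slv_mem_A' (hH0' _) _
      · rw [prI_of_ge (by linarith : 1 ≤ 3 * (t : ℝ) - 1)]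
        exact slv_mem_A (hHB' _ _) (Or.inr rfl)
  · intro y
    have e0 : ((0 : I) : ℝ) = 0 := rfl
    dsimp only
    rw [e0, prI_of_le (by norm_num : 3 * (0 : ℝ) - 1 ≤ 0), prI_of_ge (by norm_num : 1 ≤ 1 - 3 * (0 : ℝ)),
      prI_of_le (by norm_num : 3 * (0 : ℝ) - 2 ≤ 0), max_eq_left zero_le_one, hH1', hsl]
  · intro y
    have e0 : ((1 : I) : ℝ) = 1 := rfl
    dsimp only
    rw [e0, prI_of_ge (by norm_num : 1 ≤ 3 * (1 : ℝ) - 1), prI_of_le (by norm_num : 1 - 3 * (1 : ℝ) ≤ 0),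
      prI_of_ge (by norm_num : 1 ≤ 3 * (1 : ℝ) - 2), max_eq_right zero_le_one, hH1', hsl, hH1]

end admS

end

section
open Topology
set_option linter.unusedSectionVars false

section gel
open WeakDual
variable (A : Type*) [NormedCommRing A] [NormedAlgebra ℂ A] [CompleteSpace A]

/-- closure of the image of the Gelfand transform -/
noncomputable def gA : Subalgebra ℂ C(characterSpace ℂ A, ℂ) :=
  (gelfandTransform ℂ A).range.topologicalClosure

theorem gelfand_mem (a : A) : gelfandTransform ℂ A a ∈ gA A :=
  Subalgebra.le_topologicalClosure _ ⟨a, rfl⟩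

theorem gelfand_norm_le (a : A) : ‖gelfandTransform ℂ A a‖ ≤ ‖a‖ * ‖(1 : A)‖ := by
  rw [ContinuousMap.norm_le _ (by positivity)]
  intro χ
  exact AlgHom.norm_apply_le_self_mul_norm_one χ a

theorem gelfand_cont : Continuous (gelfandTransform ℂ A) := by
  refine AddMonoidHomClass.continuous_of_bound (gelfandTransform ℂ A) ‖(1 : A)‖ fun a => ?_
  rw [mul_comm]
  exact gelfand_norm_le A a

theorem gA_natural : Natural (gA A) := by
  intro χ hχ
  have hc : Continuous χ := AddMonoidHomClass.continuous_of_bound χ 1 (fun a => (hχ a).trans_eq (one_mul _).symm)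
  let χ' : A →ₐ[ℂ] ℂ := χ.comp ((gelfandTransform ℂ A).codRestrict (gA A) (gelfand_mem A))
  let x : characterSpace ℂ A := CharacterSpace.equivAlgHom.symm χ'
  have hx : ∀ a, χ ⟨gelfandTransform ℂ A a, gelfand_mem A a⟩ = gelfandTransform ℂ A a x := fun a => rfl
  refine ⟨x, ?_⟩
  rintro ⟨a, ha⟩
  have hev : Continuous fun a : gA A => (a : C(characterSpace ℂ A, ℂ)) x :=
    (continuous_eval_const x).comp continuous_subtype_val
  obtain ⟨u, hu, hul⟩ := mem_closure_iff_seq_limit.1 (show a ∈ closure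
    ((gelfandTransform ℂ A).range : Set C(characterSpace ℂ A, ℂ)) from ha)
  choose v hv using hu
  have hlim : Filter.Tendsto (fun n => (⟨gelfandTransform ℂ A (v n), gelfand_mem A (v n)⟩ : gA A)) Filter.atTop
    (𝓝 ⟨a, ha⟩) := tendsto_subtype_rng.2 (hul.congr fun n => (hv n).symm)
  have h1 := (hc.tendsto _).comp hlim
  have h2 := (hev.tendsto _).comp hlim
  refine tendsto_nhds_unique h1 (h2.congr fun n => ?_)
  exact (hx _).symm

theorem gA_adm : Adm (gA A) ⊤ where
  clA := Subalgebra.isClosed_topologicalClosure _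
  clB := isClosed_univ
  le := le_top
  nat := gA_natural A
  gen := by
    let S : Set C(characterSpace ℂ A, ℂ) := {g | g ∈ gA A ∧ reC g ∈ (⊤ : Subalgebra ℂ C(characterSpace ℂ A, ℂ))}
    let s : Set C(characterSpace ℂ A, ℂ) := Set.range (gelfandTransform ℂ A)
    let D : StarSubalgebra ℂ C(characterSpace ℂ A, ℂ) := StarAlgebra.adjoin ℂ s
    have hs : ∀ g ∈ s, g ∈ gA A := by
      rintro _ ⟨a, rfl⟩
      exact gelfand_mem A a
    have hD : D.toSubalgebra ≤ extA (gA A) S := by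
      rw [StarAlgebra.adjoin_toSubalgebra]
      refine Algebra.adjoin_le ?_
      rintro g (hg | hg)
      · exact le_extA _ _ (hs g hg)
      · have h1 := hs _ hg
        have e : g = (2 : ℂ) • reC (star g) - star g := by
          ext x
          apply Complex.ext <;> simp [reC]
          ring
        rw [e]
        exact sub_mem (Subalgebra.smul_mem _ (re_mem_extA _ (⟨h1, trivial⟩ : star g ∈ S)) _)
          (le_extA _ _ h1)
    have htop : D.topologicalClosure = ⊤ := by
      refine ContinuousMap.starSubalgebra_topologicalClosure_eq_top_of_separatesPoints D ?_
      intro x y hxy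
      by_contra hcon
      push Not at hcon
      refine hxy (Subtype.ext (ContinuousLinearMap.ext fun a => ?_))
      exact hcon (gelfandTransform ℂ A a) ⟨_, StarAlgebra.subset_adjoin ℂ _ ⟨a, rfl⟩, rfl⟩
    intro b _
    have hb : b ∈ D.topologicalClosure := by rw [htop]; trivial
    have hb' : b ∈ closure (D : Set C(characterSpace ℂ A, ℂ)) := by
      rwa [← StarSubalgebra.topologicalClosure_coe]
    exact closure_minimal (fun c hc => hD hc) (extA_closed _ _) hb'

end gel

end

section
open Topology
set_option linter.unusedSectionVars false
open scoped unitInterval Matrix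

section comps

/-- path components of nested subspaces -/
theorem pc_homeo {V : Type*} [TopologicalSpace V] (P Q : V → Prop) (hPQ : ∀ x, P x → Q x)
    (hpath : ∀ γ : I → V, Continuous γ → (∀ t, Q (γ t)) → P (γ 0) → ∀ t, P (γ t))
    (e : V) (hP : P e) :
    ∃ θ : pathComponent (⟨e, hP⟩ : {x // P x}) ≃ₜ pathComponent (⟨e, hPQ e hP⟩ : {x // Q x}),
      ∀ p, (θ p).1.1 = p.1.1 := by
  have hPP : ∀ q : pathComponent (⟨e, hPQ e hP⟩ : {x // Q x}), ∃ h : P q.1.1,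
      (⟨q.1.1, h⟩ : {x // P x}) ∈ pathComponent (⟨e, hP⟩ : {x // P x}) := by
    rintro ⟨⟨q, hq⟩, ⟨γ⟩⟩
    have h0 : (γ 0).1 = e := by rw [γ.source]
    have h1 : (γ 1).1 = q := by rw [γ.target]
    have h := hpath (fun t => (γ t).1) (continuous_subtype_val.comp γ.continuous) (fun t => (γ t).2)
      (by rw [h0]; exact hP)
    have hq' : P q := h1 ▸ h 1
    refine ⟨hq', ⟨⟨⟨fun t => ⟨(γ t).1, h t⟩, ?_⟩, ?_, ?_⟩⟩⟩
    · exact (continuous_subtype_val.comp γ.continuous).subtype_mk _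
    · exact Subtype.ext h0
    · exact Subtype.ext h1
  have hQQ : ∀ p : pathComponent (⟨e, hP⟩ : {x // P x}),
      (⟨p.1.1, hPQ _ p.1.2⟩ : {x // Q x}) ∈ pathComponent (⟨e, hPQ e hP⟩ : {x // Q x}) := by
    rintro ⟨⟨p, hp⟩, ⟨γ⟩⟩
    exact ⟨γ.map (f := fun x : {x // P x} => (⟨x.1, hPQ _ x.2⟩ : {x // Q x})) (by fun_prop)⟩
  refine ⟨⟨⟨fun p => ⟨_, hQQ p⟩, fun q => ⟨_, (hPP q).2⟩, fun p => rfl, fun q => rfl⟩, ?_, ?_⟩, fun p => rfl⟩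
  · exact Continuous.subtype_mk (Continuous.subtype_mk
      (continuous_subtype_val.comp continuous_subtype_val) _) _
  · exact Continuous.subtype_mk (Continuous.subtype_mk
      (continuous_subtype_val.comp continuous_subtype_val) _) _

theorem restrict_htpy {U : Type*} [TopologicalSpace U] {k : C(U, U)}
    (hk : k.Homotopic (ContinuousMap.id U)) (a : U) (k0 : C(pathComponent a, pathComponent a))
    (h0 : ∀ p, (k0 p).1 = k p.1) : k0.Homotopic (ContinuousMap.id _) := by
  obtain ⟨F⟩ := hk
  have hF : ∀ (t : I) (p : pathComponent a), F (t, p.1) ∈ pathComponent a := by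
    intro t p
    have h1 : Joined p.1 (F (t, p.1)) := by
      refine Joined.symm ⟨⟨⟨fun s => F (⟨max t s, ?_⟩, p.1), ?_⟩, ?_, ?_⟩⟩
      · exact ⟨le_max_of_le_left t.2.1, max_le t.2.2 s.2.2⟩
      · exact F.continuous.comp (by fun_prop)
      · have : (⟨max (t : ℝ) ((0 : I) : ℝ), le_max_of_le_left t.2.1, max_le t.2.2 (0 : I).2.2⟩ : I) = t :=
          Subtype.ext (max_eq_left t.2.1)
        dsimp only
        rw [this]
      · have : (⟨max (t : ℝ) ((1 : I) : ℝ), le_max_of_le_left t.2.1, max_le t.2.2 (1 : I).2.2⟩ : I) = 1 :=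
          Subtype.ext (max_eq_right t.2.2)
        dsimp only
        rw [this, F.apply_one]; rfl
    exact Joined.trans p.2 h1
  refine ⟨⟨⟨fun q => ⟨F (q.1, q.2.1), hF _ _⟩, ?_⟩, ?_, ?_⟩⟩
  · exact Continuous.subtype_mk (F.continuous.comp (by fun_prop)) _
  · intro p
    refine Subtype.ext ?_
    rw [h0]
    exact F.apply_zero _
  · intro p
    refine Subtype.ext ?_
    exact F.apply_one _

theorem restrict_equiv {U W : Type*} [TopologicalSpace U] [TopologicalSpace W] (f : C(U, W))
    (g : C(W, U)) (h1 : (g.comp f).Homotopic (ContinuousMap.id U))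
    (h2 : (f.comp g).Homotopic (ContinuousMap.id W)) (a : U) (b : W) (hab : f a = b) :
    ∃ (f0 : C(pathComponent a, pathComponent b)) (g0 : C(pathComponent b, pathComponent a)),
      (∀ p, (f0 p).1 = f p.1) ∧ (g0.comp f0).Homotopic (ContinuousMap.id _) ∧
      (f0.comp g0).Homotopic (ContinuousMap.id _) := by
  have hf : ∀ p : pathComponent a, f p.1 ∈ pathComponent b := by
    rintro ⟨p, ⟨γ⟩⟩
    rw [← hab]
    exact ⟨γ.map f.continuous⟩
  have hga : Joined a (g b) := by
    obtain ⟨F⟩ := h1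
    rw [← hab]
    refine Joined.symm ⟨⟨⟨fun s => F (s, a), F.continuous.comp (by fun_prop)⟩, F.apply_zero a, F.apply_one a⟩⟩
  have hg : ∀ p : pathComponent b, g p.1 ∈ pathComponent a := by
    rintro ⟨p, ⟨γ⟩⟩
    exact hga.trans ⟨γ.map g.continuous⟩
  let f0 : C(pathComponent a, pathComponent b) :=
    ⟨fun p => ⟨f p.1, hf p⟩, (f.continuous.comp continuous_subtype_val).subtype_mk _⟩
  let g0 : C(pathComponent b, pathComponent a) :=
    ⟨fun p => ⟨g p.1, hg p⟩, (g.continuous.comp continuous_subtype_val).subtype_mk _⟩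
  exact ⟨f0, g0, fun p => rfl, restrict_htpy h1 a _ fun p => rfl, restrict_htpy h2 b _ fun p => rfl⟩

end comps

section lc
variable {ι : Type*} [Fintype ι] [DecidableEq ι]
variable {R : Type*} [NormedCommRing R] [CompleteSpace R]

theorem lc_local (e x y : ι → R) (hy : ∑ i, y i * x i = 1) :
    ∀ᶠ x' in 𝓝 x, ((∃ u : Matrix ι ι R, IsUnit u ∧ u *ᵥ e = x') ↔
      ∃ u : Matrix ι ι R, IsUnit u ∧ u *ᵥ e = x) := by
  let M : (ι → R) → Matrix ι ι R := fun x' => 1 + Matrix.vecMulVec (x' - x) y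
  have hM : Continuous fun x' => (M x').det := by
    refine Continuous.matrix_det ?_
    exact continuous_const.add ((continuous_id.sub continuous_const).matrix_vecMulVec continuous_const)
  have hx : (M x).det = 1 := by simp [M]
  have hMx : ∀ x', M x' *ᵥ x = x' := by
    intro x'
    have : y ⬝ᵥ x = 1 := hy
    simp only [M]
    rw [Matrix.add_mulVec, Matrix.one_mulVec, Matrix.vecMulVec_mulVec, this]
    simp
  have hev : ∀ᶠ x' in 𝓝 x, IsUnit (M x').det := by
    refine hM.continuousAt.eventually (p := fun r => IsUnit r) ?_
    dsimp only
    rw [hx]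
    exact Units.isOpen.mem_nhds isUnit_one
  filter_upwards [hev] with x' hx'
  have hu : IsUnit (M x') := (Matrix.isUnit_iff_isUnit_det _).2 hx'
  constructor
  · rintro ⟨u, hu', h⟩
    obtain ⟨m, hm⟩ := hu
    refine ⟨(m⁻¹).1 * u, (m⁻¹).isUnit.mul hu', ?_⟩
    rw [← Matrix.mulVec_mulVec, h]
    conv_lhs => rw [← hMx x']
    rw [← hm, Matrix.mulVec_mulVec, Units.inv_mul, Matrix.one_mulVec]
  · rintro ⟨u, hu', h⟩
    refine ⟨M x' * u, hu.mul hu', ?_⟩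
    rw [← Matrix.mulVec_mulVec, h, hMx]

theorem lc_path (e : ι → R) (γ : I → ι → R) (hγ : Continuous γ)
    (hQ : ∀ t, ∃ y : ι → R, ∑ i, y i * γ t i = 1)
    (h0 : ∃ u : Matrix ι ι R, IsUnit u ∧ u *ᵥ e = γ 0) (t : I) :
    ∃ u : Matrix ι ι R, IsUnit u ∧ u *ᵥ e = γ t := by
  refine clopen_all (fun t => ∃ u : Matrix ι ι R, IsUnit u ∧ u *ᵥ e = γ t) ?_ h0 t
  intro t₀
  obtain ⟨y, hy⟩ := hQ t₀
  exact hγ.continuousAt.eventually (lc_local e (γ t₀) y hy)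

theorem lc_unimod {k : ι} {x : ι → R} (h : ∃ u : Matrix ι ι R, IsUnit u ∧ u *ᵥ Pi.single k 1 = x) :
    ∃ y : ι → R, ∑ i, y i * x i = 1 := by
  obtain ⟨_, ⟨u, rfl⟩, rfl⟩ := h
  refine ⟨fun i => (u⁻¹).1 k i, ?_⟩
  have : (u⁻¹).1 *ᵥ (u.1 *ᵥ Pi.single k 1) = Pi.single k 1 := by
    rw [Matrix.mulVec_mulVec, Units.inv_mul, Matrix.one_mulVec]
  have h := congrFun this k
  rw [Pi.single_eq_same] at h
  exact h

end lc

end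

section
open Topology
set_option linter.unusedSectionVars false
open scoped unitInterval Matrix

section fin
open WeakDual
universe u
variable {ι : Type} [Fintype ι] [DecidableEq ι]
variable {A : Type u} [NormedCommRing A] [NormedAlgebra ℂ A] [CompleteSpace A]

/-- coordinatewise Gelfand transform -/
noncomputable def Phi (a : ι → A) : ι → C(characterSpace ℂ A, ℂ) := fun i => gelfandTransform ℂ A (a i)

theorem Phi_cont : Continuous (Phi : (ι → A) → ι → C(characterSpace ℂ A, ℂ)) :=
  continuous_pi fun i => (gelfand_cont A).comp (continuous_apply i)

/-- unimodular vectors -/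
def UA (ι : Type) (A : Type u) [NormedCommRing A] [NormedAlgebra ℂ A] [CompleteSpace A] :
    Set (ι → A) := {a | ∀ χ, evv (Phi a) χ ≠ 0}

theorem mem_UA_gA {a : ι → A} (ha : a ∈ UA ι A) : Phi a ∈ Uset ι (gA A) Set.univ :=
  ⟨fun i => gelfand_mem A (a i), fun x _ => ha x⟩

theorem mem_UA_top {a : ι → A} (ha : a ∈ UA ι A) :
    Phi a ∈ Uset ι (⊤ : Subalgebra ℂ C(characterSpace ℂ A, ℂ)) Set.univ :=
  ⟨fun i => trivial, fun x _ => ha x⟩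

theorem evv_sub_le {X : Type*} [TopologicalSpace X] [CompactSpace X] (b z : ι → C(X, ℂ)) (x : X) :
    ‖evv b x - evv z x‖ ≤ ‖b - z‖ := by
  refine (pi_norm_le_iff_of_nonneg (norm_nonneg _)).2 fun i => ?_
  exact ((b i - z i).norm_coe_le_norm x).trans (norm_le_pi_norm (b - z) i)

theorem Phi_comb (a b : ι → A) (s t : ℝ) (χ : characterSpace ℂ A) :
    evv (Phi ((s : ℂ) • a + (t : ℂ) • b)) χ = s • evv (Phi a) χ + t • evv (Phi b) χ := by
  funext i
  change χ ((s : ℂ) • a i + (t : ℂ) • b i) = s • χ (a i) + t • χ (b i)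
  rw [map_add, map_smul, map_smul]
  rfl

theorem dense_sel : ∃ ψ : C(Uset ι (gA A) Set.univ, ι → A),
    ∀ y χ, ‖evv (Phi (ψ y)) χ - evv y.1 χ‖ < ‖evv y.1 χ‖ := by
  let _ : NormedSpace ℝ A := NormedSpace.restrictScalars ℝ ℂ A
  refine exists_continuous_forall_mem_convex_of_local_const (X := Uset ι (gA A) Set.univ)
    (E := ι → A) (t := fun y => {a | ∀ χ, ‖evv (Phi a) χ - evv y.1 χ‖ < ‖evv y.1 χ‖}) ?_ ?_
  · intro y a ha b hb s t hs ht hst χ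
    have e := Phi_comb a b s t χ
    have e' : s • a + t • b = (s : ℂ) • a + (t : ℂ) • b := rfl
    rw [e', e]
    exact mem_ball_iff_norm.1 (convex_ball (evv y.1 χ) ‖evv y.1 χ‖ (mem_ball_iff_norm.2 (ha χ))
      (mem_ball_iff_norm.2 (hb χ)) hs ht hst)
  · intro y
    obtain ⟨c, hc, hcy⟩ := exists_lower isClosed_univ (evv y.1) (evv_continuous y.1) y.2.2
    have hap : ∀ i, ∃ a : A, ‖gelfandTransform ℂ A a - y.1 i‖ < c / 4 := by
      intro i
      obtain ⟨_, ⟨a, rfl⟩, ha⟩ := Metric.mem_closure_iff.1 (show y.1 i ∈ closure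
        ((gelfandTransform ℂ A).range : Set C(characterSpace ℂ A, ℂ)) from y.2.1 i) (c / 4) (by positivity)
      refine ⟨a, ?_⟩
      rw [dist_comm, dist_eq_norm] at ha
      exact ha
    choose a ha using hap
    refine ⟨a, ?_⟩
    have h1 : ‖Phi a - y.1‖ < c / 4 := (pi_norm_lt_iff (by positivity)).2 ha
    filter_upwards [Metric.ball_mem_nhds y (by positivity : 0 < c / 4)] with y' hy' χ
    have h2 : ‖y'.1 - y.1‖ < c / 4 := by
      rw [← dist_eq_norm]; exact hy'
    have h3 := evv_sub_le (Phi a) y.1 χ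
    have h4 := evv_sub_le y'.1 y.1 χ
    have h5 := hcy χ trivial
    have h6 : ‖evv (Phi a) χ - evv y'.1 χ‖ ≤ ‖evv (Phi a) χ - evv y.1 χ‖ + ‖evv y'.1 χ - evv y.1 χ‖ := by
      have e : evv (Phi a) χ - evv y'.1 χ = (evv (Phi a) χ - evv y.1 χ) - (evv y'.1 χ - evv y.1 χ) := by abel
      rw [e]; exact norm_sub_le _ _
    have h7 : ‖evv y.1 χ‖ ≤ ‖evv y'.1 χ‖ + ‖evv y'.1 χ - evv y.1 χ‖ := by
      have e : evv y.1 χ = evv y'.1 χ - (evv y'.1 χ - evv y.1 χ) := by abel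
      conv_lhs => rw [e]
      exact norm_sub_le _ _
    linarith

/-- the Gelfand map on unimodular vectors -/
noncomputable def fU : C(UA ι A, Uset ι (⊤ : Subalgebra ℂ C(characterSpace ℂ A, ℂ)) Set.univ) :=
  ⟨fun a => ⟨Phi a.1, mem_UA_top a.2⟩, (Phi_cont.comp continuous_subtype_val).subtype_mk _⟩

theorem unimod_equiv : ∃ g : C(Uset ι (⊤ : Subalgebra ℂ C(characterSpace ℂ A, ℂ)) Set.univ, UA ι A),
    (g.comp fU).Homotopic (ContinuousMap.id _) ∧ (fU.comp g).Homotopic (ContinuousMap.id _) := by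
  obtain ⟨H, ⟨hH, hHB, hH0, hH1⟩, K, hK, hKA, hK0, hK1⟩ := adm_equiv (ι := ι) (gA_adm A)
  obtain ⟨ψ, hψ⟩ := dense_sel (ι := ι) (A := A)
  let UB := Uset ι (⊤ : Subalgebra ℂ C(characterSpace ℂ A, ℂ)) Set.univ
  have hψU : ∀ y, ψ y ∈ UA ι A := fun y χ => ne_zero_of_near (hψ y χ)
  let h0 : C(UB, Uset ι (gA A) Set.univ) := ⟨fun z => ⟨H z 0, hH0 z⟩,
    (hH.comp (by fun_prop : Continuous fun z : UB => (z, (0 : I)))).subtype_mk _⟩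
  let ψ0 : C(Uset ι (gA A) Set.univ, UA ι A) := ⟨fun y => ⟨ψ y, hψU y⟩, ψ.continuous.subtype_mk _⟩
  let jU : C(Uset ι (gA A) Set.univ, UB) := ⟨fun y => ⟨y.1, fun i => trivial, y.2.2⟩,
    continuous_subtype_val.subtype_mk _⟩
  let fA : C(UA ι A, Uset ι (gA A) Set.univ) :=
    ⟨fun a => ⟨Phi a.1, mem_UA_gA a.2⟩, (Phi_cont.comp continuous_subtype_val).subtype_mk _⟩
  have hff : fU = jU.comp fA := rfl
  -- first homotopies
  have k1 : (jU.comp h0).Homotopic (ContinuousMap.id UB) := by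
    refine ⟨⟨⟨fun p => ⟨H p.2 p.1, hHB _ _⟩, ?_⟩, ?_, ?_⟩⟩
    · exact (hH.comp (by fun_prop : Continuous fun p : I × UB => (p.2, p.1))).subtype_mk _
    · intro z; rfl
    · intro z; exact Subtype.ext (hH1 z)
  have k2 : (h0.comp jU).Homotopic (ContinuousMap.id _) := by
    refine ⟨⟨⟨fun p => ⟨K p.2 p.1, hKA _ _⟩, ?_⟩, ?_, ?_⟩⟩
    · exact (hK.comp (by fun_prop : Continuous fun p : I × Uset ι (gA A) Set.univ =>
        (p.2, p.1))).subtype_mk _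
    · intro z; exact Subtype.ext (hK0 z)
    · intro z; exact Subtype.ext (hK1 z)
  have k3 : (fA.comp ψ0).Homotopic (ContinuousMap.id _) := by
    refine ⟨⟨⟨fun p => ⟨((1 - (p.1 : ℝ) : ℝ) : ℂ) • Phi (ψ p.2) + ((p.1 : ℝ) : ℂ) • p.2.1, ?_, ?_⟩, ?_⟩, ?_, ?_⟩⟩
    · intro i
      exact add_mem (Subalgebra.smul_mem _ (gelfand_mem A _) _) (Subalgebra.smul_mem _ (p.2.2.1 i) _)
    · intro χ _
      have e : evv (((1 - (p.1 : ℝ) : ℝ) : ℂ) • Phi (ψ p.2) + ((p.1 : ℝ) : ℂ) • p.2.1) χ =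
        (1 - (p.1 : ℝ)) • evv (Phi (ψ p.2)) χ + (p.1 : ℝ) • evv p.2.1 χ := by
        funext i; simp [evv]
      rw [e]
      refine ne_zero_of_near (w := evv p.2.1 χ) (mem_ball_iff_norm.1 (convex_ball _ _
        (mem_ball_iff_norm.2 (hψ p.2 χ)) (Metric.mem_ball_self
          (norm_pos_iff.2 (p.2.2.2 χ trivial))) ?_ p.1.2.1 (by ring)))
      linarith [p.1.2.2]
    · refine Continuous.subtype_mk ?_ _
      have := Phi_cont (ι := ι) (A := A)
      fun_prop
    · intro y
      refine Subtype.ext ?_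
      simp [fA, ψ0]
      funext i
      exact zero_smul ℂ (y.1 i)
    · intro y
      refine Subtype.ext ?_
      simp
      funext i
      exact zero_smul ℂ (Phi (ψ y) i)
  have k4 : (ψ0.comp fA).Homotopic (ContinuousMap.id _) := by
    refine ⟨⟨⟨fun p => ⟨((1 - (p.1 : ℝ) : ℝ) : ℂ) • ψ (fA p.2) + ((p.1 : ℝ) : ℂ) • p.2.1, ?_⟩, ?_⟩, ?_, ?_⟩⟩
    · intro χ
      rw [Phi_comb]
      refine ne_zero_of_near (w := evv (Phi p.2.1) χ) (mem_ball_iff_norm.1 (convex_ball _ _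
        (mem_ball_iff_norm.2 (hψ (fA p.2) χ)) (Metric.mem_ball_self
          (norm_pos_iff.2 (p.2.2 χ))) ?_ p.1.2.1 (by ring)))
      linarith [p.1.2.2]
    · refine Continuous.subtype_mk ?_ _
      fun_prop
    · intro y
      refine Subtype.ext ?_
      simp [ψ0]
    · intro y
      refine Subtype.ext ?_
      simp
  refine ⟨ψ0.comp h0, ?_, ?_⟩
  · have s1 : (ψ0.comp ((h0.comp jU).comp fA)).Homotopic (ψ0.comp ((ContinuousMap.id _).comp fA)) :=
      (ContinuousMap.Homotopic.refl ψ0).comp (k2.comp (ContinuousMap.Homotopic.refl fA))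
    exact s1.trans k4
  · have s1 : (jU.comp ((fA.comp ψ0).comp h0)).Homotopic (jU.comp ((ContinuousMap.id _).comp h0)) :=
      (ContinuousMap.Homotopic.refl jU).comp (k3.comp (ContinuousMap.Homotopic.refl h0))
    exact s1.trans k1

end fin

end

section final1
open WeakDual Matrix Topology
universe u
variable {ι : Type} [Fintype ι] [DecidableEq ι]
variable {A : Type u} [NormedCommRing A] [NormedAlgebra ℂ A] [CompleteSpace A]

theorem Phi_single (k : ι) : Phi (Pi.single k (1 : A)) = Pi.single k 1 := by
  funext i
  by_cases h : i = k
  · subst h; simp [Phi]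
  · simp [Phi, h]

theorem Phi_lc (k : ι) (x : ι → A) (h : ∃ u : Matrix ι ι A, IsUnit u ∧ u *ᵥ Pi.single k 1 = x) :
    ∃ v : Matrix ι ι C(characterSpace ℂ A, ℂ), IsUnit v ∧ v *ᵥ Pi.single k 1 = Phi x := by
  obtain ⟨u, hu, rfl⟩ := h
  let φ : A →+* C(characterSpace ℂ A, ℂ) := (gelfandTransform ℂ A).toRingHom
  have h1 : Phi (u *ᵥ Pi.single k 1) = φ ∘ (u *ᵥ Pi.single k 1) := rfl
  have h2 : Phi (Pi.single k (1 : A)) = φ ∘ Pi.single k 1 := rfl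
  refine ⟨u.map φ, isUnit_map_matrix φ hu, ?_⟩
  rw [h1, map_mulVec', ← h2, Phi_single]

theorem conj_equiv {U V U' V' : Type*} [TopologicalSpace U] [TopologicalSpace V]
    [TopologicalSpace U'] [TopologicalSpace V'] (θA : U ≃ₜ U') (θB : V ≃ₜ V') (f0 : C(U', V'))
    (g0 : C(V', U')) (k1 : (g0.comp f0).Homotopic (ContinuousMap.id _))
    (k2 : (f0.comp g0).Homotopic (ContinuousMap.id _)) :
    ∃ F : C(U, V), (∀ p, θB (F p) = f0 (θA p)) ∧ ∃ G : C(V, U),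
      (G.comp F).Homotopic (ContinuousMap.id _) ∧ (F.comp G).Homotopic (ContinuousMap.id _) := by
  let tA : C(U, U') := ⟨θA, θA.continuous⟩
  let tA' : C(U', U) := ⟨θA.symm, θA.symm.continuous⟩
  let tB : C(V, V') := ⟨θB, θB.continuous⟩
  let tB' : C(V', V) := ⟨θB.symm, θB.symm.continuous⟩
  have iA : tA.comp tA' = ContinuousMap.id _ := ContinuousMap.ext θA.apply_symm_apply
  have iA' : tA'.comp tA = ContinuousMap.id _ := ContinuousMap.ext θA.symm_apply_apply
  have iB : tB.comp tB' = ContinuousMap.id _ := ContinuousMap.ext θB.apply_symm_apply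
  have iB' : tB'.comp tB = ContinuousMap.id _ := ContinuousMap.ext θB.symm_apply_apply
  refine ⟨tB'.comp (f0.comp tA), fun p => ?_, tA'.comp (g0.comp tB), ?_, ?_⟩
  · exact θB.apply_symm_apply _
  · have s : (tA'.comp ((g0.comp f0).comp tA)).Homotopic (tA'.comp ((ContinuousMap.id _).comp tA)) :=
      (ContinuousMap.Homotopic.refl tA').comp (k1.comp (ContinuousMap.Homotopic.refl tA))
    rw [ContinuousMap.id_comp, iA'] at s
    have e : (tA'.comp (g0.comp tB)).comp (tB'.comp (f0.comp tA)) =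
        tA'.comp ((g0.comp f0).comp tA) := by
      have : (tA'.comp (g0.comp tB)).comp (tB'.comp (f0.comp tA)) =
        tA'.comp ((g0.comp ((tB.comp tB').comp f0)).comp tA) := rfl
      rw [this, iB, ContinuousMap.id_comp]
    rw [e]; exact s
  · have s : (tB'.comp ((f0.comp g0).comp tB)).Homotopic (tB'.comp ((ContinuousMap.id _).comp tB)) :=
      (ContinuousMap.Homotopic.refl tB').comp (k2.comp (ContinuousMap.Homotopic.refl tB))
    rw [ContinuousMap.id_comp, iB'] at s
    have e : (tB'.comp (f0.comp tA)).comp (tA'.comp (g0.comp tB)) =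
        tB'.comp ((f0.comp g0).comp tB) := by
      have : (tB'.comp (f0.comp tA)).comp (tA'.comp (g0.comp tB)) =
        tB'.comp ((f0.comp ((tA.comp tA').comp g0)).comp tB) := rfl
      rw [this, iA, ContinuousMap.id_comp]
    rw [e]; exact s

theorem lc_UA (k : ι) (x : ι → A) (h : ∃ u : Matrix ι ι A, IsUnit u ∧ u *ᵥ Pi.single k 1 = x) :
    x ∈ UA ι A := by
  obtain ⟨y, hy⟩ := lc_unimod h
  intro χ h0
  have h1 := congrArg χ hy
  have h2 : ∀ i, χ (x i) = 0 := fun i => congrFun h0 i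
  simp [map_sum, h2] at h1

theorem UA_unimod {x : ι → A} (h : x ∈ UA ι A) : ∃ y : ι → A, ∑ i, y i * x i = 1 := by
  refine unit_ideal x fun χ => ?_
  by_contra hc
  push Not at hc
  exact h (CharacterSpace.equivAlgHom.symm χ) (funext hc)

variable {X : Type u} [TopologicalSpace X] [CompactSpace X]

theorem lc_UB (k : ι) (x : ι → C(X, ℂ))
    (h : ∃ u : Matrix ι ι C(X, ℂ), IsUnit u ∧ u *ᵥ Pi.single k 1 = x) :
    x ∈ Uset ι (⊤ : Subalgebra ℂ C(X, ℂ)) Set.univ := by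
  obtain ⟨y, hy⟩ := lc_unimod h
  refine ⟨fun i => trivial, fun χ _ h0 => ?_⟩
  have h1 := congrArg (fun f : C(X, ℂ) => f χ) hy
  have h2 : ∀ i, x i χ = 0 := fun i => congrFun h0 i
  simp [h2] at h1

theorem UB_unimod {x : ι → C(X, ℂ)} (h : x ∈ Uset ι (⊤ : Subalgebra ℂ C(X, ℂ)) Set.univ) :
    ∃ y : ι → C(X, ℂ), ∑ i, y i * x i = 1 := by
  have hu : IsUnit (∑ i, star (x i) * x i) := by
    rw [ContinuousMap.isUnit_iff_forall_ne_zero]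
    intro p hp
    refine h.2 p trivial (funext fun i => ?_)
    have e : (∑ i, star (x i) * x i) p = ((∑ i, ‖x i p‖ ^ 2 : ℝ) : ℂ) := by
      simp [Complex.conj_mul']
    rw [e] at hp
    have hp' : ∑ i, ‖x i p‖ ^ 2 = 0 := by exact_mod_cast hp
    have := (Finset.sum_eq_zero_iff_of_nonneg (fun i _ => by positivity)).1 hp' i (Finset.mem_univ i)
    exact norm_eq_zero.1 (pow_eq_zero_iff (two_ne_zero) |>.1 this)
  obtain ⟨v, hv⟩ := hu.exists_left_inv
  refine ⟨fun i => v * star (x i), ?_⟩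
  rw [← hv, Finset.mul_sum]
  exact Finset.sum_congr rfl fun i _ => mul_assoc _ _ _

end final1

open WeakDual Matrix

/-- Let `A` be a commutative unital complex Banach algebra and `n ≥ 1`
(size `n + 1 ≥ 1`).  The coordinatewise Gelfand transform maps `Lcₙ(A)` into
`Lcₙ(C(Max(A), ℂ))`, sends `eₙ` to `eₙ`, is continuous, and its restriction
`LΓₙ : Lcₙ(A)₀ → Lcₙ(C(Max(A), ℂ))₀` between the path components of `eₙ` is a homotopy
equivalence. -/
theorem stmt_10
    (A : Type*) [NormedCommRing A] [NormedAlgebra ℂ A] [CompleteSpace A] (n : ℕ) :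
    let B : Type _ := C(characterSpace ℂ A, ℂ)
    -- the coordinatewise Gelfand transform
    let Φ : (Fin (n + 1) → A) → (Fin (n + 1) → B) :=
      fun x i => WeakDual.gelfandTransform ℂ A (x i)
    -- the last standard basis vectors
    let eA : Fin (n + 1) → A := Pi.single (Fin.last n) 1
    let eB : Fin (n + 1) → B := Pi.single (Fin.last n) 1
    -- the spaces of last columns, as subspaces
    let LcA : Type _ := {x : Fin (n + 1) → A //
      ∃ u : Matrix (Fin (n + 1)) (Fin (n + 1)) A, IsUnit u ∧ u.mulVec eA = x}
    let LcB : Type _ := {x : Fin (n + 1) → B //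
      ∃ v : Matrix (Fin (n + 1)) (Fin (n + 1)) B, IsUnit v ∧ v.mulVec eB = x}
    -- the basepoints `eₙ`
    let a₀ : LcA := ⟨eA, 1, isUnit_one, Matrix.one_mulVec eA⟩
    let b₀ : LcB := ⟨eB, 1, isUnit_one, Matrix.one_mulVec eB⟩
    -- the path components `Lcₙ(A)₀` and `Lcₙ(C(Max(A), ℂ))₀` of the basepoints
    Continuous Φ ∧
    (∀ x : Fin (n + 1) → A,
      (∃ u : Matrix (Fin (n + 1)) (Fin (n + 1)) A, IsUnit u ∧ u.mulVec eA = x) →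
      (∃ v : Matrix (Fin (n + 1)) (Fin (n + 1)) B, IsUnit v ∧ v.mulVec eB = Φ x)) ∧
    Φ eA = eB ∧
    (∃ LΓ : C(pathComponent a₀, pathComponent b₀),
      (∀ p : pathComponent a₀, (LΓ p).1.1 = Φ p.1.1) ∧
      ∃ h : C(pathComponent b₀, pathComponent a₀),
        (h.comp LΓ).Homotopic (ContinuousMap.id _) ∧
        (LΓ.comp h).Homotopic (ContinuousMap.id _)) := by
  intro B Φ eA eB LcA LcB a₀ b₀
  have hE : Φ eA = eB := Phi_single (Fin.last n)
  refine ⟨Phi_cont, fun x hx => Phi_lc (Fin.last n) x hx, hE, ?_⟩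
  obtain ⟨θA, hA⟩ := pc_homeo (fun x : Fin (n + 1) → A =>
      ∃ u : Matrix (Fin (n + 1)) (Fin (n + 1)) A, IsUnit u ∧ u.mulVec eA = x)
    (fun x => x ∈ UA (Fin (n + 1)) A) (fun x hx => lc_UA (Fin.last n) x hx)
    (fun γ hγ hQ h0 t => lc_path eA γ hγ (fun t => UA_unimod (hQ t)) h0 t) eA a₀.2
  obtain ⟨θB, hB⟩ := pc_homeo (fun x : Fin (n + 1) → B =>
      ∃ u : Matrix (Fin (n + 1)) (Fin (n + 1)) B, IsUnit u ∧ u.mulVec eB = x)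
    (fun x => x ∈ Uset (Fin (n + 1)) (⊤ : Subalgebra ℂ C(characterSpace ℂ A, ℂ)) Set.univ)
    (fun x hx => lc_UB (Fin.last n) x hx)
    (fun γ hγ hQ h0 t => lc_path eB γ hγ (fun t => UB_unimod (hQ t)) h0 t) eB b₀.2
  obtain ⟨g, hg1, hg2⟩ := unimod_equiv (ι := Fin (n + 1)) (A := A)
  obtain ⟨f0, g0, hf0, k1, k2⟩ := restrict_equiv fU g hg1 hg2 ⟨eA, lc_UA (Fin.last n) eA a₀.2⟩
    ⟨eB, lc_UB (Fin.last n) eB b₀.2⟩ (Subtype.ext hE)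
  obtain ⟨F, hF, G, hG1, hG2⟩ := conj_equiv θA θB f0 g0 k1 k2
  refine ⟨F, fun p => ?_, G, hG1, hG2⟩
  have h1 := hB (F p)
  rw [hF] at h1
  have h3 := congrArg Subtype.val (hf0 (θA p))
  have h4 := hA p
  exact (h1.symm.trans h3).trans (congrArg Φ h4)
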